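/- Let μ be a singular cardinal. If pr₁(μ⁺, μ⁺, μ⁺, cf(μ)) fails, then there is a cardinal θ < μ such that for every cardinal σ < cf(μ) and every sequence ⟨S_α : α < σ⟩ of stationary subsets of {δ < μ⁺ : cf(δ) ≥ θ}, there is an ordinal δ < μ⁺ such that S_α ∩ δ is stationary in δ for every α < σ. -/

import Mathlib

noncomputable section

open Set

/-- The successor cardinal of `mu`, as an ordinal. -/
def sucOrd (mu : Cardinal) : Ordinal := (Order.succ mu).ord

/-- The cofinality of `mu`, as an ordinal. -/
def cofOrd (mu : Cardinal) : Ordinal := (Ordinal.cof mu.ord).ord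

/-- `mu` is a singular cardinal: infinite, with cofinality smaller than itself. -/
def IsSingular (mu : Cardinal) : Prop :=
  Cardinal.aleph0 ≤ mu ∧ Ordinal.cof mu.ord < mu

/-- `C` is unbounded below `lam`. -/
def UnbddIn (C : Set Ordinal) (lam : Ordinal) : Prop :=
  ∀ x < lam, ∃ y ∈ C, x ≤ y ∧ y < lam

/-- `C` is closed below `lam`: any accumulation point below `lam` belongs to `C`. -/
def ClosedIn (C : Set Ordinal) (lam : Ordinal) : Prop :=
  ∀ δ, δ < lam → 0 < δ → (∀ x < δ, ∃ y ∈ C, x < y ∧ y < δ) → δ ∈ C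

/-- `C` is a closed unbounded subset of `lam`. -/
def IsClubIn (C : Set Ordinal) (lam : Ordinal) : Prop :=
  C ⊆ Set.Iio lam ∧ ClosedIn C lam ∧ UnbddIn C lam

/-- `S` is a stationary subset of `lam`: it meets every closed unbounded subset of `lam`. -/
def IsStatIn (S : Set Ordinal) (lam : Ordinal) : Prop :=
  S ⊆ Set.Iio lam ∧ ∀ C, IsClubIn C lam → (S ∩ C).Nonempty

/-- The set of ordinals `t` has cardinality `< kappa`. -/
def CardLT (t : Set Ordinal) (kappa : Cardinal) : Prop :=
  (Cardinal.mk ↥t : Cardinal.{1}) < Cardinal.lift.{1, 0} kappa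

/-- `c` witnesses Shelah's principle `pr₁(μ⁺, μ⁺, σ, cf μ)`: for every sequence
`⟨t_α : α < μ⁺⟩` of pairwise disjoint subsets of `μ⁺`, each of size `< cf μ`, and every
color `ε < σ`, there are `α < β < μ⁺` with `c` constantly `ε` on pairs from `t_α × t_β`. -/
def Pr1With (mu sigma : Cardinal) (c : Ordinal → Ordinal → Ordinal) : Prop :=
  (∀ a b, a < b → b < sucOrd mu → c a b < sigma.ord) ∧
  ∀ t : Ordinal → Set Ordinal,
    (∀ a, a < sucOrd mu → t a ⊆ Set.Iio (sucOrd mu)) →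
    (∀ a b, a < sucOrd mu → b < sucOrd mu → a ≠ b → Disjoint (t a) (t b)) →
    (∀ a, a < sucOrd mu → CardLT (t a) (Ordinal.cof mu.ord)) →
    ∀ ε, ε < sigma.ord →
      ∃ α β, α < β ∧ β < sucOrd mu ∧
        ∀ ξ ∈ t α, ∀ ζ ∈ t β, c (min ξ ζ) (max ξ ζ) = ε

/-- Shelah's principle `pr₁(μ⁺, μ⁺, σ, cf μ)`. -/
def Pr1 (mu sigma : Cardinal) : Prop := ∃ c, Pr1With mu sigma c

/-- `(mus, f)` is a scale for the singular cardinal `mu`. -/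
structure IsScale (mu : Cardinal) (mus : Ordinal → Cardinal)
    (f : Ordinal → Ordinal → Ordinal) : Prop where
  regular : ∀ i, i < cofOrd mu → (mus i).IsRegular
  strictMono : ∀ i j, i < j → j < cofOrd mu → mus i < mus j
  le_mu : ∀ i, i < cofOrd mu → mus i ≤ mu
  unbdd : ∀ θ, θ < mu → ∃ i, i < cofOrd mu ∧ θ < mus i
  cof_lt : Ordinal.cof mu.ord < mus 0
  f_lt : ∀ α, α < sucOrd mu → ∀ i, i < cofOrd mu → f α i < (mus i).ord
  f_mono : ∀ α β, α < β → β < sucOrd mu →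
    ∃ i0, i0 < cofOrd mu ∧ ∀ i, i0 ≤ i → i < cofOrd mu → f α i < f β i
  f_cofinal : ∀ g : Ordinal → Ordinal, (∀ i, i < cofOrd mu → g i < (mus i).ord) →
    ∃ α, α < sucOrd mu ∧ ∃ i0, i0 < cofOrd mu ∧ ∀ i, i0 ≤ i → i < cofOrd mu → g i < f α i

/-- The minimal walk from `b` down to `a` along the C-sequence `e`:
`walk e a b 0 = b` and `walk e a b (n+1) = min (e (walk e a b n) \ a)`,
staying at `a` once it is reached. -/
def walk (e : Ordinal → Set Ordinal) (a b : Ordinal) : ℕ → Ordinal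
  | 0 => b
  | n + 1 => if walk e a b n = a then a else sInf (e (walk e a b n) ∩ Set.Ici a)

/-- `ρ₂(a,b)`: the length of the minimal walk from `b` to `a`, i.e. the least `n`
with `walk e a b n = a`. -/
def rho2 (e : Ordinal → Set Ordinal) (a b : Ordinal) : ℕ :=
  sInf {n : ℕ | walk e a b n = a}

/-- `β_i⁻(a,b)`: zero for `i = 0`, and `sup (e_{β_j(a,b)} ∩ a)` for `i = j+1`. -/
def walkLow (e : Ordinal → Set Ordinal) (a b : Ordinal) : ℕ → Ordinal
  | 0 => 0
  | j + 1 => sSup (e (walk e a b j) ∩ Set.Iio a)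

/-- `γ(a,b) = β_{ρ₂(a,b)-1}(a,b)`, the last step before the walk reaches `a`. -/
def gammaW (e : Ordinal → Set Ordinal) (a b : Ordinal) : Ordinal :=
  walk e a b (rho2 e a b - 1)

/-- `γ⁻(a,b) = max {β_i⁻(a,b) : i < ρ₂(a,b)}`. -/
def gammaMinusW (e : Ordinal → Set Ordinal) (a b : Ordinal) : Ordinal :=
  sSup (walkLow e a b '' {i : ℕ | i < rho2 e a b})

/-- `η(a,b) = max {β_i⁻(a,b) : i ≤ ρ₂(a,b)}`. -/
def etaW (e : Ordinal → Set Ordinal) (a b : Ordinal) : Ordinal :=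
  sSup (walkLow e a b '' {i : ℕ | i ≤ rho2 e a b})

/-- `e` is a C-sequence on `lam`: each `e ξ` is closed unbounded in `ξ`. -/
def IsCSeq (e : Ordinal → Set Ordinal) (lam : Ordinal) : Prop :=
  ∀ ξ, ξ < lam → IsClubIn (e ξ) ξ

/-- `ξ` is an accumulation point of `C`: `ξ = sup (C ∩ ξ) > 0`. -/
def IsAccOf (C : Set Ordinal) (ξ : Ordinal) : Prop :=
  0 < ξ ∧ sSup (C ∩ Set.Iio ξ) = ξ

/-- The non-accumulation points of `C`. -/
def naccOf (C : Set Ordinal) : Set Ordinal :=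
  {ξ ∈ C | sSup (C ∩ Set.Iio ξ) < ξ}

section Bounds

theorem exists_bound_of_set {s : Set Ordinal.{0}} {δ : Ordinal.{0}}
    (h : Cardinal.mk s < Cardinal.lift.{1} δ.cof) (hs : ∀ x ∈ s, x < δ) :
    ∃ γ < δ, ∀ x ∈ s, x < γ := by
  have : Cardinal.mk s < (Ordinal.lift.{1} δ).cof := by rwa [Ordinal.lift_cof] at h
  refine ⟨_, Ordinal.sSup_add_one_lt_of_lt_cof this hs, fun x hx => ?_⟩
  have hb : BddAbove ((· + 1) '' s) := ⟨δ + 1, by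
    rintro _ ⟨y, hy, rfl⟩
    exact (Order.add_one_le_of_lt (hs y hy)).trans (by simp)⟩
  exact (Order.lt_add_one_iff.2 le_rfl).trans_le (le_csSup hb ⟨x, hx, rfl⟩)

theorem exists_bound {J : Type} {f : J → Ordinal.{0}} {δ : Ordinal.{0}}
    (h : Cardinal.mk J < δ.cof) (hf : ∀ j, f j < δ) : ∃ γ < δ, ∀ j, f j < γ := by
  refine ⟨_, Ordinal.iSup_add_one_lt_of_lt_cof h hf, fun j => Ordinal.lt_iSup_add_one f j⟩

theorem exists_bound_image {J : Type*} {s : Set J} {f : J → Ordinal.{0}} {δ : Ordinal.{0}}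
    (h : Cardinal.lift.{1} (Cardinal.mk s) < Cardinal.lift (Cardinal.lift.{1} δ.cof))
    (hf : ∀ j ∈ s, f j < δ) : ∃ γ < δ, ∀ j ∈ s, f j < γ := by
  have h1 : Cardinal.mk (f '' s) < Cardinal.lift.{1} δ.cof := by
    rw [← Cardinal.lift_lt]
    exact (Cardinal.mk_image_le_lift).trans_lt h
  obtain ⟨γ, h2, h3⟩ := exists_bound_of_set h1 (by rintro _ ⟨j, hj, rfl⟩; exact hf j hj)
  exact ⟨γ, h2, fun j hj => h3 _ ⟨j, hj, rfl⟩⟩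

theorem exists_bound_Iio {a δ : Ordinal.{0}} {f : Ordinal.{0} → Ordinal.{0}}
    (h : a.card < δ.cof) (hf : ∀ j < a, f j < δ) : ∃ γ < δ, ∀ j < a, f j < γ := by
  have h1 : Cardinal.mk (f '' Iio a) < Cardinal.lift.{1} δ.cof := by
    refine (Cardinal.mk_image_le).trans_lt ?_
    rw [Cardinal.mk_Iio_ordinal]
    exact Cardinal.lift_lt.2 h
  obtain ⟨γ, h2, h3⟩ := exists_bound_of_set h1 (by rintro _ ⟨j, hj, rfl⟩; exact hf j hj)
  exact ⟨γ, h2, fun j hj => h3 _ ⟨j, hj, rfl⟩⟩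

theorem exists_isLUB_of_lt {s : Set Ordinal.{0}} {γ : Ordinal.{0}} (hs : ∀ x ∈ s, x ≤ γ) :
    ∃ δ ≤ γ, IsLUB s δ := by
  by_cases h : s.Nonempty
  · exact ⟨sSup s, csSup_le h hs, isLUB_csSup h ⟨γ, hs⟩⟩
  · rw [Set.not_nonempty_iff_eq_empty] at h
    subst h
    exact ⟨0, zero_le, by simp⟩

theorem exists_cofinal_set (o : Ordinal.{0}) :
    ∃ s : Set Ordinal.{0}, (∀ x ∈ s, x < o) ∧ (∀ x < o, ∃ y ∈ s, x ≤ y) ∧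
      Cardinal.mk s = Cardinal.lift.{1} o.cof := by
  obtain ⟨s, hs, hc⟩ := Order.exists_cof_eq (Iio o)
  refine ⟨Subtype.val '' s, ?_, ?_, ?_⟩
  · rintro _ ⟨x, _, rfl⟩; exact x.2
  · intro x hx
    obtain ⟨y, hy, hxy⟩ := hs ⟨x, hx⟩
    exact ⟨y, ⟨y, hy, rfl⟩, hxy⟩
  · rw [Cardinal.mk_image_eq Subtype.val_injective, hc, Ordinal.cof_Iio, Ordinal.lift_cof]

theorem cof_le_of_cofinal {o : Ordinal.{0}} {s : Set Ordinal.{0}} (hs : ∀ x ∈ s, x < o)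
    (hc : ∀ x < o, ∃ y ∈ s, x ≤ y) : Cardinal.lift.{1} o.cof ≤ Cardinal.mk s := by
  by_contra! h
  obtain ⟨γ, h1, h2⟩ := exists_bound_of_set h hs
  obtain ⟨y, hy, h3⟩ := hc γ h1
  exact (h2 y hy).not_ge h3

theorem cof_eq_of_strictMonoOn {a δ : Ordinal.{0}} {f : Ordinal.{0} → Ordinal.{0}}
    (ha : Order.IsSuccLimit a) (hf : StrictMonoOn f (Iio a)) (h1 : ∀ j < a, f j < δ)
    (h2 : ∀ x < δ, ∃ j < a, x ≤ f j) : δ.cof = a.cof := by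
  have hm : StrictMono (fun i : Iio a => f i) := fun i j h => hf i.2 j.2 h
  rw [← Ordinal.cof_iSup_Iio hm ha.isSuccPrelimit]
  congr 1
  refine le_antisymm (le_of_forall_lt fun x hx => ?_) (Ordinal.iSup_le fun i => (h1 i i.2).le)
  obtain ⟨j, hj, hx⟩ := h2 x hx
  have hj' : j + 1 < a := ha.add_one_lt hj
  have := Ordinal.le_iSup (fun i : Iio a => f i) ⟨j + 1, hj'⟩
  exact (hx.trans_lt (hf hj hj' (lt_add_one j))).trans_le this

end Bounds

section Regular

variable {Θ : Cardinal.{0}}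

theorem Cardinal.IsRegular.isSuccLimit_ord (h : Θ.IsRegular) : Order.IsSuccLimit Θ.ord :=
  Cardinal.isSuccLimit_ord h.aleph0_le

/-- The points closed under `b` form a club. -/
theorem isClubIn_closure (hr : Θ.IsRegular) (hu : Cardinal.aleph0 < Θ)
    {b : Ordinal.{0} → Ordinal.{0}} (hb : ∀ x < Θ.ord, b x < Θ.ord) :
    IsClubIn {δ | δ < Θ.ord ∧ ∀ x < δ, b x < δ} Θ.ord := by
  have hl := hr.isSuccLimit_ord
  refine ⟨fun x hx => hx.1, fun δ hδ h0 h => ⟨hδ, fun x hx => ?_⟩, fun x hx => ?_⟩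
  · obtain ⟨y, hy, hxy, hyδ⟩ := h x hx
    exact (hy.2 x hxy).trans hyδ
  · have key : ∀ y < Θ.ord, ∃ z < Θ.ord, y < z ∧ ∀ w ≤ y, b w < z := by
      intro y hy
      have hy1 := hl.add_one_lt hy
      obtain ⟨γ, h1, h2⟩ := exists_bound_Iio (a := y + 1) (δ := Θ.ord) (f := b)
        (by rw [hr.cof_ord]; exact Cardinal.lt_ord.1 hy1)
        (fun j hj => hb j (hj.trans hy1))
      refine ⟨max (y + 1) γ, max_lt hy1 h1, lt_max_of_lt_left (lt_add_one y), fun w hw => ?_⟩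
      exact lt_max_of_lt_right (h2 w (Order.lt_add_one_iff.2 hw))
    choose! g hg1 hg2 hg3 using key
    have hs : ∀ n : ℕ, g^[n] x < Θ.ord := by
      intro n
      induction n with
      | zero => exact hx
      | succ n ih => rw [Function.iterate_succ_apply']; exact hg1 _ ih
    obtain ⟨γ, h1, h2⟩ := exists_bound (J := ℕ) (f := fun n => g^[n] x) (δ := Θ.ord)
      (by rw [hr.cof_ord]; simpa using hu) hs
    obtain ⟨δ, h3, h4⟩ := exists_isLUB_of_lt (s := range fun n => g^[n] x) (γ := γ)
      (by rintro _ ⟨n, rfl⟩; exact (h2 n).le)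
    have h5 : ∀ n : ℕ, g^[n] x < δ := fun n => by
      refine lt_of_lt_of_le ?_ (h4.1 ⟨n + 1, rfl⟩)
      simp only [Function.iterate_succ_apply']
      exact hg2 _ (hs n)
    refine ⟨δ, ⟨h3.trans_lt h1, fun w hw => ?_⟩, (h5 0).le, h3.trans_lt h1⟩
    obtain ⟨_, ⟨n, rfl⟩, hn⟩ := (lt_isLUB_iff h4).1 hw
    refine lt_trans ?_ (h5 (n + 1))
    simp only [Function.iterate_succ_apply']
    exact hg3 _ (hs n) w hn.le

theorem IsClubIn.exists_gt (hr : Θ.IsRegular) {C : Set Ordinal.{0}} (hC : IsClubIn C Θ.ord)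
    {x : Ordinal.{0}} (hx : x < Θ.ord) : ∃ y ∈ C, x < y ∧ y < Θ.ord := by
  obtain ⟨y, hy, h1, h2⟩ := hC.2.2 (x + 1) (hr.isSuccLimit_ord.add_one_lt hx)
  exact ⟨y, hy, (lt_add_one x).trans_le h1, h2⟩

/-- Fewer than `Θ` clubs, together with closure under a function, have a common club refinement. -/
theorem isClubIn_iInter (hr : Θ.IsRegular) (hu : Cardinal.aleph0 < Θ) {J : Type*}
    (hJ : Cardinal.lift.{1} (Cardinal.mk J) < Cardinal.lift (Cardinal.lift.{1} Θ))
    {C : J → Set Ordinal.{0}} (hC : ∀ j, IsClubIn (C j) Θ.ord) :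
    IsClubIn {x | x < Θ.ord ∧ ∀ j, x ∈ C j} Θ.ord := by
  refine ⟨fun x hx => hx.1, fun δ hδ h0 h => ⟨hδ, fun j => (hC j).2.1 δ hδ h0 fun x hx => ?_⟩,
    fun x hx => ?_⟩
  · obtain ⟨y, hy, hxy, hyδ⟩ := h x hx
    exact ⟨y, hy.2 j, hxy, hyδ⟩
  · have : ∀ y < Θ.ord, ∃ z < Θ.ord, y < z ∧ ∀ j, ∃ w ∈ C j, y < w ∧ w < z := by
      intro y hy
      choose w hw1 hw2 hw3 using fun j => (hC j).exists_gt hr hy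
      obtain ⟨γ, h1, h2⟩ := exists_bound_image (s := univ) (f := w) (δ := Θ.ord)
        (by rw [hr.cof_ord]; simpa using hJ) (fun j _ => hw3 j)
      exact ⟨max γ (y + 1), max_lt h1 (hr.isSuccLimit_ord.add_one_lt hy),
        lt_max_of_lt_right (lt_add_one y), fun j => ⟨w j, hw1 j, hw2 j,
          lt_max_of_lt_left (h2 j trivial)⟩⟩
    choose! b hb1 hb2 hb3 using this
    obtain ⟨y, hy, hxy, hyΘ⟩ := (isClubIn_closure hr hu hb1).exists_gt hr hx
    refine ⟨y, ⟨hyΘ, fun j => (hC j).2.1 y hyΘ (hxy.pos) fun z hz => ?_⟩, hxy.le, hyΘ⟩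
    obtain ⟨w, hw, hzw, hwb⟩ := hb3 z (hz.trans hyΘ) j
    exact ⟨w, hw, hzw, hwb.trans (hy.2 z hz)⟩

theorem isClubIn_inter (hr : Θ.IsRegular) (hu : Cardinal.aleph0 < Θ) {C D : Set Ordinal.{0}}
    (hC : IsClubIn C Θ.ord) (hD : IsClubIn D Θ.ord) : IsClubIn (C ∩ D) Θ.ord := by
  have := isClubIn_iInter hr hu (J := Bool) (C := fun b => cond b C D)
    (by simpa using (Cardinal.natCast_lt_aleph0 (n := 2)).trans hu) (by rintro (_ | _) <;> assumption)
  convert this using 1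
  ext x
  simp only [mem_inter_iff, Bool.forall_bool, cond_false, cond_true, mem_ofPred_eq]
  exact ⟨fun h => ⟨hC.1 h.1, h.2, h.1⟩, fun h => ⟨h.2.2, h.2.1⟩⟩

theorem isClubIn_Ioo (hr : Θ.IsRegular) {x : Ordinal.{0}} (hx : x < Θ.ord) :
    IsClubIn {y | x < y ∧ y < Θ.ord} Θ.ord := by
  refine ⟨fun y hy => hy.2, fun δ hδ h0 h => ?_, fun y hy => ?_⟩
  · obtain ⟨y, hy, _, h2⟩ := h 0 h0
    exact ⟨hy.1.trans h2, hδ⟩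
  · have := hr.isSuccLimit_ord.add_one_lt (max_lt hx hy)
    refine ⟨max x y + 1, ⟨?_, this⟩, ?_, this⟩
    · exact (le_max_left x y).trans_lt (lt_add_one _)
    · exact (le_max_right x y).trans (lt_add_one _).le

theorem isClubIn_Iio {l : Ordinal.{0}} : IsClubIn (Iio l) l :=
  ⟨subset_rfl, fun _ h _ _ => h, fun x hx => ⟨x, hx, le_rfl, hx⟩⟩

theorem isClubIn_biInter (hr : Θ.IsRegular) (hu : Cardinal.aleph0 < Θ) {Ω : Ordinal.{0}}
    (hΩ : Ω < Θ.ord) {C : Ordinal.{0} → Set Ordinal.{0}} (hC : ∀ j < Ω, IsClubIn (C j) Θ.ord) :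
    IsClubIn {x | x < Θ.ord ∧ ∀ j < Ω, x ∈ C j} Θ.ord := by
  have := isClubIn_iInter hr hu (J := Iio Ω) (C := fun j => C j)
    (by
      rw [Cardinal.mk_Iio_ordinal, Cardinal.lift_lt, Cardinal.lift_lt]
      exact Cardinal.lt_ord.1 hΩ) (fun j => hC j j.2)
  convert this using 1
  ext x
  simp

/-- Every sequence of clubs has a club inside its diagonal intersection. -/
theorem exists_isClubIn_diagonal (hr : Θ.IsRegular) (hu : Cardinal.aleph0 < Θ)
    {C : Ordinal.{0} → Set Ordinal.{0}} (hC : ∀ a < Θ.ord, IsClubIn (C a) Θ.ord) :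
    ∃ E, IsClubIn E Θ.ord ∧ ∀ δ ∈ E, ∀ a < δ, δ ∈ C a := by
  have : ∀ y < Θ.ord, ∃ z < Θ.ord, y < z ∧ ∀ a ≤ y, ∃ w ∈ C a, y < w ∧ w < z := by
    intro y hy
    have hy1 := hr.isSuccLimit_ord.add_one_lt hy
    obtain ⟨z, hz, hyz, hzΘ⟩ := (isClubIn_biInter hr hu hy1
      (fun j hj => hC j (hj.trans hy1))).exists_gt hr hy
    exact ⟨z + 1, hr.isSuccLimit_ord.add_one_lt hzΘ, hyz.trans (lt_add_one z), fun a ha =>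
      ⟨z, hz.2 a (Order.lt_add_one_iff.2 ha), hyz, lt_add_one z⟩⟩
  choose! b hb1 hb2 hb3 using this
  refine ⟨_, isClubIn_closure hr hu hb1, fun δ hδ a ha => ?_⟩
  refine (hC a (ha.trans hδ.1)).2.1 δ hδ.1 ha.pos fun x hx => ?_
  have hm := max_lt hx ha
  obtain ⟨w, hw, h1, h2⟩ := hb3 (max x a) (hm.trans hδ.1) a (le_max_right _ _)
  exact ⟨w, hw, (le_max_left _ _).trans_lt h1, h2.trans (hδ.2 _ hm)⟩

theorem exists_isClubIn_acc (hr : Θ.IsRegular) (hu : Cardinal.aleph0 < Θ) {U : Set Ordinal.{0}}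
    (hU : ∀ x < Θ.ord, ∃ y ∈ U, x < y ∧ y < Θ.ord) :
    ∃ E, IsClubIn E Θ.ord ∧ ∀ δ ∈ E, ∀ x < δ, ∃ y ∈ U, x < y ∧ y < δ := by
  choose! b hb1 hb2 hb3 using hU
  exact ⟨_, isClubIn_closure hr hu hb3, fun δ hδ x hx =>
    ⟨b x, hb1 x (hx.trans hδ.1), hb2 x (hx.trans hδ.1), hδ.2 x hx⟩⟩

theorem IsClubIn.exists_cof_eq (hr : Θ.IsRegular) {C : Set Ordinal.{0}}
    (hC : IsClubIn C Θ.ord) {χ : Cardinal.{0}} (hχ : χ.IsRegular) (hlt : χ < Θ) {x : Ordinal.{0}}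
    (hx : x < Θ.ord) : ∃ δ ∈ C, x < δ ∧ δ.cof = χ ∧ ∀ y < δ, ∃ z ∈ C, y < z ∧ z < δ := by
  choose! n hn1 hn2 hn3 using fun y (hy : y < Θ.ord) => hC.exists_gt hr hy
  have key : ∀ P : Set Ordinal.{0}, Cardinal.mk P < Cardinal.lift.{1} Θ → (∀ y ∈ P, y < Θ.ord) →
      ∃ z ∈ C, x < z ∧ z < Θ.ord ∧ ∀ y ∈ P, y < z := by
    intro P h1 h2
    obtain ⟨γ, h3, h4⟩ := exists_bound_of_set (s := P) (δ := Θ.ord) (by rwa [hr.cof_ord]) h2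
    obtain ⟨z, hz1, hz2, hz3⟩ := hC.exists_gt hr (max_lt hx h3)
    exact ⟨z, hz1, (le_max_left _ _).trans_lt hz2, hz3,
      fun y hy => (h4 y hy).trans ((le_max_right _ _).trans_lt hz2)⟩
  choose! g hg1 hg2 hg3 hg4 using key
  let s : Ordinal.{0} → Ordinal.{0} := WellFoundedLT.fix fun j ih =>
    g {y | ∃ (i : Ordinal.{0}) (h : i < j), y = ih i h}
  have hs : ∀ j, s j = g (s '' Iio j) := by
    intro j
    have := WellFoundedLT.fix_eq (fun (j : Ordinal.{0}) (ih : ∀ i < j, Ordinal.{0}) =>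
      g {y | ∃ (i : Ordinal.{0}) (h : i < j), y = ih i h}) j
    refine this.trans (congrArg g ?_)
    ext y
    simp only [mem_ofPred_eq, mem_image, mem_Iio, exists_prop]
    exact ⟨fun ⟨i, h, e⟩ => ⟨i, h, e.symm⟩, fun ⟨i, h, e⟩ => ⟨i, h, e.symm⟩⟩
  have hcard : ∀ j < χ.ord, Cardinal.mk (s '' Iio j) < Cardinal.lift.{1} Θ := by
    intro j hj
    refine Cardinal.mk_image_le.trans_lt ?_
    rw [Cardinal.mk_Iio_ordinal]
    exact Cardinal.lift_lt.2 ((Cardinal.lt_ord.1 hj).trans hlt)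
  have hb : ∀ j < χ.ord, s j < Θ.ord := by
    intro j
    induction j using WellFoundedLT.induction with
    | _ j ih =>
      intro hj
      rw [hs]
      refine hg3 _ (hcard j hj) ?_
      rintro _ ⟨i, hi, rfl⟩
      exact ih i hi (lt_trans hi hj)
  have hP : ∀ j < χ.ord, ∀ y ∈ s '' Iio j, y < Θ.ord := by
    rintro j hj _ ⟨i, hi, rfl⟩
    exact hb i (lt_trans hi hj)
  have hmono : StrictMonoOn s (Iio χ.ord) := by
    intro i hi j hj hij
    rw [hs j]
    exact hg4 _ (hcard j hj) (hP j hj) _ ⟨i, hij, rfl⟩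
  have hmem : ∀ j < χ.ord, s j ∈ C := fun j hj => by
    rw [hs j]; exact hg1 _ (hcard j hj) (hP j hj)
  have hgt : ∀ j < χ.ord, x < s j := fun j hj => by
    rw [hs j]; exact hg2 _ (hcard j hj) (hP j hj)
  obtain ⟨γ, h1, h2⟩ := exists_bound_Iio (a := χ.ord) (δ := Θ.ord) (f := s)
    (by rwa [hr.cof_ord, Cardinal.card_ord]) hb
  obtain ⟨δ, h3, h4⟩ := exists_isLUB_of_lt (s := s '' Iio χ.ord) (γ := γ)
    (by rintro _ ⟨n, hn, rfl⟩; exact (h2 n hn).le)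
  have hlim := hχ.isSuccLimit_ord
  have h5 : ∀ j < χ.ord, s j < δ := fun j hj =>
    (hmono hj (hlim.add_one_lt hj) (lt_add_one j)).trans_le (h4.1 ⟨_, hlim.add_one_lt hj, rfl⟩)
  have h6 : ∀ y < δ, ∃ j < χ.ord, y < s j := by
    intro y hy
    obtain ⟨_, ⟨n, hn, rfl⟩, h⟩ := (lt_isLUB_iff h4).1 hy
    exact ⟨n, hn, h⟩
  have h0 : (0 : Ordinal) < χ.ord := by
    rw [Cardinal.ord_pos]; exact hχ.pos
  have hacc : ∀ y < δ, ∃ z ∈ C, y < z ∧ z < δ := fun y hy => by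
    obtain ⟨j, hj, h⟩ := h6 y hy
    exact ⟨s j, hmem j hj, h, h5 j hj⟩
  refine ⟨δ, hC.2.1 δ (h3.trans_lt h1) ((hgt 0 h0).trans (h5 0 h0)).pos hacc,
    (hgt 0 h0).trans (h5 0 h0), ?_, hacc⟩
  rw [cof_eq_of_strictMonoOn hlim hmono h5 (fun y hy => ?_), hχ.cof_ord]
  obtain ⟨j, hj, h⟩ := h6 y hy
  exact ⟨j, hj, h.le⟩

theorem IsStatIn.exists_fiber (hr : Θ.IsRegular) (hu : Cardinal.aleph0 < Θ) {S : Set Ordinal.{0}}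
    (hS : IsStatIn S Θ.ord) {f : Ordinal.{0} → Ordinal.{0}} (hf : ∀ δ ∈ S, f δ < δ) :
    ∃ a < Θ.ord, IsStatIn {δ ∈ S | f δ = a} Θ.ord := by
  by_contra! h
  have h1 : ∀ a < Θ.ord, ∃ C, IsClubIn C Θ.ord ∧ ∀ δ ∈ S, f δ = a → δ ∉ C := by
    intro a ha
    have := h a ha
    simp only [IsStatIn, not_and, not_forall] at this
    obtain ⟨C, hC, hne⟩ := this fun δ hδ => hS.1 hδ.1
    exact ⟨C, hC, fun δ hδ hfa hδC => hne ⟨δ, ⟨hδ, hfa⟩, hδC⟩⟩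
  choose! C hC hC' using h1
  obtain ⟨E, hE, hE'⟩ := exists_isClubIn_diagonal hr hu hC
  obtain ⟨δ, hδS, hδE⟩ := hS.2 E hE
  exact hC' (f δ) ((hf δ hδS).trans (hS.1 hδS)) δ hδS rfl (hE' δ hδE _ (hf δ hδS))

theorem IsStatIn.exists_gt (hr : Θ.IsRegular) {S : Set Ordinal.{0}}
    (hS : IsStatIn S Θ.ord) {x : Ordinal.{0}} (hx : x < Θ.ord) : ∃ δ ∈ S, x < δ ∧ δ < Θ.ord := by
  obtain ⟨δ, h1, h2⟩ := hS.2 _ (isClubIn_Ioo hr hx)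
  exact ⟨δ, h1, h2⟩

/-- Iterating an operation on clubs along an ordinal below `Θ`, taking intersections. -/
theorem exists_decreasing_clubs (hr : Θ.IsRegular) (hu : Cardinal.aleph0 < Θ)
    {Ω : Ordinal.{0}} (hΩ : Ω < Θ.ord) {W : Set Ordinal.{0} → Set Ordinal.{0}}
    (hW : ∀ C, IsClubIn C Θ.ord → IsClubIn (W C) Θ.ord) :
    ∃ E : Ordinal.{0} → Set Ordinal.{0}, (∀ ζ ≤ Ω, IsClubIn (E ζ) Θ.ord) ∧
      ∀ ζ ζ', ζ' < ζ → E ζ ⊆ E ζ' ∩ W (E ζ') := by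
  let E : Ordinal.{0} → Set Ordinal.{0} := WellFoundedLT.fix fun ζ ih =>
    {x | x < Θ.ord ∧ ∀ (j : Ordinal.{0}) (h : j < ζ), x ∈ ih j h ∩ W (ih j h)}
  have hE : ∀ ζ, E ζ = {x | x < Θ.ord ∧ ∀ j < ζ, x ∈ E j ∩ W (E j)} := fun ζ =>
    WellFoundedLT.fix_eq (fun (ζ : Ordinal.{0}) (ih : ∀ j < ζ, Set Ordinal.{0}) =>
      {x | x < Θ.ord ∧ ∀ (j : Ordinal.{0}) (h : j < ζ), x ∈ ih j h ∩ W (ih j h)}) ζ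
  refine ⟨E, fun ζ => ?_, fun ζ ζ' h x hx => ?_⟩
  · induction ζ using WellFoundedLT.induction with
    | _ ζ ih =>
      intro hζ
      rw [hE]
      refine isClubIn_biInter hr hu (hζ.trans_lt hΩ) fun j hj => ?_
      have := ih j hj (hj.le.trans hζ)
      exact isClubIn_inter hr hu this (hW _ this)
  · rw [hE] at hx
    exact hx.2 ζ' h

end Regular

section Singular

variable {mu : Cardinal.{0}}

theorem IsSingular.isRegular_cof (h : IsSingular mu) : (Ordinal.cof mu.ord).IsRegular :=
  Cardinal.isRegular_cof (Cardinal.isSuccLimit_ord h.1)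

theorem IsSingular.not_isRegular (h : IsSingular mu) : ¬ mu.IsRegular := fun hr =>
  h.2.ne hr.cof_ord

theorem IsSingular.isRegular_succ (h : IsSingular mu) : (Order.succ mu).IsRegular :=
  Cardinal.isRegular_succ h.1

theorem IsSingular.aleph0_lt_succ (h : IsSingular mu) : Cardinal.aleph0 < Order.succ mu :=
  h.1.trans_lt (Order.lt_succ mu)

theorem IsSingular.succ_lt (h : IsSingular mu) {c : Cardinal.{0}} (hc : c < mu) :
    Order.succ c < mu := by
  refine (Order.succ_le_of_lt hc).lt_of_ne ?_
  rintro rfl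
  rcases lt_or_ge c Cardinal.aleph0 with h0 | h0
  · exact (Cardinal.isSuccLimit_aleph0.succ_lt h0).not_ge h.1
  · exact h.not_isRegular (Cardinal.isRegular_succ h0)

theorem IsSingular.cof_lt_of_le (h : IsSingular mu) {x : Ordinal.{0}} (hx : x.cof ≤ mu) :
    x.cof < mu := by
  refine hx.lt_of_ne fun he => h.not_isRegular ?_
  rw [← he]
  exact Cardinal.isRegular_cof (Ordinal.one_lt_cof_iff.1
    (Cardinal.one_lt_aleph0.trans_le (he ▸ h.1)))

theorem IsSingular.cof_lt (h : IsSingular mu) {x : Ordinal.{0}} (hx : x < (Order.succ mu).ord) :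
    x.cof < mu :=
  h.cof_lt_of_le ((Ordinal.cof_le_card x).trans (Order.lt_succ_iff.1 (Cardinal.lt_ord.1 hx)))

/-- The index set of the scales below: a well-order of type `cf mu`. -/
abbrev Idx (mu : Cardinal.{0}) : Type := (Ordinal.cof mu.ord).ord.ToType

theorem Idx.mk_eq : Cardinal.mk (Idx mu) = Ordinal.cof mu.ord := by simp

theorem IsSingular.idx_bound (h : IsSingular mu) {J : Type*} {s : Set J}
    (hs : Cardinal.lift.{0} (Cardinal.mk s) < Cardinal.lift (Ordinal.cof mu.ord))
    (f : J → Idx mu) : ∃ i, ∀ j ∈ s, f j < i := by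
  let e := Ordinal.ToType.mk (o := (Ordinal.cof mu.ord).ord)
  obtain ⟨γ, h1, h2⟩ := exists_bound_image (s := s) (f := fun j => (e.symm (f j)).1)
    (δ := (Ordinal.cof mu.ord).ord) (by
      rw [h.isRegular_cof.cof_ord]
      have := (Cardinal.lift_lt.{_, 1}).2 hs
      simpa using this) (fun j _ => (e.symm (f j)).2)
  refine ⟨e ⟨γ, h1⟩, fun j hj => ?_⟩
  rw [← e.symm_apply_lt]
  exact h2 j hj

theorem IsSingular.nonempty_idx (h : IsSingular mu) : Nonempty (Idx mu) := by
  rw [← Cardinal.mk_ne_zero_iff, Idx.mk_eq]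
  exact h.isRegular_cof.pos.ne'

theorem IsSingular.noMaxOrder_idx (h : IsSingular mu) : NoMaxOrder (Idx mu) := ⟨fun i => by
  obtain ⟨j, hj⟩ := h.idx_bound (s := ({i} : Set (Idx mu)))
    (by simpa using h.isRegular_cof.aleph0_le) id
  exact ⟨j, hj i rfl⟩⟩

theorem mk_Iio_idx (i : Idx mu) : Cardinal.mk (Iio i) < Ordinal.cof mu.ord := by
  simpa using Cardinal.mk_Iio_lt i (by simp)

theorem IsSingular.mk_Iic_idx (h : IsSingular mu) (i : Idx mu) :
    Cardinal.mk (Iic i) < Ordinal.cof mu.ord := by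
  have := h.noMaxOrder_idx
  obtain ⟨j, hj⟩ := exists_gt i
  exact (Cardinal.mk_le_mk_of_subset fun x (hx : x ≤ i) => (hx.trans_lt hj : x < j)).trans_lt
    (mk_Iio_idx j)

theorem IsSingular.eventually_atTop (h : IsSingular mu) {P : Idx mu → Prop} :
    (∀ᶠ i in Filter.atTop, P i) ↔ ∃ z, ∀ i, z ≤ i → P i := by
  have := h.nonempty_idx
  exact Filter.eventually_atTop

theorem IsSingular.neBot (h : IsSingular mu) : (Filter.atTop : Filter (Idx mu)).NeBot := by
  have := h.nonempty_idx
  infer_instance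

/-- Fewer than `cf mu` eventual statements hold simultaneously from some index on. -/
theorem IsSingular.eventually_ball (h : IsSingular mu) {J : Type*} {s : Set J}
    (hs : Cardinal.lift.{0} (Cardinal.mk s) < Cardinal.lift (Ordinal.cof mu.ord))
    {P : J → Idx mu → Prop} (hP : ∀ j ∈ s, ∀ᶠ i in Filter.atTop, P j i) :
    ∀ᶠ i in Filter.atTop, ∀ j ∈ s, P j i := by
  have := h.nonempty_idx
  simp only [h.eventually_atTop] at hP ⊢
  choose! z hz using hP
  obtain ⟨i, hi⟩ := h.idx_bound hs z
  exact ⟨i, fun k hk j hj => hz j hj k ((hi j hj).le.trans hk)⟩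

/-- An increasing sequence of cardinals cofinal in `mu`. -/
structure IsLayering (mu : Cardinal.{0}) (M : Idx mu → Cardinal.{0}) : Prop where
  mono : Monotone M
  lt : ∀ i, M i < mu
  cofinal : ∀ c < mu, ∃ i, c < M i
  succ_cof_le : ∀ i, Order.succ (Ordinal.cof mu.ord) ≤ M i

theorem IsSingular.exists_isLayering (h : IsSingular mu) : ∃ M, IsLayering mu M := by
  obtain ⟨s, hs1, hs2, hs3⟩ := exists_cofinal_set mu.ord
  have : Nonempty (ULift.{1} (Idx mu) ≃ s) := by
    rw [← Cardinal.eq, hs3, Cardinal.mk_uLift, Idx.mk_eq]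
  obtain ⟨e⟩ := this
  have hlt : ∀ i, (e ⟨i⟩).1.card < mu := fun i => Cardinal.lt_ord.1 (hs1 _ (e ⟨i⟩).2)
  have hb : ∀ i : Idx mu, BddAbove (range fun j : Iic i => (e ⟨j⟩).1.card) := fun i =>
    ⟨mu, by rintro _ ⟨j, rfl⟩; exact (hlt j).le⟩
  refine ⟨fun i => max (Order.succ (Ordinal.cof mu.ord)) (⨆ j : Iic i, (e ⟨j⟩).1.card),
    fun i i' hi => max_le_max le_rfl ?_, fun i => max_lt (h.succ_lt h.2) ?_, fun c hc => ?_,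
    fun i => le_max_left _ _⟩
  · have : Nonempty (Iic i) := ⟨⟨i, mem_Iic.2 le_rfl⟩⟩
    exact ciSup_le fun j => le_ciSup (hb i') ⟨j.1, j.2.trans hi⟩
  · exact Cardinal.iSup_lt_of_lt_cof_ord (h.mk_Iic_idx i) fun j => hlt j
  · obtain ⟨y, hy, hcy⟩ := hs2 _ (Cardinal.ord_lt_ord.2 (h.succ_lt hc))
    obtain ⟨⟨i⟩, hi⟩ := e.surjective ⟨y, hy⟩
    refine ⟨i, lt_max_of_lt_right ?_⟩
    refine lt_of_lt_of_le ?_ (le_ciSup (hb i) ⟨i, mem_Iic.2 le_rfl⟩)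
    simp only [hi]
    exact (Order.lt_succ c).trans_le (Cardinal.ord_le.1 hcy)

namespace IsLayering

variable {M : Idx mu → Cardinal.{0}}

theorem eventually_lt (hM : IsLayering mu M) (h : IsSingular mu) {c : Cardinal.{0}} (hc : c < mu) :
    ∀ᶠ i in Filter.atTop, c < M i := by
  rw [h.eventually_atTop]
  obtain ⟨z, hz⟩ := hM.cofinal c hc
  exact ⟨z, fun i hi => hz.trans_le (hM.mono hi)⟩

theorem cof_lt (hM : IsLayering mu M) (i : Idx mu) : Ordinal.cof mu.ord < M i :=
  (Order.lt_succ _).trans_le (hM.succ_cof_le i)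

theorem aleph0_le (hM : IsLayering mu M) (h : IsSingular mu) (i : Idx mu) :
    Cardinal.aleph0 ≤ M i :=
  h.isRegular_cof.aleph0_le.trans (hM.cof_lt i).le

end IsLayering

end Singular

section Closure

/-- The set `s` together with its limit points below `ν`. -/
def limClosure (ν : Ordinal.{0}) (s : Set Ordinal.{0}) : Set Ordinal.{0} :=
  {x | x < ν ∧ (x ∈ s ∨ 0 < x ∧ ∀ y < x, ∃ z ∈ s, y < z ∧ z < x)}

theorem closedIn_limClosure (ν : Ordinal.{0}) (s : Set Ordinal.{0}) :
    ClosedIn (limClosure ν s) ν := by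
  refine fun δ hδ h0 h => ⟨hδ, Or.inr ⟨h0, fun y hy => ?_⟩⟩
  obtain ⟨z, hz, hyz, hzδ⟩ := h y hy
  rcases hz.2 with hz | ⟨-, hz⟩
  · exact ⟨z, hz, hyz, hzδ⟩
  · obtain ⟨w, hw, h1, h2⟩ := hz y hyz
    exact ⟨w, hw, h1, h2.trans hzδ⟩

theorem mk_limClosure_le {ν : Ordinal.{0}} {s : Set Ordinal.{0}} (hs : ∀ x < ν, ∃ y ∈ s, x ≤ y)
    {c : Cardinal.{0}} (hc : Cardinal.aleph0 ≤ c) (h : Cardinal.mk s ≤ Cardinal.lift.{1} c) :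
    Cardinal.mk (limClosure ν s) ≤ Cardinal.lift.{1} c := by
  classical
  choose! n hn using fun x (hx : x < ν) =>
    WellFounded.has_min (wellFounded_lt (α := Ordinal.{0})) {y | y ∈ s ∧ x ≤ y} (hs x hx)
  have hsub : limClosure ν s ⊆ s ∪ {x ∈ limClosure ν s | x ∉ s} := fun x hx => by
    by_cases hxs : x ∈ s
    · exact Or.inl hxs
    · exact Or.inr ⟨hx, hxs⟩
  have h2 : Cardinal.mk {x ∈ limClosure ν s | x ∉ s} ≤ Cardinal.mk s := by
    refine Cardinal.mk_le_of_injective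
      (f := fun x : {x ∈ limClosure ν s | x ∉ s} => (⟨n x, (hn x x.2.1.1).1.1⟩ : s)) ?_
    have key : ∀ x y : Ordinal.{0}, x ∈ limClosure ν s → y ∈ limClosure ν s → y ∉ s → x < y →
        n x < y := by
      intro x y hx hy hys hxy
      obtain ⟨z, hz, h1, h2⟩ := (hy.2.resolve_left hys).2 x hxy
      exact (not_lt.1 ((hn x hx.1).2 z ⟨hz, h1.le⟩)).trans_lt h2
    rintro ⟨x, hx, hxs⟩ ⟨y, hy, hys⟩ he
    simp only [Subtype.mk.injEq] at he
    refine Subtype.ext ?_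
    rcases lt_trichotomy x y with hxy | hxy | hxy
    · exact absurd (key x y hx hy hys hxy) (he ▸ (hn y hy.1).1.2).not_gt
    · exact hxy
    · exact absurd (key y x hy hx hxs hxy) (he ▸ (hn x hx.1).1.2).not_gt
  refine (Cardinal.mk_le_mk_of_subset hsub).trans ((Cardinal.mk_union_le _ _).trans ?_)
  exact Cardinal.add_le_of_le (by simpa using hc) h (h2.trans h)

theorem isClubIn_limClosure {ν : Ordinal.{0}} {s : Set Ordinal.{0}}
    (hs : ∀ x < ν, ∃ y ∈ s, x ≤ y ∧ y < ν) : IsClubIn (limClosure ν s) ν :=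
  ⟨fun _ hx => hx.1, closedIn_limClosure ν s, fun x hx => by
    obtain ⟨y, hy, h1, h2⟩ := hs x hx
    exact ⟨y, ⟨h2, Or.inl hy⟩, h1, h2⟩⟩

theorem exists_isClubIn_mk_le (ν : Ordinal.{0}) {c : Cardinal.{0}} (hc : Cardinal.aleph0 ≤ c)
    (h : ν.cof ≤ c) : ∃ e, IsClubIn e ν ∧ Cardinal.mk e ≤ Cardinal.lift.{1} c := by
  obtain ⟨s, h1, h2, h3⟩ := exists_cofinal_set ν
  refine ⟨limClosure ν s, isClubIn_limClosure fun x hx => ?_, mk_limClosure_le h2 hc ?_⟩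
  · obtain ⟨y, hy, hxy⟩ := h2 x hx
    exact ⟨y, hy, hxy, h1 y hy⟩
  · rw [h3]; exact Cardinal.lift_le.2 h

end Closure

section Projection

/-- The largest element of (the closure of) `E` that is at most `a`. -/
def projBelow (E : Set Ordinal.{0}) (a : Ordinal.{0}) : Ordinal.{0} := sSup (E ∩ Iic a)

theorem bddAbove_inter_Iic (E : Set Ordinal.{0}) (a : Ordinal.{0}) : BddAbove (E ∩ Iic a) :=
  ⟨a, fun _ hx => hx.2⟩

theorem projBelow_le (E : Set Ordinal.{0}) (a : Ordinal.{0}) : projBelow E a ≤ a := by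
  rcases (E ∩ Iic a).eq_empty_or_nonempty with h | h
  · simp [projBelow, h]
  · exact csSup_le h fun _ hx => hx.2

theorem le_projBelow {E : Set Ordinal.{0}} {a z : Ordinal.{0}} (hz : z ∈ E) (h : z ≤ a) :
    z ≤ projBelow E a :=
  le_csSup (bddAbove_inter_Iic E a) ⟨hz, h⟩

theorem projBelow_mono {E E' : Set Ordinal.{0}} (h : E ⊆ E') (a : Ordinal.{0}) :
    projBelow E a ≤ projBelow E' a := by
  rcases (E ∩ Iic a).eq_empty_or_nonempty with h0 | h0
  · simp [projBelow, h0]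
  · exact csSup_le h0 fun x hx => le_projBelow (h hx.1) hx.2

theorem projBelow_mem {E : Set Ordinal.{0}} {l a : Ordinal.{0}} (hE : ClosedIn E l) (ha : a < l)
    (h0 : projBelow E a ≠ 0) : projBelow E a ∈ E := by
  have hne : (E ∩ Iic a).Nonempty := by
    by_contra h
    rw [not_nonempty_iff_eq_empty] at h
    simp [projBelow, h] at h0
  by_contra hn
  have hlub : IsLUB (E ∩ Iic a) (projBelow E a) := isLUB_csSup hne (bddAbove_inter_Iic E a)
  refine hn (hE _ ((projBelow_le E a).trans_lt ha) (pos_iff_ne_zero.2 h0) fun x hx => ?_)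
  obtain ⟨y, hy, hxy⟩ := (lt_isLUB_iff hlub).1 hx
  refine ⟨y, hy.1, hxy, (hlub.1 hy).lt_of_ne ?_⟩
  rintro rfl
  exact hn hy.1

theorem exists_stable_of_antitone {h : Ordinal.{0} → Ordinal.{0}} {Ω : Ordinal.{0}} (h0 : 0 < Ω)
    (hh : ∀ ζ ζ', ζ ≤ ζ' → ζ' < Ω → h ζ' ≤ h ζ) :
    ∃ ζ₀ < Ω, ∀ ζ, ζ₀ ≤ ζ → ζ < Ω → h ζ = h ζ₀ := by
  obtain ⟨_, ⟨ζ₀, h1, rfl⟩, h2⟩ := WellFounded.has_min (wellFounded_lt (α := Ordinal.{0}))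
    (h '' Iio Ω) ⟨_, 0, h0, rfl⟩
  exact ⟨ζ₀, h1, fun ζ hζ hζ' => le_antisymm (hh _ _ hζ hζ') (not_lt.1 (h2 _ ⟨ζ, hζ', rfl⟩))⟩

end Projection

section PreScale

variable {mu : Cardinal.{0}} {M : Idx mu → Cardinal.{0}}

theorem exists_injOn_lt_ord {ν : Ordinal.{0}} (hν : ν < (Order.succ mu).ord) :
    ∃ φ : Ordinal.{0} → Ordinal.{0}, InjOn φ (Iio ν) ∧ ∀ x < ν, φ x < mu.ord := by
  have h : Cardinal.mk (Iio ν) ≤ Cardinal.mk (Iio mu.ord) := by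
    rw [Cardinal.mk_Iio_ordinal, Cardinal.mk_Iio_ordinal, Cardinal.card_ord, Cardinal.lift_le]
    exact Order.lt_succ_iff.1 (Cardinal.lt_ord.1 hν)
  obtain ⟨g⟩ := Cardinal.le_def _ _ |>.1 h
  classical
  refine ⟨fun x => if hx : x < ν then (g ⟨x, hx⟩).1 else 0, fun x hx y hy hxy => ?_,
    fun x hx => ?_⟩
  · simp only [dif_pos (show x < ν from hx), dif_pos (show y < ν from hy)] at hxy
    exact congrArg Subtype.val (g.injective (Subtype.ext hxy))
  · simp only [dif_pos hx]
    exact (g ⟨x, hx⟩).2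

theorem IsLayering.exists_filtration (hM : IsLayering mu M) (h : IsSingular mu) {ν : Ordinal.{0}}
    (hν : ν < (Order.succ mu).ord) : ∃ B : Idx mu → Set Ordinal.{0},
      (∀ i, ∀ x ∈ B i, x < ν) ∧ (∀ i, Cardinal.mk (B i) ≤ Cardinal.lift.{1} (M i)) ∧
      (∀ x < ν, ∀ᶠ i in Filter.atTop, x ∈ B i) ∧
      ∃ e, IsClubIn e ν ∧ ∀ᶠ i in Filter.atTop, e ⊆ B i := by
  obtain ⟨φ, hφ, hφ'⟩ := exists_injOn_lt_ord hν
  obtain ⟨e, he, hec⟩ := exists_isClubIn_mk_le ν (le_max_left Cardinal.aleph0 ν.cof)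
    (le_max_right _ _)
  classical
  refine ⟨fun i => {x | x < ν ∧ φ x < (M i).ord} ∪ {x ∈ e | max Cardinal.aleph0 ν.cof ≤ M i},
    ?_, fun i => ?_, fun x hx => ?_, e, he, ?_⟩
  · rintro i x (hx | hx)
    · exact hx.1
    · exact he.1 hx.1
  · refine (Cardinal.mk_union_le _ _).trans (Cardinal.add_le_of_le ?_ ?_ ?_)
    · simpa using hM.aleph0_le h i
    · rw [← Cardinal.mk_image_eq_of_injOn (f := φ) _ (hφ.mono fun x hx => hx.1)]
      have : φ '' {x | x < ν ∧ φ x < (M i).ord} ⊆ Iio (M i).ord := by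
        rintro _ ⟨x, hx, rfl⟩; exact hx.2
      refine (Cardinal.mk_le_mk_of_subset this).trans ?_
      rw [Cardinal.mk_Iio_ordinal, Cardinal.card_ord]
    · by_cases hc : max Cardinal.aleph0 ν.cof ≤ M i
      · refine (Cardinal.mk_le_mk_of_subset fun x hx => hx.1).trans (hec.trans ?_)
        exact Cardinal.lift_le.2 hc
      · simp only [hc, and_false]
        simp
  · have : (φ x).card < mu := Cardinal.lt_ord.1 (hφ' x hx)
    filter_upwards [hM.eventually_lt h this] with i hi
    exact Or.inl ⟨hx, Cardinal.lt_ord.2 hi⟩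
  · have : max Cardinal.aleph0 ν.cof < mu :=
      max_lt (h.isRegular_cof.aleph0_le.trans_lt h.2) (h.cof_lt hν)
    filter_upwards [hM.eventually_lt h this] with i hi x hx
    exact Or.inr ⟨hx, hi.le⟩

/-- An increasing sequence of functions below `mu`, with good behaviour along some club of each
ordinal below `mu⁺`. -/
structure IsPrescale (mu : Cardinal.{0}) (f : Ordinal.{0} → Idx mu → Ordinal.{0}) : Prop where
  lt : ∀ ν < (Order.succ mu).ord, ∀ i, f ν i < mu.ord
  mono : ∀ ν < (Order.succ mu).ord, ∀ c < ν, ∀ᶠ i in Filter.atTop, f c i < f ν i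
  club : ∀ ν < (Order.succ mu).ord, ∃ e, IsClubIn e ν ∧
    ∀ᶠ i in Filter.atTop, ∀ c ∈ e, f c i < f ν i

theorem IsSingular.exists_isPrescale (h : IsSingular mu) : ∃ f, IsPrescale mu f := by
  obtain ⟨M, hM⟩ := h.exists_isLayering
  choose! B hB1 hB2 hB3 e he1 he2 using
    fun ν (hν : ν < (Order.succ mu).ord) => hM.exists_filtration h hν
  let f : Ordinal.{0} → Idx mu → Ordinal.{0} := WellFoundedLT.fix fun ν ih i =>
    sSup {x | ∃ (c : Ordinal.{0}) (hc : c < ν), c ∈ B ν i ∧ x = ih c hc i + 1}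
  have hf : ∀ ν < (Order.succ mu).ord, ∀ i, f ν i = sSup ((fun c => f c i + 1) '' B ν i) := by
    intro ν hν i
    have := congrFun (WellFoundedLT.fix_eq (fun (ν : Ordinal.{0})
      (ih : ∀ c < ν, Idx mu → Ordinal.{0}) (i : Idx mu) =>
      sSup {x | ∃ (c : Ordinal.{0}) (hc : c < ν), c ∈ B ν i ∧ x = ih c hc i + 1}) ν) i
    refine this.trans (congrArg sSup ?_)
    ext y
    simp only [mem_ofPred_eq, mem_image]
    exact ⟨fun ⟨c, _, hc, e⟩ => ⟨c, hc, e.symm⟩, fun ⟨c, hc, e⟩ => ⟨c, hB1 ν hν i c hc, hc, e.symm⟩⟩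
  have hlt : ∀ ν, ν < (Order.succ mu).ord → ∀ i, f ν i < (Order.succ (M i)).ord := by
    intro ν
    induction ν using WellFoundedLT.induction with
    | _ ν ih =>
      intro hν i
      have hr := Cardinal.isRegular_succ (hM.aleph0_le h i)
      obtain ⟨γ, h1, h2⟩ := exists_bound_of_set (s := (fun c => f c i + 1) '' B ν i)
        (δ := (Order.succ (M i)).ord) (by
          rw [hr.cof_ord]
          exact Cardinal.mk_image_le.trans_lt ((hB2 ν hν i).trans_lt
            (Cardinal.lift_lt.2 (Order.lt_succ _)))) (by
          rintro _ ⟨c, hc, rfl⟩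
          have hcν := hB1 ν hν i c hc
          exact hr.isSuccLimit_ord.add_one_lt (ih c hcν (hcν.trans hν) i))
      rw [hf ν hν]
      refine lt_of_le_of_lt ?_ h1
      rcases ((fun c => f c i + 1) '' B ν i).eq_empty_or_nonempty with h0 | h0
      · simp [h0]
      · exact csSup_le h0 fun x hx => (h2 x hx).le
  have hBlt : ∀ ν < (Order.succ mu).ord, ∀ i, ∀ c ∈ B ν i, f c i < f ν i := by
    intro ν hν i c hc
    rw [hf ν hν i]
    refine (lt_add_one (f c i)).trans_le (le_csSup ⟨(Order.succ (M i)).ord, ?_⟩ ⟨c, hc, rfl⟩)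
    rintro _ ⟨c, hc, rfl⟩
    exact Order.add_one_le_of_lt (hlt c ((hB1 ν hν i c hc).trans hν) i)
  refine ⟨f, fun ν hν i => (hlt ν hν i).trans_le ?_, fun ν hν c hc => ?_, fun ν hν =>
    ⟨e ν, he1 ν hν, ?_⟩⟩
  · exact Cardinal.ord_le_ord.2 (Order.succ_le_of_lt (hM.lt i))
  · filter_upwards [hB3 ν hν c hc] with i hi using hBlt ν hν i c hi
  · filter_upwards [he2 ν hν] with i hi c hc using hBlt ν hν i c (hi hc)

end PreScale

section Guessing

/-- Club guessing at cofinality `χ` on `χ⁺⁺`. -/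
theorem exists_club_guessing {χ : Cardinal.{0}} (hχ : χ.IsRegular) :
    ∃ C : Ordinal.{0} → Set Ordinal.{0}, (∀ δ, ∀ x ∈ C δ, x < δ) ∧
      ∀ E, IsClubIn E (Order.succ (Order.succ χ)).ord →
        ∃ δ < (Order.succ (Order.succ χ)).ord, δ.cof = χ ∧ C δ ⊆ E ∧ ∀ x < δ, ∃ y ∈ C δ, x < y := by
  have hr1 := Cardinal.isRegular_succ hχ.aleph0_le
  have hr := Cardinal.isRegular_succ hr1.aleph0_le
  have hu : Cardinal.aleph0 < Order.succ (Order.succ χ) := hr1.aleph0_le.trans_lt (Order.lt_succ _)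
  set Θ := Order.succ (Order.succ χ) with hΘ
  choose cb hcb1 hcb2 hcb3 using exists_cofinal_set
  let D : Set Ordinal.{0} → Ordinal.{0} → Set Ordinal.{0} := fun E δ =>
    {x | x < δ ∧ x ≠ 0 ∧ ∃ a ∈ cb δ, x = projBelow E a}
  suffices hE : ∃ E, IsClubIn E Θ.ord ∧ ∀ E', IsClubIn E' Θ.ord → ∃ δ < Θ.ord, δ.cof = χ ∧
      D E δ ⊆ E' ∧ ∀ x < δ, ∃ y ∈ D E δ, x < y by
    obtain ⟨E, -, h⟩ := hE
    exact ⟨D E, fun δ x hx => hx.1, h⟩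
  by_contra! hcon
  choose! W hW1 hW2 using hcon
  have hΩ : (Order.succ χ).ord < Θ.ord := Cardinal.ord_lt_ord.2 (Order.lt_succ _)
  obtain ⟨E, hE1, hE2⟩ := exists_decreasing_clubs hr hu hΩ hW1
  set Ω := (Order.succ χ).ord with hΩd
  have hΩ0 : 0 < Ω := Cardinal.ord_pos.2 hr1.pos
  obtain ⟨δ, hδ, h0δ, hδc, hδacc⟩ := (hE1 Ω le_rfl).exists_cof_eq hr hχ
    ((Order.lt_succ χ).trans (Order.lt_succ _)) (Cardinal.ord_pos.2 hr.pos)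
  have hδΘ := (hE1 Ω le_rfl).1 hδ
  have hanti : ∀ ζ ζ', ζ ≤ ζ' → E ζ' ⊆ E ζ := fun ζ ζ' hz => by
    rcases hz.eq_or_lt with rfl | hz
    · rfl
    · exact fun x hx => (hE2 _ _ hz hx).1
  choose ζ hζ1 hζ2 using fun a => exists_stable_of_antitone
    (h := fun ζ => projBelow (E ζ) a) hΩ0 (fun ζ ζ' hz _ => projBelow_mono (hanti ζ ζ' hz) a)
  obtain ⟨ζs, hs1, hs2⟩ := exists_bound_image (s := cb δ) (f := ζ) (δ := Ω) (by
    rw [hcb3, hΩd, hr1.cof_ord, hδc]; simp) (fun a _ => hζ1 a)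
  have hlim := hr1.isSuccLimit_ord
  obtain ⟨x, hx, hx'⟩ := hW2 (E ζs) (hE1 ζs hs1.le) δ hδΘ hδc (by
    rintro x ⟨hxδ, hx0, a, ha, rfl⟩
    have h1 := hζ2 a ζs (hs2 a ha).le hs1
    have h2 := hζ2 a (ζs + 1) ((hs2 a ha).le.trans (lt_add_one _).le) (hlim.add_one_lt hs1)
    have h3 : projBelow (E ζs) a = projBelow (E (ζs + 1)) a := h1.trans h2.symm
    rw [h3] at hx0 ⊢
    have := projBelow_mem (hE1 (ζs + 1) (hlim.add_one_lt hs1).le).2.1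
      ((hcb1 δ a ha).trans hδΘ) hx0
    exact (hE2 (ζs + 1) ζs (lt_add_one _) this).2)
  obtain ⟨z, hz, hxz, hzδ⟩ := hδacc x hx
  obtain ⟨a, ha, hza⟩ := hcb2 δ z hzδ
  have hle := le_projBelow (hanti ζs Ω hs1.le hz) hza
  have := hx' (projBelow (E ζs) a) ⟨(projBelow_le _ _).trans_lt (hcb1 δ a ha),
    (hxz.trans_le hle).pos.ne', a, ha, rfl⟩
  exact (hxz.trans_le hle).not_ge this

end Guessing

section Free

variable {mu : Cardinal.{0}} {f : Ordinal.{0} → Idx mu → Ordinal.{0}}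

/-- A normal sequence in `mu⁺` whose successor steps dominate a prescribed function of the
initial segment built so far. -/
theorem IsSingular.exists_normal_sequence (h : IsSingular mu) {Θ : Ordinal.{0}} (hΘ : Θ.card ≤ mu)
    {G : Ordinal.{0} → (Ordinal.{0} → Ordinal.{0}) → Ordinal.{0}}
    (hG : ∀ k < Θ, ∀ s : Ordinal.{0} → Ordinal.{0}, (∀ l, s l < (Order.succ mu).ord) →
      G k s < (Order.succ mu).ord) :
    ∃ δ : Ordinal.{0} → Ordinal.{0}, (∀ j ≤ Θ, δ j < (Order.succ mu).ord) ∧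
      (∀ k < Θ, ∃ s : Ordinal.{0} → Ordinal.{0}, (∀ l ≤ k, s l = δ l) ∧
        (∀ l, s l < (Order.succ mu).ord) ∧ G k s < δ (k + 1)) ∧
      (∀ k j, k < j → j ≤ Θ → δ k < δ j) ∧
      ∀ j ≤ Θ, Order.IsSuccLimit j → ∀ x < δ j, ∃ k < j, x < δ k := by
  classical
  let N : Ordinal.{0} → (Ordinal.{0} → Ordinal.{0}) → Ordinal.{0} := fun k s =>
    max (s k) (G k s) + 1
  let r : Ordinal.{0} → (Ordinal.{0} → Ordinal.{0}) → Ordinal.{0} → Ordinal.{0} := fun k s l =>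
    if l ≤ k then s l else 0
  let δ : Ordinal.{0} → Ordinal.{0} := WellFoundedLT.fix fun j ih =>
    sSup {x | ∃ k < j, x = N k (r k fun l => if hl : l < j then ih l hl else 0)}
  have hδ : ∀ j, δ j = sSup ((fun k => N k (r k δ)) '' Iio j) := by
    intro j
    have := WellFoundedLT.fix_eq (fun (j : Ordinal.{0}) (ih : ∀ l < j, Ordinal.{0}) =>
      sSup {x | ∃ k < j, x = N k (r k fun l => if hl : l < j then ih l hl else 0)}) j
    refine this.trans (congrArg sSup ?_)
    have e : ∀ k < j, (r k fun l => if hl : l < j then δ l else 0) = r k δ := by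
      intro k hk
      funext l
      by_cases hl : l ≤ k
      · simp only [r, if_pos hl, dif_pos (hl.trans_lt hk)]
      · simp only [r, if_neg hl]
    ext y
    simp only [mem_ofPred_eq, mem_image, mem_Iio]
    constructor
    · rintro ⟨k, hk, rfl⟩
      exact ⟨k, hk, congrArg (N k) (e k hk).symm⟩
    · rintro ⟨k, hk, rfl⟩
      exact ⟨k, hk, congrArg (N k) (e k hk).symm⟩
  have hreg := h.isRegular_succ
  have hlim := hreg.isSuccLimit_ord
  have h0 : (0 : Ordinal) < (Order.succ mu).ord := Cardinal.ord_pos.2 hreg.pos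
  have hr : ∀ k, (∀ l ≤ k, δ l < (Order.succ mu).ord) → ∀ l, r k δ l < (Order.succ mu).ord := by
    intro k hk l
    by_cases hl : l ≤ k
    · simpa only [r, if_pos hl] using hk l hl
    · simpa only [r, if_neg hl] using h0
  have hN : ∀ k < Θ, (∀ l ≤ k, δ l < (Order.succ mu).ord) → N k (r k δ) < (Order.succ mu).ord :=
    fun k hk hkl => hlim.add_one_lt (max_lt (hr k hkl k) (hG k hk _ (hr k hkl)))
  have hcard : ∀ j ≤ Θ, j.card < (Order.succ mu).ord.cof := fun j hj => by
    rw [hreg.cof_ord]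
    exact Order.lt_succ_iff.2 ((Ordinal.card_le_card hj).trans hΘ)
  have hlt : ∀ j, j ≤ Θ → δ j < (Order.succ mu).ord := by
    intro j
    induction j using WellFoundedLT.induction with
    | _ j ih =>
      intro hj
      obtain ⟨γ, h1, h2⟩ := exists_bound_Iio (f := fun k => N k (r k δ)) (hcard j hj)
        (fun k hk => hN k (hk.trans_le hj)
          fun l hl => ih l (hl.trans_lt hk) ((hl.trans_lt hk).le.trans hj))
      rw [hδ]
      refine lt_of_le_of_lt ?_ h1
      rcases ((fun k => N k (r k δ)) '' Iio j).eq_empty_or_nonempty with h0 | h0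
      · rw [h0]; simp
      · refine csSup_le h0 ?_
        rintro _ ⟨k, hk, rfl⟩
        exact (h2 k hk).le
  have hle : ∀ k j, k < j → j ≤ Θ → N k (r k δ) ≤ δ j := by
    intro k j hk hj
    rw [hδ j]
    refine le_csSup ⟨(Order.succ mu).ord, ?_⟩ ⟨k, hk, rfl⟩
    rintro _ ⟨k, hk, rfl⟩
    exact (hN k (lt_of_lt_of_le hk hj) fun l hl => hlt l (hl.trans (le_of_lt hk) |>.trans hj)).le
  have hself : ∀ k, r k δ k = δ k := fun k => by simp [r]
  refine ⟨δ, hlt, fun k hk => ⟨r k δ, fun l hl => by simp [r, hl],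
    hr k fun l hl => hlt l (hl.trans hk.le), ?_⟩, fun k j hkj hj => ?_, fun j hj hjl x hx => ?_⟩
  · refine lt_of_lt_of_le ?_ (hle k (k + 1) (lt_add_one k) (Order.add_one_le_of_lt hk))
    exact (le_max_right _ _).trans_lt (lt_add_one _)
  · refine lt_of_lt_of_le ?_ (hle k j hkj hj)
    calc δ k = r k δ k := (hself k).symm
      _ ≤ _ := le_max_left _ _
      _ < _ := lt_add_one _
  · rw [hδ] at hx
    have hne : ((fun k => N k (r k δ)) '' Iio j).Nonempty := ⟨_, 0, hjl.bot_lt, rfl⟩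
    obtain ⟨_, ⟨k, hk, rfl⟩, hxk⟩ := exists_lt_of_lt_csSup hne hx
    have hk1 : k + 1 < j := hjl.add_one_lt hk
    exact ⟨k + 1, hk1, lt_of_lt_of_le hxk (hle k _ (lt_add_one k) (hk1.le.trans hj))⟩

/-- Every unbounded subset of `mu⁺` contains `χ` many indices along which the prescale is
everywhere increasing from a fixed coordinate on. -/
theorem IsPrescale.exists_free (hf : IsPrescale mu f) (h : IsSingular mu) {χ : Cardinal.{0}}
    (hχ : χ.IsRegular) (hκχ : Ordinal.cof mu.ord < χ) (hχm : χ < mu) {X : Set Ordinal.{0}}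
    (hX : ∀ x < (Order.succ mu).ord, ∃ y ∈ X, x < y ∧ y < (Order.succ mu).ord) :
    ∃ X₀ ⊆ X, (∀ x ∈ X₀, x < (Order.succ mu).ord) ∧ Cardinal.lift.{1} χ ≤ Cardinal.mk X₀ ∧
      (∀ x ∈ X₀, ∃ y ∈ X₀, x < y) ∧
      ∃ z, ∀ a ∈ X₀, ∀ b ∈ X₀, a < b → ∀ i, z ≤ i → f a i < f b i := by
  classical
  obtain ⟨C, hC1, hC2⟩ := exists_club_guessing hχ
  have hr1 := Cardinal.isRegular_succ hχ.aleph0_le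
  have hr := Cardinal.isRegular_succ hr1.aleph0_le
  have hu : Cardinal.aleph0 < Order.succ (Order.succ χ) := hr1.aleph0_le.trans_lt (Order.lt_succ _)
  have hΘm : Order.succ (Order.succ χ) < mu := h.succ_lt (h.succ_lt hχm)
  set Θ := Order.succ (Order.succ χ) with hΘ
  have hreg := h.isRegular_succ
  have hlimΘ := hr.isSuccLimit_ord
  -- the condition stating that `x` dominates the part of the `α`-th guess up to `k`
  let P : Ordinal.{0} → (Ordinal.{0} → Ordinal.{0}) → Ordinal.{0} → Ordinal.{0} → Prop :=
    fun k s α x => ∀ᶠ i in Filter.atTop, ∀ l ∈ C α, l ≤ k → f (s l) i < f x i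
  have hG : ∀ k < Θ.ord, ∀ s : Ordinal.{0} → Ordinal.{0}, ∃ γ < (Order.succ mu).ord, ∀ α < Θ.ord,
      (∃ ν < (Order.succ mu).ord, P k s α ν) → ∃ x ∈ X, x < γ ∧ P k s α x := by
    intro k hk s
    have h1 : ∀ α, (∃ ν < (Order.succ mu).ord, P k s α ν) →
        ∃ x ∈ X, x < (Order.succ mu).ord ∧ P k s α x := by
      rintro α ⟨ν, hν, hP⟩
      obtain ⟨x, hx, hνx, hxl⟩ := hX ν hν
      refine ⟨x, hx, hxl, ?_⟩
      filter_upwards [hP, hf.mono x hxl ν hνx] with i h1 h2 l hl hlk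
      exact (h1 l hl hlk).trans h2
    choose! g hg1 hg2 hg3 using h1
    obtain ⟨γ, h1, h2⟩ := exists_bound_image
      (s := {α | α < Θ.ord ∧ ∃ ν < (Order.succ mu).ord, P k s α ν}) (f := g)
      (δ := (Order.succ mu).ord) (by
        rw [hreg.cof_ord, Cardinal.lift_lt]
        refine (Cardinal.mk_le_mk_of_subset (t := Iio Θ.ord) fun x hx => hx.1).trans_lt ?_
        rw [Cardinal.mk_Iio_ordinal, Cardinal.card_ord, Cardinal.lift_lt]
        exact hΘm.trans (Order.lt_succ _)) (fun α hα => hg2 α hα.2)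
    exact ⟨γ, h1, fun α hα hα2 => ⟨g α, hg1 α hα2, h2 α ⟨hα, hα2⟩, hg3 α hα2⟩⟩
  choose! G hG1 hG2 using hG
  obtain ⟨δ, hδ1, hδ2, hδ3, hδ4⟩ := h.exists_normal_sequence (Θ := Θ.ord)
    (by rw [Cardinal.card_ord]; exact hΘm.le) (G := G) (fun k hk s _ => hG1 k hk s)
  obtain ⟨e, he1, he2⟩ := hf.club (δ Θ.ord) (hδ1 _ le_rfl)
  -- a club of indices `j` with `δ j ∈ e`
  have hnext : ∀ j < Θ.ord, ∃ j' < Θ.ord, ∃ c ∈ e, δ j < c ∧ c < δ j' := by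
    intro j hj
    have hj1 := hlimΘ.add_one_lt hj
    obtain ⟨c, hc, h1, h2⟩ := he1.2.2 (δ (j + 1)) (hδ3 _ _ hj1 le_rfl)
    obtain ⟨j', hj', h3⟩ := hδ4 _ le_rfl hlimΘ c h2
    exact ⟨j', hj', c, hc, (hδ3 _ _ (lt_add_one j) hj1.le).trans_le h1, h3⟩
  choose! b hb1 hb2 using hnext
  have hD := isClubIn_inter hr hu (isClubIn_inter hr hu (isClubIn_closure hr hu hb1)
    (isClubIn_closure hr hu (b := fun x => x + 1) fun x hx => hlimΘ.add_one_lt hx))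
    (isClubIn_Ioo hr (x := 0) (Cardinal.ord_pos.2 hr.pos))
  obtain ⟨α, hα, hαc, hCD, hCu⟩ := hC2 _ hD
  have hCe : ∀ j ∈ C α, j < Θ.ord ∧ δ j ∈ e := by
    intro j hj
    obtain ⟨⟨⟨hjΘ, hjb⟩, -, hj1⟩, hj0, -⟩ := hCD hj
    refine ⟨hjΘ, he1.2.1 _ (hδ3 _ _ hjΘ le_rfl) ((hδ3 0 j hj0 hjΘ.le).pos) fun x hx => ?_⟩
    have hjl : Order.IsSuccLimit j := by
      rw [Order.isSuccLimit_iff]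
      refine ⟨fun hm => hj0.ne' ?_, Order.isSuccPrelimit_of_succ_lt fun a ha => ?_⟩
      · simpa using hm
      · simpa using hj1 a ha
    obtain ⟨k, hk, hxk⟩ := hδ4 j hjΘ.le hjl x hx
    obtain ⟨c, hc, h1, h2⟩ := hb2 k (hk.trans hjΘ)
    exact ⟨c, hc, hxk.trans h1, h2.trans (hδ3 _ _ (hjb k hk) hjΘ.le)⟩
  have hx : ∀ k ∈ C α, ∃ x ∈ X, x < δ (k + 1) ∧
      ∀ᶠ i in Filter.atTop, ∀ l ∈ C α, l ≤ k → f (δ l) i < f x i := by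
    intro k hk
    have hkΘ := (hCe k hk).1
    obtain ⟨s, hs1, hs2, hs3⟩ := hδ2 k hkΘ
    obtain ⟨x, hx1, hx2, hx3⟩ := hG2 k hkΘ s α hα ⟨δ Θ.ord, hδ1 _ le_rfl, by
      filter_upwards [he2] with i hi l hl hlk
      rw [hs1 l hlk]
      exact hi _ (hCe l hl).2⟩
    refine ⟨x, hx1, hx2.trans hs3, ?_⟩
    filter_upwards [hx3] with i hi l hl hlk
    rw [← hs1 l hlk]
    exact hi l hl hlk
  choose! x hx1 hx2 hx3 using hx
  have hxl : ∀ k ∈ C α, x k < (Order.succ mu).ord := fun k hk =>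
    (hx2 k hk).trans (hδ1 _ (Order.add_one_le_of_lt (hCe k hk).1))
  have hz : ∀ k ∈ C α, ∃ z k', k' ∈ C α ∧ k < k' ∧ (∀ m ∈ C α, k < m → k' ≤ m) ∧ ∀ i, z ≤ i →
      (∀ l ∈ C α, l ≤ k → f (δ l) i < f (x k) i) ∧ f (x k) i < f (δ k') i := by
    intro k hk
    obtain ⟨k', ⟨hk1, hk2⟩, hk3⟩ := WellFounded.has_min (wellFounded_lt (α := Ordinal.{0}))
      {m | m ∈ C α ∧ k < m} (hCu k (hC1 α k hk))
    have h1 : ∀ᶠ i in Filter.atTop, f (x k) i < f (δ k') i := by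
      refine hf.mono _ (hδ1 _ (hCe k' hk1).1.le) _ ((hx2 k hk).trans_le ?_)
      rcases (Order.add_one_le_of_lt hk2).eq_or_lt with h0 | h0
      · rw [h0]
      · exact (hδ3 _ _ h0 (hCe k' hk1).1.le).le
    obtain ⟨z, hz⟩ := h.eventually_atTop.1 ((hx3 k hk).and h1)
    exact ⟨z, k', hk1, hk2, fun m hm hkm => not_lt.1 (hk3 m ⟨hm, hkm⟩), hz⟩
  have := h.nonempty_idx
  choose! z k' hz1 hz2 hz3 hz4 using hz
  obtain ⟨z₀, hz₀⟩ : ∃ z₀, ∀ y < α, ∃ k ∈ C α, z k = z₀ ∧ y < k := by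
    by_contra! hcon
    choose y hy1 hy2 using hcon
    obtain ⟨γ, h1, h2⟩ := exists_bound (f := y) (δ := α) (by rwa [Idx.mk_eq, hαc]) hy1
    obtain ⟨k, hk, hγk⟩ := hCu γ h1
    exact (hy2 (z k) k hk rfl).not_gt ((h2 _).trans hγk)
  have key : ∀ k ∈ C α, ∀ m ∈ C α, z k = z₀ → z m = z₀ → k < m → ∀ i, z₀ ≤ i →
      f (x k) i < f (x m) i := by
    intro k hk m hm hzk hzm hkm i hi
    refine ((hz4 k hk i (hzk ▸ hi)).2).trans ?_
    exact (hz4 m hm i (hzm ▸ hi)).1 _ (hz1 k hk) (hz3 k hk m hm hkm)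
  have hlt : ∀ k ∈ C α, ∀ m ∈ C α, z k = z₀ → z m = z₀ → (x k < x m ↔ k < m) := by
    have h1 : ∀ k ∈ C α, ∀ m ∈ C α, z k = z₀ → z m = z₀ → k < m → x k < x m := by
      intro k hk m hm hzk hzm hkm
      by_contra! hle
      rcases hle.eq_or_lt with he | hlt
      · have := key k hk m hm hzk hzm hkm z₀ le_rfl
        rw [he] at this
        exact this.false
      · obtain ⟨w, hw⟩ := h.eventually_atTop.1 (hf.mono _ (hxl k hk) _ hlt)
        exact (hw (max w z₀) (le_max_left _ _)).asymm
          (key k hk m hm hzk hzm hkm _ (le_max_right _ _))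
    intro k hk m hm hzk hzm
    refine ⟨fun hxx => ?_, h1 k hk m hm hzk hzm⟩
    by_contra! hle
    rcases hle.eq_or_lt with he | hlt
    · rw [he] at hxx; exact hxx.false
    · exact hxx.asymm (h1 m hm k hk hzm hzk hlt)
  refine ⟨x '' {k ∈ C α | z k = z₀}, ?_, ?_, ?_, ?_, z₀, ?_⟩
  · rintro _ ⟨k, hk, rfl⟩; exact hx1 k hk.1
  · rintro _ ⟨k, hk, rfl⟩; exact hxl k hk.1
  · rw [Cardinal.mk_image_eq_of_injOn, ← hαc]
    · refine cof_le_of_cofinal (fun k hk => hC1 α k hk.1) fun y hy => ?_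
      obtain ⟨k, hk, h1, h2⟩ := hz₀ y hy
      exact ⟨k, ⟨hk, h1⟩, h2.le⟩
    · intro k hk m hm he
      by_contra hne
      rcases lt_or_gt_of_ne hne with h1 | h1
      · exact ((hlt k hk.1 m hm.1 hk.2 hm.2).2 h1).ne he
      · exact ((hlt m hm.1 k hk.1 hm.2 hk.2).2 h1).ne he.symm
  · rintro _ ⟨k, hk, rfl⟩
    obtain ⟨m, hm, h1, h2⟩ := hz₀ k (hC1 α k hk.1)
    exact ⟨x m, ⟨m, ⟨hm, h1⟩, rfl⟩, (hlt k hk.1 m hm hk.2 h1).2 h2⟩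
  · rintro _ ⟨k, hk, rfl⟩ _ ⟨m, hm, rfl⟩ hkm i hi
    exact key k hk.1 m hm.1 hk.2 hm.2 ((hlt k hk.1 m hm.1 hk.2 hm.2).1 hkm) i hi

end Free

section Scale

variable {mu : Cardinal.{0}} {f : Ordinal.{0} → Idx mu → Ordinal.{0}}

/-- The least element of `A` that is at least `a`. -/
def projAbove (A : Set Ordinal.{0}) (a : Ordinal.{0}) : Ordinal.{0} := sInf (A ∩ Ici a)

theorem projAbove_mem {A : Set Ordinal.{0}} {a z : Ordinal.{0}} (hz : z ∈ A) (h : a ≤ z) :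
    projAbove A a ∈ A ∧ a ≤ projAbove A a :=
  csInf_mem (s := A ∩ Ici a) ⟨z, hz, h⟩

theorem projAbove_le {A : Set Ordinal.{0}} {a z : Ordinal.{0}} (hz : z ∈ A) (h : a ≤ z) :
    projAbove A a ≤ z :=
  csInf_le' ⟨hz, h⟩

theorem projAbove_mono {A : Set Ordinal.{0}} {a b z : Ordinal.{0}} (hab : a ≤ b) (hz : z ∈ A)
    (h : b ≤ z) : projAbove A a ≤ projAbove A b :=
  projAbove_le (projAbove_mem hz h).1 (hab.trans (projAbove_mem hz h).2)

theorem projAbove_anti {A B : Set Ordinal.{0}} {a z : Ordinal.{0}} (hAB : A ⊆ B) (hz : z ∈ A)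
    (h : a ≤ z) : projAbove B a ≤ projAbove A a :=
  projAbove_le (hAB (projAbove_mem hz h).1) (projAbove_mem hz h).2

/-- Projections of the prescale to small sets are eventually constant. -/
theorem IsPrescale.exists_projAbove_const (hf : IsPrescale mu f) (h : IsSingular mu)
    {χ : Cardinal.{0}} (hχ : χ.IsRegular) (hκχ : Ordinal.cof mu.ord < χ) (hχm : χ < mu)
    {A : Idx mu → Set Ordinal.{0}} (hA : ∀ i, Cardinal.mk (A i) < Cardinal.lift.{1} χ)
    (htop : ∀ i, mu.ord ∈ A i) :
    ∃ α₀ < (Order.succ mu).ord, ∀ α < (Order.succ mu).ord, α₀ ≤ α →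
      ∀ᶠ i in Filter.atTop, projAbove (A i) (f α i) = projAbove (A i) (f α₀ i) := by
  classical
  by_contra! hcon
  have hreg := h.isRegular_succ
  have hlim := hreg.isSuccLimit_ord
  have hle : ∀ α < (Order.succ mu).ord, ∀ i, f α i ≤ mu.ord := fun α hα i => (hf.lt α hα i).le
  have h1 : ∀ α < (Order.succ mu).ord, ∃ β < (Order.succ mu).ord, ∀ γ < (Order.succ mu).ord,
      β ≤ γ → ∃ᶠ i in Filter.atTop, projAbove (A i) (f α i) < projAbove (A i) (f γ i) := by
    intro α hα
    obtain ⟨β, hβ, hαβ, hne⟩ := hcon α hα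
    have hαβ' : α < β := by
      refine hαβ.lt_of_ne ?_
      rintro rfl
      have := h.neBot
      obtain ⟨i, hi⟩ := hne.exists
      exact hi rfl
    refine ⟨β, hβ, fun γ hγ hβγ => ?_⟩
    have h2 : ∀ᶠ i in Filter.atTop, f β i ≤ f γ i := by
      rcases hβγ.eq_or_lt with rfl | hlt
      · exact Filter.Eventually.of_forall fun _ => le_rfl
      · exact (hf.mono γ hγ β hlt).mono fun _ hi => hi.le
    refine (hne.and_eventually ((hf.mono β hβ α hαβ').and h2)).mono fun i hi => ?_
    have h3 := projAbove_mono hi.2.1.le (htop i) (hle β hβ i)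
    exact (h3.lt_of_ne hi.1.symm).trans_le (projAbove_mono hi.2.2 (htop i) (hle γ hγ i))
  choose! n hn1 hn2 using h1
  have hcl := isClubIn_closure hreg h.aleph0_lt_succ hn1
  obtain ⟨X₀, hX1, hX2, hX3, hX4, z, hz⟩ := hf.exists_free h hχ hκχ hχm
    (X := {δ | δ < (Order.succ mu).ord ∧ ∀ x < δ, n x < δ}) (fun x hx => hcl.exists_gt hreg hx)
  have h2 : ∀ a ∈ X₀, ∃ i, z ≤ i ∧ ∀ b ∈ X₀, a < b →
      projAbove (A i) (f a i) < projAbove (A i) (f b i) := by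
    intro a ha
    obtain ⟨a', ⟨ha1, ha2⟩, ha3⟩ := WellFounded.has_min (wellFounded_lt (α := Ordinal.{0}))
      {m | m ∈ X₀ ∧ a < m} (hX4 a ha)
    have h3 := hn2 a (hX2 a ha) a' (hX2 a' ha1) ((hX1 ha1).2 a ha2).le
    have := h.nonempty_idx
    obtain ⟨i, hi1, hi2⟩ := (h3.and_eventually (Filter.eventually_ge_atTop z)).exists
    refine ⟨i, hi2, fun b hb hab => hi1.trans_le ?_⟩
    rcases (not_lt.1 (fun hlt => ha3 b ⟨hb, hab⟩ hlt)).eq_or_lt with rfl | hlt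
    · rfl
    · exact projAbove_mono (hz a' ha1 b hb hlt i hi2).le (htop i) (hle b (hX2 b hb) i)
  have := h.nonempty_idx
  choose! t ht1 ht2 using h2
  have hinj : Function.Injective (fun a : X₀ => (⟨t a, ⟨projAbove (A (t a)) (f a (t a)),
      (projAbove_mem (htop _) (hle a (hX2 a a.2) _)).1⟩⟩ : Σ i, A i)) := by
    have key : ∀ a ∈ X₀, ∀ b ∈ X₀, t a = t b → projAbove (A (t a)) (f a (t a)) =
        projAbove (A (t b)) (f b (t b)) → ¬ a < b := by
      intro a ha b hb hab he hlt
      have := ht2 a ha b hb hlt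
      rw [he, hab] at this
      exact this.false
    rintro ⟨a, ha⟩ ⟨b, hb⟩ he
    simp only [Sigma.mk.injEq] at he
    obtain ⟨he1, he2⟩ := he
    have he3 : projAbove (A (t a)) (f a (t a)) = projAbove (A (t b)) (f b (t b)) := by
      have : ∀ (i j : Idx mu) (x : A i) (y : A j), i = j → HEq x y → x.1 = y.1 := by
        rintro i j x y rfl hxy
        exact congrArg _ (eq_of_heq hxy)
      exact this _ _ _ _ he1 he2
    refine Subtype.ext ?_
    by_contra hne
    rcases lt_or_gt_of_ne hne with hlt | hlt
    · exact key a ha b hb he1 he3 hlt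
    · exact key b hb a ha he1.symm he3.symm hlt
  have h3 := Cardinal.lift_mk_le_lift_mk_of_injective hinj
  have h4 : Cardinal.mk (Σ i, A i) < Cardinal.lift.{1} χ := by
    rw [Cardinal.mk_sigma]
    refine Cardinal.sum_lt_lift_of_isRegular (c := Cardinal.lift.{1} χ) ?_ ?_ ?_
    · exact hχ.lift
    · rw [Idx.mk_eq]; exact Cardinal.lift_lt.2 hκχ
    · exact hA
  simp only [Cardinal.lift_id] at h3
  exact (hX3.trans h3).not_gt h4

/-- `g` is an upper bound of the prescale modulo eventual domination. -/
def IsUB (mu : Cardinal.{0}) (f : Ordinal.{0} → Idx mu → Ordinal.{0}) (g : Idx mu → Ordinal.{0}) :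
    Prop :=
  ∀ α < (Order.succ mu).ord, ∀ᶠ i in Filter.atTop, f α i ≤ g i

theorem IsPrescale.isUB_of_eventually_const (hf : IsPrescale mu f)
    {A : Idx mu → Set Ordinal.{0}} (htop : ∀ i, mu.ord ∈ A i) {α₀ : Ordinal.{0}}
    (hα₀ : α₀ < (Order.succ mu).ord)
    (hA : ∀ α < (Order.succ mu).ord, α₀ ≤ α →
      ∀ᶠ i in Filter.atTop, projAbove (A i) (f α i) = projAbove (A i) (f α₀ i)) :
    IsUB mu f fun i => projAbove (A i) (f α₀ i) := by
  intro α hα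
  have h1 : ∀ α < (Order.succ mu).ord, ∀ i, f α i ≤ projAbove (A i) (f α i) := fun α hα i =>
    (projAbove_mem (htop i) (hf.lt α hα i).le).2
  rcases le_or_gt α₀ α with hle | hlt
  · filter_upwards [hA α hα hle] with i hi
    exact (h1 α hα i).trans_eq hi
  · filter_upwards [hf.mono α₀ hα₀ α hlt] with i hi
    exact hi.le.trans (h1 α₀ hα₀ i)

/-- A minimal upper bound exists. -/
theorem IsPrescale.exists_minimal_isUB (hf : IsPrescale mu f) (h : IsSingular mu) :
    ∃ g, (∀ i, g i ≤ mu.ord) ∧ IsUB mu f g ∧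
      ∀ u, (∀ i, u i ≤ g i) → IsUB mu f u → ∀ᶠ i in Filter.atTop, g i ≤ u i := by
  classical
  by_contra! hcon
  choose! R hR1 hR2 hR3 using hcon
  set χ := Order.succ (Ordinal.cof mu.ord) with hχd
  have hχ : χ.IsRegular := Cardinal.isRegular_succ h.isRegular_cof.aleph0_le
  have hκχ : Ordinal.cof mu.ord < χ := Order.lt_succ _
  have hχm : χ < mu := h.succ_lt h.2
  have hproj : ∀ A : Idx mu → Set Ordinal.{0},
      (∀ i, Cardinal.mk (A i) < Cardinal.lift.{1} χ) ∧ (∀ i, mu.ord ∈ A i) →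
      ∃ α₀ < (Order.succ mu).ord, ∀ α < (Order.succ mu).ord, α₀ ≤ α →
        ∀ᶠ i in Filter.atTop, projAbove (A i) (f α i) = projAbove (A i) (f α₀ i) := fun A hA =>
    hf.exists_projAbove_const h hχ hκχ hχm hA.1 hA.2
  choose! α hα1 hα2 using hproj
  let H : (Idx mu → Set Ordinal.{0}) → Idx mu → Ordinal.{0} := fun A i =>
    projAbove (A i) (f (α A) i)
  let A : Ordinal.{0} → Idx mu → Set Ordinal.{0} := WellFoundedLT.fix fun ξ ih i =>
    {mu.ord} ∪ {x | ∃ (η : Ordinal.{0}) (hη : η < ξ), x = R (H (ih η hη)) i}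
  have hA : ∀ ξ i, A ξ i = {mu.ord} ∪ (fun η => R (H (A η)) i) '' Iio ξ := by
    intro ξ i
    have := congrFun (WellFoundedLT.fix_eq (fun (ξ : Ordinal.{0})
      (ih : ∀ c < ξ, Idx mu → Set Ordinal.{0}) (i : Idx mu) =>
      {mu.ord} ∪ {x | ∃ (η : Ordinal.{0}) (hη : η < ξ), x = R (H (ih η hη)) i}) ξ) i
    refine this.trans (congrArg _ ?_)
    ext y
    simp only [mem_ofPred_eq, mem_image, mem_Iio]
    exact ⟨fun ⟨c, hc, e⟩ => ⟨c, hc, e.symm⟩, fun ⟨c, hc, e⟩ => ⟨c, hc, e.symm⟩⟩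
  have htop : ∀ ξ i, mu.ord ∈ A ξ i := fun ξ i => by rw [hA]; exact Or.inl rfl
  have hAc : ∀ ξ < χ.ord, ∀ i, Cardinal.mk (A ξ i) < Cardinal.lift.{1} χ := by
    intro ξ hξ i
    rw [hA]
    refine (Cardinal.mk_union_le _ _).trans_lt ?_
    have hal : Cardinal.aleph0 ≤ Cardinal.lift.{1} χ := by simpa using hχ.aleph0_le
    refine Cardinal.add_lt_of_lt hal ?_ (Cardinal.mk_image_le.trans_lt ?_)
    · rw [Cardinal.mk_singleton]
      exact Cardinal.one_lt_aleph0.trans_le hal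
    · rw [Cardinal.mk_Iio_ordinal, Cardinal.lift_lt]
      exact Cardinal.lt_ord.1 hξ
  have hHtop : ∀ ξ < χ.ord, ∀ i, H (A ξ) i ≤ mu.ord := fun ξ hξ i =>
    projAbove_le (htop ξ i) (hf.lt _ (hα1 _ ⟨hAc ξ hξ, htop ξ⟩) i).le
  have hHub : ∀ ξ < χ.ord, IsUB mu f (H (A ξ)) := fun ξ hξ =>
    hf.isUB_of_eventually_const (htop ξ) (hα1 _ ⟨hAc ξ hξ, htop ξ⟩) (hα2 _ ⟨hAc ξ hξ, htop ξ⟩)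
  obtain ⟨αs, hs1, hs2⟩ := exists_bound_Iio (a := χ.ord) (δ := (Order.succ mu).ord)
    (f := fun ξ => α (A ξ)) (by
      rw [Cardinal.card_ord, h.isRegular_succ.cof_ord]; exact hχm.trans (Order.lt_succ _))
    (fun ξ hξ => hα1 _ ⟨hAc ξ hξ, htop ξ⟩)
  have hχ0 : 0 < χ.ord := Cardinal.ord_pos.2 hχ.pos
  have hsub : ∀ ξ ξ', ξ ≤ ξ' → ∀ i, A ξ i ⊆ A ξ' i := fun ξ ξ' hle i => by
    rw [hA, hA]
    exact union_subset_union_right _ (image_mono (Iio_subset_Iio hle))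
  choose ζ hζ1 hζ2 using fun i => exists_stable_of_antitone
    (h := fun ξ => projAbove (A ξ i) (f αs i)) hχ0
    (fun ξ ξ' hle _ => projAbove_anti (hsub ξ ξ' hle i) (htop ξ i) (hf.lt αs hs1 i).le)
  obtain ⟨ξ, h1, h2⟩ := exists_bound (f := ζ) (δ := χ.ord)
    (by rw [hχ.cof_ord, Idx.mk_eq]; exact hκχ) hζ1
  have hξ1 := hχ.isSuccLimit_ord.add_one_lt h1
  have h3 := hα2 _ ⟨hAc ξ h1, htop ξ⟩ αs hs1 (hs2 ξ h1).le
  have h4 := hR2 (H (A ξ)) (hHtop ξ h1) (hHub ξ h1) αs hs1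
  obtain ⟨i, hi1, hi2, hi3⟩ := ((hR3 (H (A ξ)) (hHtop ξ h1) (hHub ξ h1)).and_eventually
    (h3.and h4)).exists
  have h5 : projAbove (A (ξ + 1) i) (f αs i) = projAbove (A ξ i) (f αs i) :=
    (hζ2 i (ξ + 1) ((h2 i).le.trans (lt_add_one ξ).le) hξ1).trans (hζ2 i ξ (h2 i).le h1).symm
  have h6 : R (H (A ξ)) i ∈ A (ξ + 1) i := by
    rw [hA]; exact Or.inr ⟨ξ, lt_add_one ξ, rfl⟩
  have h7 := projAbove_le h6 hi3
  rw [h5, hi2] at h7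
  exact hi1.not_ge h7

/-- A scale: an eventually increasing, cofinal sequence of length `mu⁺` in a product of ordinals
with strictly increasing regular cofinalities. -/
structure IsTrueScale (mu : Cardinal.{0}) (g : Idx mu → Ordinal.{0})
    (f : Ordinal.{0} → Idx mu → Ordinal.{0}) : Prop where
  mono : ∀ ν < (Order.succ mu).ord, ∀ c < ν, ∀ᶠ i in Filter.atTop, f c i < f ν i
  lt : ∀ ν < (Order.succ mu).ord, ∀ i, f ν i < g i
  cofinal : ∀ u : Idx mu → Ordinal.{0}, (∀ i, u i < g i) →
    ∃ α < (Order.succ mu).ord, ∀ᶠ i in Filter.atTop, u i < f α i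
  cof_lt : ∀ i, Ordinal.cof mu.ord < (g i).cof
  strictMono : StrictMono fun i => (g i).cof
  cof_lt_mu : ∀ i, (g i).cof < mu

theorem IsPrescale.exists_exact (hf : IsPrescale mu f) (h : IsSingular mu) :
    ∃ g : Idx mu → Ordinal.{0}, (∀ i, g i ≤ mu.ord) ∧
      (∀ α < (Order.succ mu).ord, ∀ᶠ i in Filter.atTop, f α i < g i) ∧
      ∀ u : Idx mu → Ordinal.{0}, (∀ᶠ i in Filter.atTop, u i < g i) →
        ∃ α₀ < (Order.succ mu).ord, ∀ α < (Order.succ mu).ord, α₀ ≤ α →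
          ∀ᶠ i in Filter.atTop, u i < f α i := by
  have hlim := h.isRegular_succ.isSuccLimit_ord
  obtain ⟨g, hg1, hg2, hg3⟩ := hf.exists_minimal_isUB h
  refine ⟨g, hg1, fun α hα => ?_, fun u hu => ?_⟩
  · have h1 := hlim.add_one_lt hα
    filter_upwards [hf.mono _ h1 α (lt_add_one α), hg2 _ h1] with i hi1 hi2
    exact hi1.trans_le hi2
  have hκ := h.isRegular_cof.aleph0_le
  obtain ⟨α₀, h1, h2⟩ := hf.exists_projAbove_const h
    (Cardinal.isRegular_succ hκ) (Order.lt_succ _) (h.succ_lt h.2)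
    (A := fun i => {u i, g i, mu.ord}) (fun i => by
      refine (Cardinal.lt_aleph0_iff_finite.2 (toFinite _)).trans_le ?_
      rw [Cardinal.aleph0_le_lift]
      exact hκ.trans (Order.le_succ _)) (fun i => by simp)
  have h3 : IsUB mu f fun i => min (projAbove {u i, g i, mu.ord} (f α₀ i)) (g i) := by
    intro α hα
    filter_upwards [hf.isUB_of_eventually_const (fun i => by simp) h1 h2 α hα, hg2 α hα]
      with i hi1 hi2
    exact le_min hi1 hi2
  have h4 := hg3 _ (fun i => min_le_right _ _) h3
  refine ⟨α₀, h1, fun α hα hle => ?_⟩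
  filter_upwards [h4, hu, h2 α hα hle] with i hi1 hi2 hi3
  by_contra! hle
  have h5 := projAbove_le (A := {u i, g i, mu.ord}) (z := u i) (by simp) hle
  rw [hi3] at h5
  exact (hi2.trans_le (hi1.trans (min_le_left _ _))).not_ge h5

theorem IsPrescale.eventually_lt_cof (hf : IsPrescale mu f) (h : IsSingular mu)
    {g : Idx mu → Ordinal.{0}}
    (hg2 : ∀ α < (Order.succ mu).ord, ∀ᶠ i in Filter.atTop, f α i < g i)
    (hg3 : ∀ u : Idx mu → Ordinal.{0}, (∀ᶠ i in Filter.atTop, u i < g i) →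
        ∃ α₀ < (Order.succ mu).ord, ∀ α < (Order.succ mu).ord, α₀ ≤ α →
          ∀ᶠ i in Filter.atTop, u i < f α i) {χ : Cardinal.{0}} (hχ : χ.IsRegular)
    (hκχ : Ordinal.cof mu.ord < χ) (hχm : χ < mu) :
    ∀ᶠ i in Filter.atTop, χ ≤ (g i).cof := by
  classical
  by_contra hcon
  have hfr : ∃ᶠ i in Filter.atTop, (g i).cof < χ := by
    rw [Filter.not_eventually] at hcon
    exact hcon.mono fun i hi => not_le.1 hi
  choose cb hcb1 hcb2 hcb3 using exists_cofinal_set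
  have hal : Cardinal.aleph0 ≤ Cardinal.lift.{1} χ := by simpa using hχ.aleph0_le
  let A : Idx mu → Set Ordinal.{0} := fun i =>
    {mu.ord} ∪ if (g i).cof < χ then cb (g i) else ∅
  have htop : ∀ i, mu.ord ∈ A i := fun i => Or.inl rfl
  obtain ⟨α₀, h1, h2⟩ := hf.exists_projAbove_const h hχ hκχ hχm (A := A) (fun i => by
    refine (Cardinal.mk_union_le _ _).trans_lt (Cardinal.add_lt_of_lt hal ?_ ?_)
    · rw [Cardinal.mk_singleton]
      exact Cardinal.one_lt_aleph0.trans_le hal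
    · split_ifs with hc
      · rw [hcb3]; exact Cardinal.lift_lt.2 hc
      · rw [Cardinal.mk_eq_zero]
        exact Cardinal.aleph0_pos.trans_le hal) htop
  have h0 : (0 : Ordinal) < (Order.succ mu).ord := Cardinal.ord_pos.2 h.isRegular_succ.pos
  obtain ⟨α₁, h3, h4⟩ := hg3 (fun i => if projAbove (A i) (f α₀ i) < g i then
    projAbove (A i) (f α₀ i) else 0) (by
      filter_upwards [hg2 0 h0] with i hi
      split_ifs with hlt
      · exact hlt
      · exact hi.pos)
  have hm := max_lt h1 h3
  obtain ⟨i, hi1, hi2, hi3, hi4⟩ := (hfr.and_eventually ((h4 _ hm (le_max_right _ _)).and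
    ((hg2 _ hm).and (h2 _ hm (le_max_left _ _))))).exists
  obtain ⟨y, hy, hle⟩ := hcb2 (g i) _ hi3
  have hyA : y ∈ A i := Or.inr (by rwa [if_pos hi1])
  have h5 := (projAbove_le hyA hle).trans_lt (hcb1 _ _ hy)
  have h6 := (projAbove_mem hyA hle).2
  rw [hi4] at h5 h6
  rw [if_pos h5] at hi2
  exact hi2.not_ge h6

/-- Every singular cardinal carries a scale. -/
theorem IsSingular.exists_isTrueScale (h : IsSingular mu) : ∃ g f, IsTrueScale mu g f := by
  classical
  obtain ⟨f, hf⟩ := h.exists_isPrescale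
  obtain ⟨g, hg1, hg2, hg3⟩ := hf.exists_exact h
  have hlim := h.isRegular_succ.isSuccLimit_ord
  have hNM := h.noMaxOrder_idx
  have hne := h.nonempty_idx
  have hcof : ∀ i, (g i).cof < mu := fun i => h.cof_lt ((hg1 i).trans_lt
    (Cardinal.ord_lt_ord.2 (Order.lt_succ mu)))
  have hev : ∀ c < mu, ∀ᶠ i in Filter.atTop, c < (g i).cof := by
    intro c hc
    have h1 : max c (Ordinal.cof mu.ord) < mu := max_lt hc h.2
    have h2 := h.isRegular_cof.aleph0_le
    refine (hf.eventually_lt_cof h hg2 hg3 (Cardinal.isRegular_succ (h2.trans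
      (le_max_right c _))) ((le_max_right _ _).trans_lt (Order.lt_succ _)) (h.succ_lt h1)).mono
      fun i hi => ?_
    exact (le_max_left _ _).trans_lt (Order.succ_le_iff.1 hi)
  have hstep : ∀ (i : Idx mu) (s : Idx mu → Idx mu), ∃ k, i ≤ k ∧
      Ordinal.cof mu.ord < (g k).cof ∧ ∀ j < i, (g (s j)).cof < (g k).cof := by
    intro i s
    have h1 : ⨆ j : Iio i, (g (s j)).cof < mu :=
      Cardinal.iSup_lt_of_lt_cof_ord (mk_Iio_idx i) fun j => hcof _
    obtain ⟨k, hk1, hk2, hk3⟩ :=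
      ((hev _ h.2).and ((hev _ h1).and (Filter.eventually_ge_atTop i))).exists
    refine ⟨k, hk3, hk1, fun j hj => lt_of_le_of_lt ?_ hk2⟩
    refine le_ciSup (f := fun j : Iio i => (g (s j)).cof) ⟨mu, ?_⟩ ⟨j, hj⟩
    rintro _ ⟨j, rfl⟩
    exact (hcof _).le
  choose K hK1 hK2 hK3 using hstep
  let k : Idx mu → Idx mu := WellFoundedLT.fix fun i ih =>
    K i fun j => if hj : j < i then ih j hj else j
  have hk : ∀ i, k i = K i fun j => if j < i then k j else j := fun i =>
    WellFoundedLT.fix_eq (fun (i : Idx mu) (ih : ∀ j < i, Idx mu) =>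
      K i fun j => if hj : j < i then ih j hj else j) i
  have hk1 : ∀ i, i ≤ k i := fun i => by rw [hk]; exact hK1 _ _
  have hk2 : ∀ i, Ordinal.cof mu.ord < (g (k i)).cof := fun i => by rw [hk i]; exact hK2 _ _
  have hk3 : ∀ j i, j < i → (g (k j)).cof < (g (k i)).cof := fun j i hji => by
    have := hK3 i (fun j => if j < i then k j else j) j hji
    rw [if_pos hji, ← hk i] at this
    exact this
  have hkinj : Function.Injective k := fun i j hij => by
    by_contra hne
    rcases lt_or_gt_of_ne hne with hlt | hlt
    · exact (hk3 i j hlt).ne (by rw [hij])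
    · exact (hk3 j i hlt).ne (by rw [hij])
  have hkt : Filter.Tendsto k Filter.atTop Filter.atTop :=
    Filter.tendsto_atTop_mono hk1 Filter.tendsto_id
  have hg0 : ∀ i, 0 < g (k i) := fun i => by
    have := (hk2 i).pos
    rw [pos_iff_ne_zero, Ordinal.cof_eq_zero.ne] at this
    exact pos_iff_ne_zero.2 this
  let f' : Ordinal.{0} → Idx mu → Ordinal.{0} := fun α i =>
    if f α (k i) < g (k i) then f α (k i) else 0
  have hf' : ∀ α < (Order.succ mu).ord, ∀ᶠ i in Filter.atTop, f' α i = f α (k i) := fun α hα => by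
    filter_upwards [hkt.eventually (hg2 α hα)] with i hi
    exact if_pos hi
  refine ⟨fun i => g (k i), f', fun ν hν c hc => ?_, fun ν _ i => ?_, fun u hu => ?_, hk2,
    fun j i hji => hk3 j i hji, fun i => hcof _⟩
  · filter_upwards [hf' ν hν, hf' c (hc.trans hν), hkt.eventually (hf.mono ν hν c hc)]
      with i h1 h2 h3
    rwa [h1, h2]
  · simp only [f']
    split_ifs with hlt
    · exact hlt
    · exact hg0 i
  · have h0 : (0 : Ordinal) < (Order.succ mu).ord := Cardinal.ord_pos.2 h.isRegular_succ.pos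
    obtain ⟨α, hα, hα2⟩ := hg3 (fun j => if hj : ∃ i, k i = j then u hj.choose else 0) (by
      filter_upwards [hg2 0 h0] with j hj
      split_ifs with hij
      · have := hu hij.choose
        rwa [hij.choose_spec] at this
      · exact hj.pos)
    refine ⟨α, hα, ?_⟩
    filter_upwards [hf' α hα, hkt.eventually (hα2 α hα le_rfl)] with i h1 h2
    have h3 : ∃ i', k i' = k i := ⟨i, rfl⟩
    rw [dif_pos h3, hkinj h3.choose_spec] at h2
    rwa [h1]

end Scale

section ExactColoring

variable {mu : Cardinal.{0}} {g : Idx mu → Ordinal.{0}} {f : Ordinal.{0} → Idx mu → Ordinal.{0}}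

theorem exists_bound_image_ord {s : Set Ordinal.{0}} {F : Ordinal.{0} → Ordinal.{0}}
    {δ : Ordinal.{0}} (h : Cardinal.mk s < Cardinal.lift.{1} δ.cof) (hF : ∀ x ∈ s, F x < δ) :
    ∃ γ < δ, ∀ x ∈ s, F x < γ :=
  exists_bound_image (by simpa only [Cardinal.lift_id, Cardinal.lift_lift] using h) hF

theorem exists_bound_idx {F : Idx mu → Ordinal.{0}} {δ : Ordinal.{0}}
    (h : Ordinal.cof mu.ord < δ.cof) (hF : ∀ i, F i < δ) : ∃ γ < δ, ∀ i, F i < γ :=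
  exists_bound (by rwa [Idx.mk_eq]) hF

theorem IsSingular.eventually_ball_ord (h : IsSingular mu) {s : Set Ordinal.{0}}
    (hs : CardLT s (Ordinal.cof mu.ord)) {P : Ordinal.{0} → Idx mu → Prop}
    (hP : ∀ x ∈ s, ∀ᶠ i in Filter.atTop, P x i) : ∀ᶠ i in Filter.atTop, ∀ x ∈ s, P x i :=
  h.eventually_ball (by rw [Cardinal.lift_uzero]; exact hs) hP

theorem CardLT.lt_lift {s : Set Ordinal.{0}} {κ c : Cardinal.{0}} (hs : CardLT s κ) (h : κ ≤ c) :
    Cardinal.mk s < Cardinal.lift.{1} c :=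
  lt_of_lt_of_le hs (Cardinal.lift_le.2 h)

/-- Sequences of nonempty pairwise disjoint subsets of `μ⁺` of size less than `cf μ`. -/
structure IsBlockSeq (mu : Cardinal.{0}) (t : Ordinal.{0} → Set Ordinal.{0}) : Prop where
  subset : ∀ a < (Order.succ mu).ord, t a ⊆ Iio (Order.succ mu).ord
  disjoint : ∀ a b, a < (Order.succ mu).ord → b < (Order.succ mu).ord → a ≠ b →
    Disjoint (t a) (t b)
  card : ∀ a < (Order.succ mu).ord, CardLT (t a) (Ordinal.cof mu.ord)
  nonempty : ∀ a < (Order.succ mu).ord, (t a).Nonempty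

theorem IsSingular.cof_lt_cof_succ (h : IsSingular mu) :
    Ordinal.cof mu.ord < (Order.succ mu).ord.cof := by
  rw [h.isRegular_succ.cof_ord]
  exact h.2.trans (Order.lt_succ _)

theorem IsBlockSeq.exists_subset_Ici {t : Ordinal.{0} → Set Ordinal.{0}} (ht : IsBlockSeq mu t)
    (h : IsSingular mu) {u : Ordinal.{0}} (hu : u < (Order.succ mu).ord) :
    ∃ a < (Order.succ mu).ord, ∀ b < (Order.succ mu).ord, a ≤ b → t b ⊆ Ici u := by
  classical
  let F : Ordinal.{0} → Ordinal.{0} := fun y =>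
    if hy : ∃ a < (Order.succ mu).ord, y ∈ t a then hy.choose else 0
  obtain ⟨a, ha, hab⟩ := exists_bound_Iio (a := u) (δ := (Order.succ mu).ord) (f := F) (by
    rw [h.isRegular_succ.cof_ord]
    exact Cardinal.lt_ord.1 hu) (fun y _ => by
      simp only [F]
      split_ifs with hy
      · exact hy.choose_spec.1
      · exact Cardinal.ord_pos.2 h.isRegular_succ.pos)
  refine ⟨a, ha, fun b hb hle y hy => ?_⟩
  by_contra! hyu
  have h1 : ∃ a < (Order.succ mu).ord, y ∈ t a := ⟨b, hb, hy⟩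
  have h2 := hab y (not_le.1 hyu)
  simp only [F, dif_pos h1] at h2
  exact (ht.disjoint _ _ h1.choose_spec.1 hb (h2.trans_le hle).ne).le_bot
    ⟨h1.choose_spec.2, hy⟩

/-- The last coordinate at which `f ζ` does not exceed `f ξ` is `i`. -/
def IsLastDrop (f : Ordinal.{0} → Idx mu → Ordinal.{0}) (ξ ζ : Ordinal.{0}) (i : Idx mu) : Prop :=
  f ζ i ≤ f ξ i ∧ ∀ j, i < j → f ξ j < f ζ j

theorem IsLastDrop.unique {ξ ζ : Ordinal.{0}} {i j : Idx mu} (hi : IsLastDrop f ξ ζ i)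
    (hj : IsLastDrop f ξ ζ j) : i = j := by
  rcases lt_trichotomy i j with hlt | heq | hlt
  · exact absurd hj.1 (hi.2 j hlt).not_ge
  · exact heq
  · exact absurd hi.1 (hj.2 i hlt).not_ge

theorem IsTrueScale.eventually_exists_gt (hf : IsTrueScale mu g f) (h : IsSingular mu)
    {t : Ordinal.{0} → Set Ordinal.{0}} (ht : IsBlockSeq mu t) :
    ∀ᶠ i in Filter.atTop, ∀ γ < g i, ∀ u < (Order.succ mu).ord,
      ∃ a < (Order.succ mu).ord, t a ⊆ Ici u ∧ ∀ ξ ∈ t a, γ < f ξ i := by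
  classical
  by_contra hcon
  rw [Filter.not_eventually] at hcon
  push Not at hcon
  have hlim := h.isRegular_succ.isSuccLimit_ord
  have h0 : (0 : Ordinal) < (Order.succ mu).ord := Cardinal.ord_pos.2 h.isRegular_succ.pos
  let P : Idx mu → Ordinal.{0} → Ordinal.{0} → Prop := fun i γ u =>
    γ < g i ∧ u < (Order.succ mu).ord ∧
      ∀ a < (Order.succ mu).ord, t a ⊆ Ici u → ∃ ξ ∈ t a, f ξ i ≤ γ
  have hcon' : ∃ᶠ i in Filter.atTop, ∃ γ u, P i γ u := by
    refine hcon.mono fun i hi => ?_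
    obtain ⟨γ, h1, u, h2, h3⟩ := hi
    exact ⟨γ, u, h1, h2, h3⟩
  have : ∀ i, ∃ γ u, γ < g i ∧ u < (Order.succ mu).ord ∧ ((∃ γ u, P i γ u) → P i γ u) := by
    intro i
    by_cases hi : ∃ γ u, P i γ u
    · obtain ⟨γ, u, hP⟩ := hi
      exact ⟨γ, u, hP.1, hP.2.1, fun _ => hP⟩
    · exact ⟨0, 0, (hf.lt 0 h0 i).pos, h0, fun h => absurd h hi⟩
  choose γ u h1 h2 h3 using this
  obtain ⟨v, hv, huv⟩ := exists_bound_idx h.cof_lt_cof_succ h2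
  obtain ⟨α, hα, hγα⟩ := hf.cofinal γ h1
  obtain ⟨a, ha, hta⟩ := ht.exists_subset_Ici h (max_lt hv (hlim.add_one_lt hα))
  have hta := hta a ha le_rfl
  have hev := h.eventually_ball_ord (ht.card a ha) (P := fun ξ i => γ i < f ξ i) fun ξ hξ => by
    have h4 : α < ξ := (lt_add_one α).trans_le ((le_max_right _ _).trans (hta hξ))
    filter_upwards [hγα, hf.mono ξ (ht.subset a ha hξ) α h4] with i hi1 hi2
    exact hi1.trans hi2
  obtain ⟨i, hi1, hi2⟩ := (hcon'.and_eventually hev).exists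
  obtain ⟨ξ, hξ, hle⟩ := (h3 i hi1).2.2 a ha
    (hta.trans (Ici_subset_Ici.2 ((huv i).le.trans (le_max_left _ _))))
  exact (hi2 ξ hξ).not_ge hle

theorem IsTrueScale.exists_isClubIn_isLastDrop (hf : IsTrueScale mu g f) (h : IsSingular mu)
    {t : Ordinal.{0} → Set Ordinal.{0}} (ht : IsBlockSeq mu t) :
    ∃ E, IsClubIn E (Order.succ mu).ord ∧ ∀ x ∈ E, ∀ y < x, ∀ b < (Order.succ mu).ord,
      t b ⊆ Ici x → ∀ᶠ i in Filter.atTop, ∃ a < (Order.succ mu).ord, t a ⊆ Ioo y x ∧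
        ∀ ξ ∈ t a, ∀ ζ ∈ t b, IsLastDrop f ξ ζ i := by
  have hlim := h.isRegular_succ.isSuccLimit_ord
  have h0 : (0 : Ordinal) < (Order.succ mu).ord := Cardinal.ord_pos.2 h.isRegular_succ.pos
  have hcof := h.isRegular_succ.cof_ord
  obtain ⟨i₀, hi₀⟩ := h.eventually_atTop.1 (hf.eventually_exists_gt h ht)
  choose cb hcb1 hcb2 hcb3 using exists_cofinal_set
  have : ∀ y i γ, ∃ a < (Order.succ mu).ord, y < (Order.succ mu).ord → i₀ ≤ i → γ < g i →
      t a ⊆ Ioi y ∧ ∀ ξ ∈ t a, γ < f ξ i := by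
    intro y i γ
    by_cases hy : y < (Order.succ mu).ord ∧ i₀ ≤ i ∧ γ < g i
    · obtain ⟨a, ha, h1, h2⟩ := hi₀ i hy.2.1 γ hy.2.2 _ (hlim.add_one_lt hy.1)
      exact ⟨a, ha, fun _ _ _ => ⟨fun ξ hξ => (lt_add_one y).trans_le (h1 hξ), h2⟩⟩
    · exact ⟨0, h0, fun h1 h2 h3 => absurd ⟨h1, h2, h3⟩ hy⟩
  choose A hA1 hA2 using this
  have : ∀ y, ∃ b < (Order.succ mu).ord, ∀ i, ∀ γ ∈ cb (g i), ∀ ξ ∈ t (A y i γ), ξ < b := by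
    intro y
    have h1 : ∀ i γ, ∃ b < (Order.succ mu).ord, ∀ ξ ∈ t (A y i γ), ξ < b := fun i γ =>
      exists_bound_of_set ((ht.card _ (hA1 y i γ)).lt_lift h.cof_lt_cof_succ.le)
        (ht.subset _ (hA1 y i γ))
    choose b hb1 hb2 using h1
    have h2 : ∀ i, ∃ b' < (Order.succ mu).ord, ∀ γ ∈ cb (g i), b i γ < b' := fun i =>
      exists_bound_image_ord (by
        rw [hcb3, hcof]
        exact Cardinal.lift_lt.2 ((hf.cof_lt_mu i).trans (Order.lt_succ _))) fun γ _ => hb1 i γ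
    choose b' hb1' hb2' using h2
    obtain ⟨b'', h3, h4⟩ := exists_bound_idx h.cof_lt_cof_succ hb1'
    exact ⟨b'', h3, fun i γ hγ ξ hξ =>
      (hb2 i γ ξ hξ).trans ((hb2' i γ hγ).trans (h4 i))⟩
  choose b1 hb1 hb1' using this
  have : ∀ y, ∃ b < (Order.succ mu).ord, ∀ᶠ j in Filter.atTop, ∀ i < j, ∀ γ ∈ cb (g i),
      ∀ ξ ∈ t (A y i γ), f ξ j < f b j := by
    intro y
    have h1 : ∀ j i γ, ∃ z < g j, ∀ ξ ∈ t (A y i γ), f ξ j < z := fun j i γ =>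
      exists_bound_image_ord ((ht.card _ (hA1 y i γ)).lt_lift (hf.cof_lt j).le)
        fun ξ hξ => hf.lt ξ (ht.subset _ (hA1 y i γ) hξ) j
    choose z hz1 hz2 using h1
    have h2 : ∀ j i, ∃ z' < g j, i < j → ∀ γ ∈ cb (g i), z j i γ < z' := fun j i => by
      by_cases hij : i < j
      · obtain ⟨z', h3, h4⟩ := exists_bound_image_ord (s := cb (g i)) (F := z j i) (δ := g j) (by
          rw [hcb3]
          exact Cardinal.lift_lt.2 (hf.strictMono hij)) fun γ _ => hz1 j i γ
        exact ⟨z', h3, fun _ => h4⟩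
      · exact ⟨_, hf.lt 0 h0 j, fun h => absurd h hij⟩
    choose z' hz1' hz2' using h2
    have h3 : ∀ j, ∃ z'' < g j, ∀ i, z' j i < z'' := fun j =>
      exists_bound_idx (hf.cof_lt j) (hz1' j)
    choose z'' hz1'' hz2'' using h3
    obtain ⟨b, h4, h5⟩ := hf.cofinal z'' hz1''
    refine ⟨b, h4, h5.mono fun j hj i hij γ hγ ξ hξ => ?_⟩
    exact (hz2 j i γ ξ hξ).trans ((hz2' j i hij γ hγ).trans ((hz2'' j i).trans hj))
  choose b2 hb2 hb2' using this
  refine ⟨_, isClubIn_closure h.isRegular_succ h.aleph0_lt_succ (b := fun y => max (b1 y) (b2 y))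
    fun y _ => max_lt (hb1 y) (hb2 y), fun x hx y hyx b hb htb => ?_⟩
  have hy := hyx.trans hx.1
  have hmax := max_lt_iff.1 (hx.2 y hyx)
  have hev := h.eventually_ball_ord (ht.card b hb) (P := fun ζ i => f (b2 y) i < f ζ i)
    fun ζ hζ => hf.mono ζ (ht.subset b hb hζ) _ (hmax.2.trans_le (htb hζ))
  obtain ⟨i₁, hi₁⟩ := h.eventually_atTop.1 (hev.and (hb2' y))
  refine h.eventually_atTop.2 ⟨max i₀ i₁, fun i hi => ?_⟩
  obtain ⟨γ₀, h1, h2⟩ := exists_bound_image_ord (s := t b) (F := fun ζ => f ζ i) (δ := g i)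
    ((ht.card b hb).lt_lift (hf.cof_lt i).le) fun ζ hζ => hf.lt ζ (ht.subset b hb hζ) i
  obtain ⟨γ, h3, h4⟩ := hcb2 _ _ h1
  have h5 := hA2 y i γ hy ((le_max_left _ _).trans hi) (hcb1 _ _ h3)
  refine ⟨A y i γ, hA1 y i γ, fun ξ hξ => ⟨h5.1 hξ, (hb1' y i γ h3 ξ hξ).trans hmax.1⟩,
    fun ξ hξ ζ hζ => ⟨((h2 ζ hζ).trans_le h4).le.trans (h5.2 ξ hξ).le, fun j hj => ?_⟩⟩
  have h6 := hi₁ j ((le_max_right _ _).trans (hi.trans hj.le))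
  exact (h6.2 i hj γ h3 ξ hξ).trans (h6.1 ζ hζ)

end ExactColoring

section Ladders

/-- A choice of a cofinal set of minimal size in every ordinal. -/
structure IsCofinalSystem (cb : Ordinal.{0} → Set Ordinal.{0}) : Prop where
  lt : ∀ ν, ∀ x ∈ cb ν, x < ν
  cofinal : ∀ ν, ∀ x < ν, ∃ y ∈ cb ν, x ≤ y
  card : ∀ ν, Cardinal.mk (cb ν) = Cardinal.lift.{1} ν.cof

theorem exists_isCofinalSystem : ∃ cb, IsCofinalSystem cb := by
  choose cb h1 h2 h3 using exists_cofinal_set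
  exact ⟨cb, h1, h2, h3⟩

theorem limClosure_subset_limClosure {ν ν' : Ordinal.{0}} {s s' : Set Ordinal.{0}} (hν : ν ≤ ν')
    (hs : s ⊆ s') : limClosure ν s ⊆ limClosure ν' s' := fun x hx =>
  ⟨hx.1.trans_le hν, hx.2.imp (fun h => hs h) fun h => ⟨h.1, fun y hy => by
    obtain ⟨z, hz, h1⟩ := h.2 y hy
    exact ⟨z, hs hz, h1⟩⟩⟩

/-- The stages of the construction of `ladder`. -/
def ladderAux (cb : Ordinal.{0} → Set Ordinal.{0}) (E : Set Ordinal.{0}) (c : Cardinal.{0})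
    (ν : Ordinal.{0}) : ℕ → Set Ordinal.{0}
  | 0 => cb ν
  | n + 1 => limClosure ν (ladderAux cb E c ν n) ∪
      ((⋃ b ∈ {b ∈ ladderAux cb E c ν n | b.cof ≤ c}, cb b) ∪
        projBelow E '' ladderAux cb E c ν n)

/-- A closed unbounded subset of `ν` closed under projection to `E` and under adding the cofinal
sets of its elements of cofinality at most `c`. -/
def ladder (cb : Ordinal.{0} → Set Ordinal.{0}) (E : Set Ordinal.{0}) (c : Cardinal.{0})
    (ν : Ordinal.{0}) : Set Ordinal.{0} := limClosure ν (⋃ n, ladderAux cb E c ν n)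

variable {cb : Ordinal.{0} → Set Ordinal.{0}} {E : Set Ordinal.{0}} {c : Cardinal.{0}}
  {ν : Ordinal.{0}}

theorem mem_ladderAux_succ_of_cof_le {n : ℕ} {b x : Ordinal.{0}}
    (hb : b ∈ ladderAux cb E c ν n) (hbc : b.cof ≤ c) (hx : x ∈ cb b) :
    x ∈ ladderAux cb E c ν (n + 1) := by
  refine Or.inr (Or.inl ?_)
  simp only [mem_iUnion]
  exact ⟨b, ⟨hb, hbc⟩, hx⟩

theorem projBelow_mem_ladderAux_succ {n : ℕ} {b : Ordinal.{0}}
    (hb : b ∈ ladderAux cb E c ν n) : projBelow E b ∈ ladderAux cb E c ν (n + 1) :=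
  Or.inr (Or.inr ⟨b, hb, rfl⟩)

namespace IsCofinalSystem

theorem ladderAux_lt (h : IsCofinalSystem cb) (n : ℕ) : ∀ x ∈ ladderAux cb E c ν n, x < ν := by
  induction n with
  | zero => exact h.lt ν
  | succ n ih =>
    rintro x (hx | hx | ⟨b, hb, rfl⟩)
    · exact hx.1
    · simp only [mem_iUnion] at hx
      obtain ⟨b, hb, hx⟩ := hx
      exact (h.lt b x hx).trans (ih b hb.1)
    · exact (projBelow_le E b).trans_lt (ih b hb)

theorem ladderAux_subset_succ (h : IsCofinalSystem cb) (n : ℕ) :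
    ladderAux cb E c ν n ⊆ ladderAux cb E c ν (n + 1) := fun x hx =>
  Or.inl ⟨h.ladderAux_lt n x hx, Or.inl hx⟩

theorem monotone_ladderAux (h : IsCofinalSystem cb) : Monotone (ladderAux cb E c ν) :=
  monotone_nat_of_le_succ h.ladderAux_subset_succ

theorem ladderAux_subset_ladder (h : IsCofinalSystem cb) (n : ℕ) :
    ladderAux cb E c ν n ⊆ ladder cb E c ν := fun x hx =>
  ⟨h.ladderAux_lt n x hx, Or.inl (mem_iUnion.2 ⟨n, hx⟩)⟩

theorem exists_mem_ladderAux (h : IsCofinalSystem cb) (n : ℕ) {x : Ordinal.{0}} (hx : x < ν) :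
    ∃ y ∈ ladderAux cb E c ν n, x ≤ y := by
  obtain ⟨y, hy, hxy⟩ := h.cofinal ν x hx
  exact ⟨y, h.monotone_ladderAux (Nat.zero_le n) hy, hxy⟩

theorem isClubIn_ladder (h : IsCofinalSystem cb) : IsClubIn (ladder cb E c ν) ν :=
  isClubIn_limClosure fun x hx => by
    obtain ⟨y, hy, hxy⟩ := h.exists_mem_ladderAux 0 hx
    exact ⟨y, mem_iUnion.2 ⟨0, hy⟩, hxy, h.ladderAux_lt 0 y hy⟩

theorem mk_ladderAux_le (h : IsCofinalSystem cb) (hc : Cardinal.aleph0 ≤ c) (hν : ν.cof ≤ c)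
    (n : ℕ) : Cardinal.mk (ladderAux cb E c ν n) ≤ Cardinal.lift.{1} c := by
  have hc' : Cardinal.aleph0 ≤ Cardinal.lift.{1} c := Cardinal.aleph0_le_lift.2 hc
  induction n with
  | zero =>
    refine (h.card ν).trans_le (Cardinal.lift_le.2 hν)
  | succ n ih =>
    refine (Cardinal.mk_union_le _ _).trans (Cardinal.add_le_of_le hc' ?_
      ((Cardinal.mk_union_le _ _).trans (Cardinal.add_le_of_le hc' ?_ ?_)))
    · exact mk_limClosure_le (fun x hx => h.exists_mem_ladderAux n hx) hc ih
    · refine (Cardinal.mk_biUnion_le _ _).trans ?_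
      refine (mul_le_mul' ((Cardinal.mk_le_mk_of_subset (sep_subset _ _)).trans ih)
        (ciSup_le' fun b => ?_)).trans (Cardinal.mul_eq_self hc').le
      exact (h.card b.1).trans_le (Cardinal.lift_le.2 b.2.2)
    · exact Cardinal.mk_image_le.trans ih

theorem mk_ladder_le (h : IsCofinalSystem cb) (hc : Cardinal.aleph0 ≤ c) (hν : ν.cof ≤ c) :
    Cardinal.mk (ladder cb E c ν) ≤ Cardinal.lift.{1} c := by
  refine mk_limClosure_le (fun x hx => ?_) hc ?_
  · obtain ⟨y, hy, hxy⟩ := h.exists_mem_ladderAux 0 hx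
    exact ⟨y, mem_iUnion.2 ⟨0, hy⟩, hxy⟩
  · have hc' : Cardinal.aleph0 ≤ Cardinal.lift.{1} c := Cardinal.aleph0_le_lift.2 hc
    refine le_trans ?_ (Cardinal.mul_eq_self hc').le
    have h1 := Cardinal.mk_iUnion_le_lift.{1, 0} (f := fun n => ladderAux cb E c ν n)
    rw [Cardinal.lift_uzero] at h1
    refine h1.trans (mul_le_mul' (by simpa using hc) (ciSup_le' fun n => ?_))
    rw [Cardinal.lift_uzero]
    exact h.mk_ladderAux_le hc hν n

end IsCofinalSystem

theorem ladder_subset_ladder {δ : Ordinal.{0}} (hδ : δ ∈ ladder cb E c ν) (h0 : Cardinal.aleph0 < δ.cof) (hc : δ.cof ≤ c) :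
    ladder cb E c δ ⊆ ladder cb E c ν := by
  obtain ⟨n, hn⟩ : ∃ n, δ ∈ ladderAux cb E c ν n := by
    rcases hδ.2 with hδ' | ⟨hpos, hlim⟩
    · exact mem_iUnion.1 hδ'
    · by_contra! hcon
      have : ∀ n, ∃ y < δ, ∀ z ∈ ladderAux cb E c ν n, y < z → δ ≤ z := by
        by_contra! hn
        obtain ⟨n, hn⟩ := hn
        exact hcon (n + 1) (Or.inl ⟨hδ.1, Or.inr ⟨hpos, hn⟩⟩)
      choose y hy1 hy2 using this
      obtain ⟨γ, h1, h2⟩ := exists_bound (f := y) (by rwa [Cardinal.mk_nat]) hy1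
      obtain ⟨z, hz, hz1, hz2⟩ := hlim γ h1
      obtain ⟨n, hn⟩ := mem_iUnion.1 hz
      exact (hy2 n z hn ((h2 n).trans hz1)).not_gt hz2
  have key : ∀ k, ladderAux cb E c δ k ⊆ ladderAux cb E c ν (n + 1 + k) := by
    intro k
    induction k with
    | zero => exact fun x hx => mem_ladderAux_succ_of_cof_le hn hc hx
    | succ k ih =>
      refine union_subset_union (limClosure_subset_limClosure hδ.1.le ih)
        (union_subset_union ?_ (image_mono ih))
      exact biUnion_subset_biUnion_left fun b hb => ⟨ih hb.1, hb.2⟩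
  refine limClosure_subset_limClosure hδ.1.le (iUnion_subset fun k => ?_)
  exact (key k).trans (subset_iUnion (fun n => ladderAux cb E c ν n) _)

theorem ladderAux_mono {c' : Cardinal.{0}} (hc : c ≤ c') (n : ℕ) :
    ladderAux cb E c ν n ⊆ ladderAux cb E c' ν n := by
  induction n with
  | zero => exact Subset.rfl
  | succ n ih =>
    refine union_subset_union (limClosure_subset_limClosure le_rfl ih)
      (union_subset_union ?_ (image_mono ih))
    exact biUnion_subset_biUnion_left fun b hb => ⟨ih hb.1, hb.2.trans hc⟩

theorem ladder_mono {c' : Cardinal.{0}} (hc : c ≤ c') : ladder cb E c ν ⊆ ladder cb E c' ν :=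
  limClosure_subset_limClosure le_rfl (iUnion_mono fun n => ladderAux_mono hc n)

theorem IsCofinalSystem.exists_mem_ladderAux_stable (h : IsCofinalSystem cb)
    {F : Ordinal.{0} → Set Ordinal.{0}} {Ω l x₀ : Ordinal.{0}} (hΩ : 0 < Ω)
    (hF : ∀ ζ < Ω, ClosedIn (F ζ) l) (hanti : ∀ ζ ζ', ζ ≤ ζ' → F ζ' ⊆ F ζ)
    (hx₀ : ∀ ζ < Ω, x₀ ∈ F ζ) (hc : c < x₀.cof) (b : Ordinal.{0}) (hx₀b : x₀ ≤ b) (hbl : b < l) :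
    ∃ x, x₀ ≤ x ∧ x ≤ b ∧ c < x.cof ∧ ∃ ζ₀ < Ω, ∀ ζ, ζ₀ ≤ ζ → ζ < Ω → x ∈ F ζ ∧
      ∀ ν n, b ∈ ladderAux cb (F ζ) c ν n → ∃ k, x ∈ ladderAux cb (F ζ) c ν k := by
  induction b using WellFoundedLT.induction with
  | _ b ih =>
    obtain ⟨ζ₁, h1, h2⟩ := exists_stable_of_antitone (h := fun ζ => projBelow (F ζ) b) hΩ
      fun ζ ζ' hz _ => projBelow_mono (hanti ζ ζ' hz) b
    have h3 : x₀ ≤ projBelow (F ζ₁) b := le_projBelow (hx₀ ζ₁ h1) hx₀b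
    have h0 : x₀ ≠ 0 := by
      rintro rfl
      simp at hc
    have hle := projBelow_le (F ζ₁) b
    have hmem : ∀ ζ, ζ₁ ≤ ζ → ζ < Ω → projBelow (F ζ₁) b ∈ F ζ := fun ζ hζ hζ' => by
      rw [← h2 ζ hζ hζ']
      refine projBelow_mem (hF ζ hζ') hbl ?_
      rw [h2 ζ hζ hζ']
      exact ((pos_iff_ne_zero.2 h0).trans_le h3).ne'
    have hstep : ∀ ζ, ζ₁ ≤ ζ → ζ < Ω → ∀ ν n, b ∈ ladderAux cb (F ζ) c ν n →
        projBelow (F ζ₁) b ∈ ladderAux cb (F ζ) c ν (n + 1) := fun ζ hζ hζ' ν n hb => by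
      rw [← h2 ζ hζ hζ']
      exact projBelow_mem_ladderAux_succ hb
    by_cases hcof : c < (projBelow (F ζ₁) b).cof
    · exact ⟨_, h3, hle, hcof, ζ₁, h1, fun ζ hζ hζ' => ⟨hmem ζ hζ hζ', fun ν n hb =>
        ⟨n + 1, hstep ζ hζ hζ' ν n hb⟩⟩⟩
    · have hlt : x₀ < projBelow (F ζ₁) b := h3.lt_of_ne (by rintro rfl; exact hcof hc)
      obtain ⟨a, ha, hxa⟩ := h.cofinal _ _ hlt
      have hab : a < b := (h.lt _ a ha).trans_le hle
      obtain ⟨x, h4, h5, h6, ζ₂, h7, h8⟩ := ih a hab hxa (hab.trans hbl)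
      refine ⟨x, h4, h5.trans hab.le, h6, max ζ₁ ζ₂, max_lt h1 h7, fun ζ hζ hζ' => ?_⟩
      obtain ⟨h9, h10⟩ := h8 ζ ((le_max_right _ _).trans hζ) hζ'
      refine ⟨h9, fun ν n hb => h10 ν (n + 2) ?_⟩
      exact mem_ladderAux_succ_of_cof_le
        (hstep ζ ((le_max_left _ _).trans hζ) hζ' ν n hb) (not_lt.1 hcof) ha

variable {mu : Cardinal.{0}}

theorem IsSingular.isClubIn_iInter_idx (h : IsSingular mu) {C : Idx mu → Set Ordinal.{0}}
    (hC : ∀ i, IsClubIn (C i) (Order.succ mu).ord) :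
    IsClubIn {x | x < (Order.succ mu).ord ∧ ∀ i, x ∈ C i} (Order.succ mu).ord :=
  isClubIn_iInter h.isRegular_succ h.aleph0_lt_succ (by
    rw [Idx.mk_eq, Cardinal.lift_uzero]
    exact Cardinal.lift_lt.2 (h.2.trans (Order.lt_succ _))) hC

theorem IsSingular.exists_guess (h : IsSingular mu) {M : Idx mu → Cardinal.{0}}
    (hM : IsLayering mu M) (hcb : IsCofinalSystem cb) :
    ∃ E, IsClubIn E (Order.succ mu).ord ∧ ∀ D, IsClubIn D (Order.succ mu).ord →
      ∃ δ ∈ D, δ.cof = Order.succ (Ordinal.cof mu.ord) ∧ ∀ m, ∀ y < δ,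
        ∃ x ∈ ladder cb E (M m) δ ∩ D, y < x ∧ M m < x.cof := by
  have hr := h.isRegular_succ
  have hu := h.aleph0_lt_succ
  have hκ := h.isRegular_cof.aleph0_le
  have hr1 := Cardinal.isRegular_succ hκ
  have hr2 := Cardinal.isRegular_succ hr1.aleph0_le
  have hκm := h.succ_lt h.2
  by_contra! hcon
  choose! W hW1 hW2 using hcon
  set Ω := (Order.succ (Order.succ (Ordinal.cof mu.ord))).ord with hΩd
  have hΩ : Ω < (Order.succ mu).ord :=
    Cardinal.ord_lt_ord.2 ((h.succ_lt hκm).trans (Order.lt_succ _))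
  have hΩ0 : 0 < Ω := Cardinal.ord_pos.2 hr2.pos
  have hΩl := hr2.isSuccLimit_ord
  obtain ⟨F, hF1, hF2⟩ := exists_decreasing_clubs hr hu hΩ hW1
  have hanti : ∀ ζ ζ', ζ ≤ ζ' → F ζ' ⊆ F ζ := fun ζ ζ' hz => by
    rcases hz.eq_or_lt with rfl | hz
    · rfl
    · exact fun x hx => (hF2 _ _ hz hx).1
  have hacc : ∀ m, ∃ D, IsClubIn D (Order.succ mu).ord ∧ ∀ δ ∈ D, ∀ x < δ,
      ∃ y ∈ {y ∈ F Ω | M m < y.cof}, x < y ∧ y < δ := fun m => by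
    refine exists_isClubIn_acc hr hu fun x hx => ?_
    have hreg := Cardinal.isRegular_succ (hM.aleph0_le h m)
    obtain ⟨δ, h1, h2, h3, -⟩ := (hF1 Ω le_rfl).exists_cof_eq hr hreg
      ((h.succ_lt (hM.lt m)).trans (Order.lt_succ _)) hx
    exact ⟨δ, ⟨h1, h3 ▸ Order.lt_succ _⟩, h2, (hF1 Ω le_rfl).1 h1⟩
  choose D hD1 hD2 using hacc
  have hD := h.isClubIn_iInter_idx hD1
  obtain ⟨δ, hδ, -, hδc, -⟩ := (isClubIn_inter hr hu (hF1 Ω le_rfl) hD).exists_cof_eq hr hr1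
    (hκm.trans (Order.lt_succ _)) (Cardinal.ord_pos.2 hr.pos)
  have hδl := (hF1 Ω le_rfl).1 hδ.1
  have hnear : ∀ m, ∀ y, ∃ ζ₀ < Ω, y < δ → ∃ x, y < x ∧ x < δ ∧ M m < x.cof ∧
      ∀ ζ, ζ₀ ≤ ζ → ζ < Ω → x ∈ F ζ ∧ x ∈ ladder cb (F ζ) (M m) δ := by
    intro m y
    by_cases hy : y < δ
    swap
    · exact ⟨0, hΩ0, fun h => absurd h hy⟩
    obtain ⟨x₀, hx₀, h1, h2⟩ := hD2 m δ (hδ.2.2 m) y hy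
    obtain ⟨b, hb, hxb⟩ := hcb.cofinal δ x₀ h2
    have hbδ := hcb.lt δ b hb
    obtain ⟨x, h3, h4, h5, ζ₀, h6, h7⟩ := hcb.exists_mem_ladderAux_stable hΩ0
      (fun ζ hζ => (hF1 ζ hζ.le).2.1) hanti (fun ζ hζ => hanti ζ Ω hζ.le hx₀.1) hx₀.2 b hxb
      (hbδ.trans hδl)
    refine ⟨ζ₀, h6, fun _ => ⟨x, h1.trans_le h3, h4.trans_lt hbδ, h5, fun ζ hζ hζ' => ?_⟩⟩
    obtain ⟨h8, h9⟩ := h7 ζ hζ hζ'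
    obtain ⟨k, hk⟩ := h9 δ 0 hb
    exact ⟨h8, hcb.ladderAux_subset_ladder k hk⟩
  choose ζ hζ1 hζ2 using hnear
  have : ∀ m, ∃ ζ' < Ω, ∀ y ∈ cb δ, ζ m y < ζ' := fun m => exists_bound_image_ord (by
    rw [hcb.card, hδc, hΩd, hr2.cof_ord]
    exact Cardinal.lift_lt.2 (Order.lt_succ _)) fun y _ => hζ1 m y
  choose ζ' hζ1' hζ2' using this
  obtain ⟨ζs, hs1, hs2⟩ := exists_bound_idx (F := ζ') (δ := Ω) (by
    rw [hΩd, hr2.cof_ord]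
    exact (Order.lt_succ _).trans (Order.lt_succ _)) hζ1'
  obtain ⟨m, y, hy, hno⟩ := hW2 (F ζs) (hF1 ζs hs1.le) δ (hF2 Ω ζs hs1 hδ.1).2 hδc
  obtain ⟨y', hy', hyy'⟩ := hcb.cofinal δ y hy
  obtain ⟨x, h1, h2, h3, h4⟩ := hζ2 m y' (hcb.lt δ y' hy')
  have hle := ((hζ2' m y' hy').trans (hs2 m)).le
  have h5 := (h4 ζs hle hs1).2
  have h6 := (h4 (ζs + 1) (hle.trans (lt_add_one _).le) (hΩl.add_one_lt hs1)).1
  exact (hno x ⟨h5, (hF2 _ _ (lt_add_one _) h6).2⟩ (hyy'.trans_lt h1)).not_gt h3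

end Ladders

section Ideal

/-- A coherent system of clubs that guesses clubs at cofinality `(cf μ)⁺`. -/
structure IsLadderSystem (mu : Cardinal.{0}) (M : Idx mu → Cardinal.{0})
    (e : Idx mu → Ordinal.{0} → Set Ordinal.{0}) : Prop where
  club : ∀ m ν, IsClubIn (e m ν) ν
  card : ∀ m ν, ν.cof ≤ M m → Cardinal.mk (e m ν) ≤ Cardinal.lift.{1} (M m)
  mono : ∀ ν, Monotone fun m => e m ν
  coherent : ∀ m ν, ∀ δ ∈ e m ν, δ.cof = Order.succ (Ordinal.cof mu.ord) → e m δ ⊆ e m ν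
  guess : ∀ D, IsClubIn D (Order.succ mu).ord →
    ∃ δ ∈ D, δ.cof = Order.succ (Ordinal.cof mu.ord) ∧ ∀ m, ∀ y < δ,
      ∃ x ∈ e m δ ∩ D, y < x ∧ M m < x.cof

/-- Positivity with respect to the club guessing ideal of the ladder system `e`. -/
def IsPos (mu : Cardinal.{0}) (M : Idx mu → Cardinal.{0})
    (e : Idx mu → Ordinal.{0} → Set Ordinal.{0}) (Y : Set Ordinal.{0}) : Prop :=
  ∀ D, IsClubIn D (Order.succ mu).ord → ∃ δ ∈ D, δ.cof = Order.succ (Ordinal.cof mu.ord) ∧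
    ∃ᶠ m in Filter.atTop, ∀ y < δ, ∃ x ∈ e m δ ∩ D ∩ Y, y < x ∧ M m < x.cof

variable {mu : Cardinal.{0}} {M : Idx mu → Cardinal.{0}}
  {e : Idx mu → Ordinal.{0} → Set Ordinal.{0}} {Y Z : Set Ordinal.{0}}

theorem IsSingular.exists_isLadderSystem (h : IsSingular mu) (hM : IsLayering mu M) :
    ∃ e, IsLadderSystem mu M e := by
  obtain ⟨cb, hcb⟩ := exists_isCofinalSystem
  obtain ⟨E, -, hE⟩ := h.exists_guess hM hcb
  refine ⟨fun m ν => ladder cb E (M m) ν, fun m ν => hcb.isClubIn_ladder, fun m ν hν =>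
    hcb.mk_ladder_le (hM.aleph0_le h m) hν, fun ν m m' hm => ladder_mono (hM.mono hm),
    fun m ν δ hδ hδc => ladder_subset_ladder hδ ?_ ?_, hE⟩
  · rw [hδc]
    exact h.isRegular_cof.aleph0_le.trans_lt (Order.lt_succ _)
  · rw [hδc]
    exact hM.succ_cof_le m

theorem IsLadderSystem.isPos_univ (he : IsLadderSystem mu M e) (h : IsSingular mu) :
    IsPos mu M e univ := by
  intro D hD
  obtain ⟨δ, h1, h2, h3⟩ := he.guess D hD
  have := h.neBot
  refine ⟨δ, h1, h2, Filter.Frequently.of_forall fun m y hy => ?_⟩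
  obtain ⟨x, h4, h5⟩ := h3 m y hy
  exact ⟨x, ⟨h4, mem_univ x⟩, h5⟩

theorem exists_club_of_not_isPos (hY : ¬ IsPos mu M e Y) :
    ∃ D, IsClubIn D (Order.succ mu).ord ∧ ∀ δ ∈ D, δ.cof = Order.succ (Ordinal.cof mu.ord) →
      ¬ ∃ᶠ m in Filter.atTop, ∀ y < δ, ∃ x ∈ e m δ ∩ D ∩ Y, y < x ∧ M m < x.cof := by
  by_contra hcon
  exact hY fun D hD => by
    by_contra hno
    exact hcon ⟨D, hD, fun δ hδ hδc hfr => hno ⟨δ, hδ, hδc, hfr⟩⟩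

namespace IsPos

theorem mono (hY : IsPos mu M e Y) (hYZ : Y ⊆ Z) : IsPos mu M e Z := by
  intro D hD
  obtain ⟨δ, h1, h2, h3⟩ := hY D hD
  refine ⟨δ, h1, h2, h3.mono fun m hm y hy => ?_⟩
  obtain ⟨x, h4, h5⟩ := hm y hy
  exact ⟨x, ⟨h4.1, hYZ h4.2⟩, h5⟩

theorem inter_club (hY : IsPos mu M e Y) (h : IsSingular mu) {D : Set Ordinal.{0}}
    (hD : IsClubIn D (Order.succ mu).ord) : IsPos mu M e (Y ∩ D) := by
  intro D' hD'
  obtain ⟨δ, h1, h2, h3⟩ := hY _ (isClubIn_inter h.isRegular_succ h.aleph0_lt_succ hD hD')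
  refine ⟨δ, h1.2, h2, h3.mono fun m hm y hy => ?_⟩
  obtain ⟨x, h4, h5⟩ := hm y hy
  exact ⟨x, ⟨⟨h4.1.1, h4.1.2.2⟩, h4.2, h4.1.2.1⟩, h5⟩

theorem nonempty (hY : IsPos mu M e Y) : Y.Nonempty := by
  obtain ⟨δ, h1, h2, h3⟩ := hY (Iio (Order.succ mu).ord) isClubIn_Iio
  obtain ⟨m, hm⟩ := h3.exists
  have : δ ≠ 0 := by
    rintro rfl
    rw [Ordinal.cof_zero] at h2
    exact (Order.succ_ne_bot (Ordinal.cof mu.ord)) h2.symm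
  obtain ⟨x, hx, -⟩ := hm 0 (pos_iff_ne_zero.2 this)
  exact ⟨x, hx.2⟩

theorem exists_gt (hY : IsPos mu M e Y) (h : IsSingular mu) {u : Ordinal.{0}}
    (hu : u < (Order.succ mu).ord) : ∃ x ∈ Y, u < x ∧ x < (Order.succ mu).ord := by
  obtain ⟨x, h1, h2⟩ := (hY.inter_club h (isClubIn_Ioo h.isRegular_succ hu)).nonempty
  exact ⟨x, h1, h2⟩

theorem exists_of_biUnion {s : Set Ordinal.{0}} {F : Ordinal.{0} → Set Ordinal.{0}}
    (hY : IsPos mu M e (⋃ j ∈ s, F j)) (h : IsSingular mu)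
    (hs : CardLT s (Ordinal.cof mu.ord)) : ∃ j ∈ s, IsPos mu M e (F j) := by
  by_contra! hcon
  have : ∀ j : s, ∃ D, IsClubIn D (Order.succ mu).ord ∧ ∀ δ ∈ D,
      δ.cof = Order.succ (Ordinal.cof mu.ord) →
      ¬ ∃ᶠ m in Filter.atTop, ∀ y < δ, ∃ x ∈ e m δ ∩ D ∩ F j, y < x ∧ M m < x.cof := by
    intro j
    exact exists_club_of_not_isPos (hcon j j.2)
  choose D hD1 hD2 using this
  obtain ⟨δ, hδ, hδc, hfr⟩ := hY _ (isClubIn_iInter h.isRegular_succ h.aleph0_lt_succ (by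
    rw [Cardinal.lift_id, Cardinal.lift_id]
    exact hs.lt_lift (h.2.trans (Order.lt_succ _)).le) hD1)
  have hfr2 : ∃ᶠ m in Filter.atTop, ∃ j ∈ s, ∀ y < δ, ∃ x ∈ e m δ ∩ {x | x < (Order.succ mu).ord ∧
      ∀ j, x ∈ D j} ∩ F j, y < x ∧ M m < x.cof := by
    refine hfr.mono fun m hm => ?_
    by_contra! hno
    choose! y hy1 hy2 using hno
    obtain ⟨y', h1, h2⟩ := exists_bound_image_ord (s := s) (F := y) (δ := δ) (by
      rw [hδc]
      exact hs.lt_lift (Order.le_succ _)) hy1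
    obtain ⟨x, h3, h4, h5⟩ := hm y' h1
    obtain ⟨j, hj, hxj⟩ := mem_iUnion₂.1 h3.2
    exact (hy2 j hj x ⟨h3.1, hxj⟩ ((h2 j hj).trans h4)).not_gt h5
  obtain ⟨j, hj, hjf⟩ : ∃ j ∈ s, ∃ᶠ m in Filter.atTop, ∀ y < δ, ∃ x ∈ e m δ ∩
      {x | x < (Order.succ mu).ord ∧ ∀ j, x ∈ D j} ∩ F j, y < x ∧ M m < x.cof := by
    by_contra hno
    have := h.eventually_ball_ord hs fun j hj =>
      Filter.not_frequently.1 fun hfj => hno ⟨j, hj, hfj⟩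
    obtain ⟨m, ⟨j, hj, h1⟩, h2⟩ := (hfr2.and_eventually this).exists
    exact h2 j hj h1
  refine hD2 ⟨j, hj⟩ δ (hδ.2 _) hδc (hjf.mono fun m hm y hy => ?_)
  obtain ⟨x, h1, h2⟩ := hm y hy
  exact ⟨x, ⟨⟨h1.1.1, h1.1.2.2 _⟩, h1.2⟩, h2⟩

theorem exists_of_biUnion_mono {χ : Cardinal.{0}} {F : Ordinal.{0} → Set Ordinal.{0}}
    (hY : IsPos mu M e (⋃ j ∈ Iio χ.ord, F j)) (h : IsSingular mu) (hχ : χ.IsRegular)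
    (hκχ : Order.succ (Ordinal.cof mu.ord) < χ) (hχm : χ < mu)
    (hF : ∀ i j, i ≤ j → j < χ.ord → F i ⊆ F j) : ∃ j < χ.ord, IsPos mu M e (F j) := by
  by_contra! hcon
  have : ∀ j < χ.ord, ∃ D, IsClubIn D (Order.succ mu).ord ∧ ∀ δ ∈ D,
      δ.cof = Order.succ (Ordinal.cof mu.ord) →
      ¬ ∃ᶠ m in Filter.atTop, ∀ y < δ, ∃ x ∈ e m δ ∩ D ∩ F j, y < x ∧ M m < x.cof := by
    intro j hj
    exact exists_club_of_not_isPos (hcon j hj)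
  choose! D hD1 hD2 using this
  obtain ⟨δ, hδ, hδc, hfr⟩ := hY _ (isClubIn_biInter h.isRegular_succ h.aleph0_lt_succ
    (Cardinal.ord_lt_ord.2 (hχm.trans (Order.lt_succ _))) hD1)
  have hχ0 : 0 < χ.ord := Cardinal.ord_pos.2 hχ.pos
  let P : Idx mu → Ordinal.{0} → Prop := fun m j => ∀ y < δ, ∃ x ∈ e m δ ∩
    {x | x < (Order.succ mu).ord ∧ ∀ j < χ.ord, x ∈ D j} ∩ F j, y < x ∧ M m < x.cof
  have hPmono : ∀ m i j, i ≤ j → j < χ.ord → P m i → P m j := fun m i j hij hj hP y hy => by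
    obtain ⟨x, h1, h2⟩ := hP y hy
    exact ⟨x, ⟨h1.1, hF i j hij hj h1.2⟩, h2⟩
  have hex : ∀ m, ∃ j < χ.ord, (∀ y < δ, ∃ x ∈ e m δ ∩ {x | x < (Order.succ mu).ord ∧
      ∀ j < χ.ord, x ∈ D j} ∩ (⋃ j ∈ Iio χ.ord, F j), y < x ∧ M m < x.cof) → P m j := by
    intro m
    by_cases hm : ∀ y < δ, ∃ x ∈ e m δ ∩ {x | x < (Order.succ mu).ord ∧
      ∀ j < χ.ord, x ∈ D j} ∩ (⋃ j ∈ Iio χ.ord, F j), y < x ∧ M m < x.cof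
    swap
    · exact ⟨0, hχ0, fun h => absurd h hm⟩
    choose! x hx1 hx2 hx3 using hm
    have : ∀ y < δ, ∃ j < χ.ord, x y ∈ F j := fun y hy => by
      obtain ⟨j, hj, hxj⟩ := mem_iUnion₂.1 (hx1 y hy).2
      exact ⟨j, hj, hxj⟩
    choose! J hJ1 hJ2 using this
    obtain ⟨cb, h1, h2, h3⟩ := exists_cofinal_set δ
    obtain ⟨j, hj, hj'⟩ := exists_bound_image_ord (s := cb) (F := J) (δ := χ.ord) (by
      rw [h3, hδc, hχ.cof_ord]
      exact Cardinal.lift_lt.2 hκχ) fun y hy => hJ1 y (h1 y hy)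
    refine ⟨j, hj, fun _ y hy => ?_⟩
    obtain ⟨y', hy', hyy'⟩ := h2 y hy
    have := h1 y' hy'
    exact ⟨x y', ⟨(hx1 y' this).1, hF _ _ (hj' y' hy').le hj (hJ2 y' this)⟩,
      hyy'.trans_lt (hx2 y' this), hx3 y' this⟩
  choose J hJ1 hJ2 using hex
  obtain ⟨j, hj, hj'⟩ := exists_bound_idx (F := J) (δ := χ.ord) (by
    rw [hχ.cof_ord]
    exact (Order.lt_succ _).trans hκχ) hJ1
  refine hD2 j hj δ (hδ.2 j hj) hδc (hfr.mono fun m hm y hy => ?_)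
  obtain ⟨x, h1, h2⟩ := hPmono m _ _ (hj' m).le hj (hJ2 m hm) y hy
  exact ⟨x, ⟨⟨h1.1.1, h1.1.2.2 j hj⟩, h1.2⟩, h2⟩

theorem diff (hY : IsPos mu M e Y) (h : IsSingular mu) (hZ : ¬ IsPos mu M e Z) :
    IsPos mu M e (Y \ Z) := by
  classical
  let F : Ordinal.{0} → Set Ordinal.{0} := fun j => if j = 0 then Z else Y \ Z
  obtain ⟨j, hj, hjp⟩ := (hY.mono (Z := ⋃ j ∈ ({0, 1} : Set Ordinal.{0}), F j) (fun x hx => by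
    by_cases hxZ : x ∈ Z
    · exact mem_iUnion₂.2 ⟨0, by simp, by simpa [F] using hxZ⟩
    · exact mem_iUnion₂.2 ⟨1, by simp, by simpa [F] using ⟨hx, hxZ⟩⟩)).exists_of_biUnion h (by
      have : Cardinal.mk ({0, 1} : Set Ordinal.{0}) < Cardinal.aleph0 :=
        Cardinal.lt_aleph0_iff_finite.2 (toFinite _)
      exact this.trans_le (Cardinal.aleph0_le_lift.2 h.isRegular_cof.aleph0_le))
  rcases hj with rfl | rfl
  · exact absurd (by simpa [F] using hjp) hZ
  · simpa [F] using hjp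

end IsPos

end Ideal

section Walks

/-- The minimal walk from `ζ` to `x` along `e` only passes, before `x`, through ordinals of
cofinality at most `c`. -/
inductive WalkLE (e : Ordinal.{0} → Set Ordinal.{0}) (c : Cardinal.{0}) (x : Ordinal.{0}) :
    Ordinal.{0} → Prop
  | refl : WalkLE e c x x
  | step {ζ : Ordinal.{0}} : x < ζ → ζ.cof ≤ c → WalkLE e c x (sInf (e ζ ∩ Ici x)) →
      WalkLE e c x ζ

open Classical in
/-- The first ordinal of cofinality greater than `c` on the walk from `ζ` to `ξ`. -/
def walkStop (e : Ordinal.{0} → Set Ordinal.{0}) (c : Cardinal.{0}) (ξ : Ordinal.{0}) :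
    Ordinal.{0} → Ordinal.{0} :=
  WellFoundedLT.fix fun ζ ih =>
    if ζ ≤ ξ ∨ c < ζ.cof then ζ
    else if h : sInf (e ζ ∩ Ici ξ) < ζ then ih _ h else ζ

variable {e : Ordinal.{0} → Set Ordinal.{0}} {c : Cardinal.{0}}

theorem sInf_inter_Ici_mem {s : Set Ordinal.{0}} {ζ x : Ordinal.{0}} (hs : IsClubIn s ζ)
    (hx : x < ζ) : sInf (s ∩ Ici x) ∈ s ∩ Ici x := by
  obtain ⟨y, hy, hxy, -⟩ := hs.2.2 x hx
  exact csInf_mem ⟨y, hy, hxy⟩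

theorem sInf_inter_Ici_eq {s : Set Ordinal.{0}} {y x ξ : Ordinal.{0}} (hyξ : y < ξ) (hξx : ξ ≤ x) (h : ∀ z ∈ s, y < z → x ≤ z) :
    sInf (s ∩ Ici ξ) = sInf (s ∩ Ici x) := by
  congr 1
  ext z
  exact ⟨fun hz => ⟨hz.1, h z hz.1 (hyξ.trans_le hz.2)⟩, fun hz => ⟨hz.1, hξx.trans hz.2⟩⟩

theorem sInf_inter_Ici_of_mem {s : Set Ordinal.{0}} {x : Ordinal.{0}} (hx : x ∈ s) :
    sInf (s ∩ Ici x) = x :=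
  le_antisymm (csInf_le' ⟨hx, self_mem_Ici⟩) (le_csInf ⟨x, hx, self_mem_Ici⟩ fun _ hz => hz.2)

theorem walkStop_of_lt_cof {ξ ζ : Ordinal.{0}} (h : c < ζ.cof) : walkStop e c ξ ζ = ζ := by
  rw [walkStop, WellFoundedLT.fix_eq, if_pos (Or.inr h)]

theorem walkStop_of_cof_le (he : ∀ ν, IsClubIn (e ν) ν) {ξ ζ : Ordinal.{0}} (hξ : ξ < ζ)
    (h : ζ.cof ≤ c) : walkStop e c ξ ζ = walkStop e c ξ (sInf (e ζ ∩ Ici ξ)) := by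
  have h1 : sInf (e ζ ∩ Ici ξ) < ζ := (he ζ).1 (sInf_inter_Ici_mem (he ζ) hξ).1
  conv_lhs => rw [walkStop, WellFoundedLT.fix_eq, if_neg (not_or.2 ⟨hξ.not_ge, h.not_gt⟩),
    dif_pos h1]
  rfl

theorem walkStop_le (ξ ζ : Ordinal.{0}) : walkStop e c ξ ζ ≤ ζ := by
  induction ζ using WellFoundedLT.induction with
  | _ ζ ih =>
    rw [walkStop, WellFoundedLT.fix_eq]
    split_ifs with h1 h2
    · exact le_rfl
    · exact (ih _ h2).trans h2.le
    · exact le_rfl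

theorem WalkLE.exists_walkStop_eq {x ζ : Ordinal.{0}} (hw : WalkLE e c x ζ)
    (he : ∀ ν, IsClubIn (e ν) ν)
    (hcard : ∀ ν, ν.cof ≤ c → Cardinal.mk (e ν) ≤ Cardinal.lift.{1} c) (hx : c < x.cof) :
    ∃ y < x, ∀ ξ, y < ξ → ξ < x → walkStop e c ξ ζ = x := by
  have hx0 : 0 < x := by
    rw [pos_iff_ne_zero]
    rintro rfl
    simp at hx
  induction hw with
  | refl => exact ⟨0, hx0, fun ξ _ _ => walkStop_of_lt_cof hx⟩
  | @step ζ hxζ hζc _ ih =>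
    obtain ⟨y, hy, hy'⟩ := ih
    obtain ⟨z, hz, hz'⟩ := exists_bound_of_set (s := e ζ ∩ Iio x) (δ := x)
      ((Cardinal.mk_le_mk_of_subset inter_subset_left).trans_lt
        ((hcard ζ hζc).trans_lt (Cardinal.lift_lt.2 hx))) fun w hw => hw.2
    refine ⟨max y z, max_lt hy hz, fun ξ h1 h2 => ?_⟩
    obtain ⟨h3, h4⟩ := max_lt_iff.1 h1
    rw [walkStop_of_cof_le he (h2.trans hxζ) hζc, sInf_inter_Ici_eq h4 h2.le]
    · exact hy' ξ h3 h2
    · intro w hw hzw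
      by_contra! hwx
      exact (hz' w ⟨hw, hwx⟩).not_gt hzw

theorem WalkLE.exists_walkLE {δ ζ : Ordinal.{0}} (hw : WalkLE e c δ ζ)
    (he : ∀ ν, IsClubIn (e ν) ν) (hδ0 : 0 < δ) (hδ : δ.cof ≤ c)
    (hcoh : ∀ ν, δ ∈ e ν → e δ ⊆ e ν) : ∃ y < δ, ∀ x ∈ e δ, y < x → WalkLE e c x ζ := by
  induction hw with
  | refl =>
    refine ⟨0, hδ0, fun x hx _ => WalkLE.step ((he δ).1 hx) hδ ?_⟩
    rw [sInf_inter_Ici_of_mem hx]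
    exact WalkLE.refl
  | @step ζ hδζ hζc _ ih =>
    by_cases hlim : ∀ y < δ, ∃ z ∈ e ζ, y < z ∧ z < δ
    · have hmem := (he ζ).2.1 δ hδζ hδ0 hlim
      refine ⟨0, hδ0, fun x hx _ => WalkLE.step (((he δ).1 hx).trans hδζ) hζc ?_⟩
      rw [sInf_inter_Ici_of_mem (hcoh ζ hmem hx)]
      exact WalkLE.refl
    · push Not at hlim
      obtain ⟨z, hz, hz'⟩ := hlim
      obtain ⟨y, hy, hy'⟩ := ih
      refine ⟨max y z, max_lt hy hz, fun x hx h1 => ?_⟩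
      obtain ⟨h2, h3⟩ := max_lt_iff.1 h1
      have h4 := (he δ).1 hx
      refine WalkLE.step (h4.trans hδζ) hζc ?_
      rw [sInf_inter_Ici_eq h3 h4.le hz']
      exact hy' x hx h2

theorem IsLadderSystem.eventually_walkLE {mu : Cardinal.{0}} {M : Idx mu → Cardinal.{0}}
    {e : Idx mu → Ordinal.{0} → Set Ordinal.{0}} (he : IsLadderSystem mu M e) (h : IsSingular mu)
    (hM : IsLayering mu M) {δ ζ : Ordinal.{0}} (hδ : δ ≤ ζ) (hζ : ζ < (Order.succ mu).ord) :
    ∀ᶠ m in Filter.atTop, WalkLE (e m) (M m) δ ζ := by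
  induction ζ using WellFoundedLT.induction with
  | _ ζ ih =>
    rcases hδ.eq_or_lt with rfl | hδ
    · exact Filter.Eventually.of_forall fun m => WalkLE.refl
    have := h.nonempty_idx
    obtain ⟨_, ⟨m₀, rfl⟩, hmin⟩ := WellFounded.has_min (wellFounded_lt (α := Ordinal.{0}))
      (range fun m => sInf (e m ζ ∩ Ici δ)) (range_nonempty _)
    have hmem := fun m => sInf_inter_Ici_mem (he.club m ζ) hδ
    have hlt := (he.club m₀ ζ).1 (hmem m₀).1
    filter_upwards [Filter.eventually_ge_atTop m₀, ih _ hlt (hmem m₀).2 (hlt.trans hζ),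
      hM.eventually_lt h (h.cof_lt hζ)] with m h1 h2 h3
    refine WalkLE.step hδ h3.le ?_
    have : sInf (e m ζ ∩ Ici δ) = sInf (e m₀ ζ ∩ Ici δ) :=
      le_antisymm (csInf_le' ⟨he.mono ζ h1 (hmem m₀).1, (hmem m₀).2⟩)
        (not_lt.1 (hmin _ ⟨m, rfl⟩))
    rwa [this]

end Walks

section Coloring

variable {mu : Cardinal.{0}}

theorem IsSingular.exists_code (h : IsSingular mu) :
    ∃ c : Idx mu → Idx mu × Idx mu × Idx mu, ∀ p z, ∃ i, z ≤ i ∧ c i = p := by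
  have hinf : Cardinal.aleph0 ≤ Cardinal.mk (Idx mu) := by
    rw [Idx.mk_eq]
    exact h.isRegular_cof.aleph0_le
  have : Nonempty (Idx mu ≃ Idx mu × Idx mu × Idx mu × Idx mu) := by
    rw [← Cardinal.eq]
    simp only [Cardinal.mk_prod, Cardinal.lift_id, Cardinal.mul_eq_self hinf]
  obtain ⟨E⟩ := this
  refine ⟨fun i => (E i).2, fun p z => ?_⟩
  by_contra! hcon
  have hsub : range (fun j => E.symm (j, p)) ⊆ Iio z := by
    rintro _ ⟨j, rfl⟩
    by_contra hj
    exact hcon _ (not_lt.1 hj) (by simp)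
  have h1 := (Cardinal.mk_le_mk_of_subset hsub).trans_lt (mk_Iio_idx z)
  rw [Cardinal.mk_range_eq _ (fun i j hij => by simpa using hij), Idx.mk_eq] at h1
  exact h1.false

theorem pr1With_of_isPos (h : IsSingular mu) {g : Idx mu → Ordinal.{0}}
    {f : Ordinal.{0} → Idx mu → Ordinal.{0}} (hf : IsTrueScale mu g f)
    {M : Idx mu → Cardinal.{0}} (hM : IsLayering mu M)
    {e : Idx mu → Ordinal.{0} → Set Ordinal.{0}} (he : IsLadderSystem mu M e)
    {P : Idx mu → Ordinal.{0} → Set Ordinal.{0}}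
    (hP : ∀ k, ∀ υ < (M k).ord, IsPos mu M e (P k υ))
    (hdis : ∀ k, ∀ υ < (M k).ord, ∀ υ' < (M k).ord, υ ≠ υ' → Disjoint (P k υ) (P k υ')) :
    Pr1 mu (Order.succ mu) := by
  classical
  obtain ⟨code, hcode⟩ := h.exists_code
  have hr := h.isRegular_succ
  have hu := h.aleph0_lt_succ
  choose! φ hφ1 hφ2 using fun ν (hν : ν < (Order.succ mu).ord) => exists_injOn_lt_ord hν
  let y1 : Idx mu → Ordinal.{0} → Ordinal.{0} → Ordinal.{0} := fun i ξ ζ =>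
    walkStop (e (code i).1) (M (code i).1) ξ ζ
  let y2 : Idx mu → Ordinal.{0} → Ordinal.{0} → Ordinal.{0} := fun i ξ ζ =>
    walkStop (e (code i).2.1) (M (code i).2.1) ξ (y1 i ξ ζ)
  let IsColor : Ordinal.{0} → Ordinal.{0} → Ordinal.{0} → Prop := fun ξ ζ τ =>
    ∃ i, IsLastDrop f ξ ζ i ∧ τ < y1 i ξ ζ ∧ φ (y1 i ξ ζ) τ < (M (code i).2.2).ord ∧
      y2 i ξ ζ ∈ P (code i).2.2 (φ (y1 i ξ ζ) τ)
  have huniq : ∀ ξ ζ τ τ', ζ < (Order.succ mu).ord → IsColor ξ ζ τ → IsColor ξ ζ τ' → τ = τ' := by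
    rintro ξ ζ τ τ' hζ ⟨i, h1, h2, h3, h4⟩ ⟨i', h1', h2', h3', h4'⟩
    obtain rfl := h1.unique h1'
    refine hφ1 _ ((walkStop_le _ _).trans_lt hζ) h2 h2' ?_
    by_contra hne
    exact (hdis _ _ h3 _ h3' hne).le_bot ⟨h4, h4'⟩
  have h0 : (0 : Ordinal) < (Order.succ mu).ord := Cardinal.ord_pos.2 hr.pos
  refine ⟨fun ξ ζ => if hc : ∃ τ, IsColor ξ ζ τ then hc.choose else 0, fun ξ ζ _ hζ => ?_,
    fun t ht1 ht2 ht3 τ hτ => ?_⟩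
  · dsimp only
    split_ifs with hc
    · obtain ⟨i, -, h2, -⟩ := hc.choose_spec
      exact (h2.trans_le (walkStop_le _ _)).trans hζ
    · exact h0
  change τ < (Order.succ mu).ord at hτ
  by_cases hne : ∀ a < (Order.succ mu).ord, (t a).Nonempty
  swap
  · push Not at hne
    obtain ⟨a, ha, hta⟩ := hne
    refine ⟨a, a + 1, lt_add_one a, hr.isSuccLimit_ord.add_one_lt ha, fun ξ hξ => ?_⟩
    rw [hta] at hξ
    exact hξ.elim
  have ht : IsBlockSeq mu t := ⟨ht1, ht2, ht3, hne⟩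
  obtain ⟨E, hE1, hE2⟩ := hf.exists_isClubIn_isLastDrop h ht
  have hacc : ∀ k, ∀ υ < (M k).ord, ∃ D, IsClubIn D (Order.succ mu).ord ∧ ∀ δ ∈ D, ∀ x < δ,
      ∃ y ∈ {y | y ∈ E ∧ y.cof = Order.succ (Ordinal.cof mu.ord) ∧ ∃ᶠ m in Filter.atTop,
        ∀ w < y, ∃ x ∈ e m y ∩ E ∩ P k υ, w < x ∧ M m < x.cof}, x < y ∧ y < δ := by
    intro k υ hυ
    refine exists_isClubIn_acc hr hu fun x hx => ?_
    obtain ⟨δ, h1, h2, h3⟩ := hP k υ hυ _ (isClubIn_inter hr hu hE1 (isClubIn_Ioo hr hx))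
    refine ⟨δ, ⟨h1.1, h2, h3.mono fun m hm w hw => ?_⟩, h1.2⟩
    obtain ⟨x, h4, h5⟩ := hm w hw
    exact ⟨x, ⟨⟨h4.1.1, h4.1.2.1⟩, h4.2⟩, h5⟩
  choose! D hD1 hD2 using hacc
  have hE2club := isClubIn_inter hr hu (isClubIn_inter hr hu hE1 (isClubIn_Ioo hr hτ))
    (h.isClubIn_iInter_idx fun k => isClubIn_biInter hr hu
      (Cardinal.ord_lt_ord.2 ((hM.lt k).trans (Order.lt_succ _))) (hD1 k))
  obtain ⟨δ₁, hδ₁, hδ₁c, hδ₁g⟩ := he.guess _ hE2club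
  have hδ₁l := hE1.1 hδ₁.1.1
  obtain ⟨β, hβ, hβt⟩ := ht.exists_subset_Ici h hδ₁l
  have htβ := hβt β hβ le_rfl
  have hpos : ∀ δ : Ordinal.{0}, δ.cof = Order.succ (Ordinal.cof mu.ord) → 0 < δ := by
    intro δ hδ
    rw [pos_iff_ne_zero]
    rintro rfl
    rw [Ordinal.cof_zero] at hδ
    exact (Order.succ_ne_bot (Ordinal.cof mu.ord)) hδ.symm
  have := h.neBot
  obtain ⟨m₁, hm₁⟩ := (h.eventually_ball_ord (ht3 β hβ) fun ζ hζ =>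
    he.eventually_walkLE h hM (htβ hζ) (ht1 β hβ hζ)).exists
  choose! w hw1 hw2 using fun ζ hζ => (hm₁ ζ hζ).exists_walkLE (he.club m₁) (hpos _ hδ₁c)
    (hδ₁c.trans_le (hM.succ_cof_le m₁)) fun ν hν => he.coherent m₁ ν δ₁ hν hδ₁c
  obtain ⟨w', hw', hww'⟩ := exists_bound_image_ord
    ((ht3 β hβ).lt_lift (hδ₁c ▸ Order.le_succ (Ordinal.cof mu.ord))) hw1
  obtain ⟨x₁, ⟨hx₁e, hx₁⟩, hwx₁, hx₁c⟩ := hδ₁g m₁ w' hw'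
  have hx₁δ := (he.club m₁ δ₁).1 hx₁e
  choose! v hv1 hv2 using fun ζ hζ => (hw2 ζ hζ x₁ hx₁e ((hww' ζ hζ).trans hwx₁)).exists_walkStop_eq
    (he.club m₁) (he.card m₁) hx₁c
  obtain ⟨v', hv', hvv'⟩ := exists_bound_image_ord
    ((ht3 β hβ).lt_lift ((hM.cof_lt m₁).trans hx₁c).le) hv1
  have hτx₁ : τ < x₁ := hx₁.1.2.1
  have hx₁l := hE1.1 hx₁.1.1
  obtain ⟨k, hk⟩ := hM.cofinal _ (Cardinal.lt_ord.1 (hφ2 x₁ hx₁l τ hτx₁))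
  have hk' := Cardinal.lt_ord.2 hk
  obtain ⟨δ₂, ⟨hδ₂, hδ₂c, hδ₂f⟩, hvδ₂, hδ₂x₁⟩ := hD2 k _ hk' x₁ ((hx₁.2.2 k).2 _ hk') v' hv'
  obtain ⟨m₂, hm₂, hm₂'⟩ :=
    (hδ₂f.and_eventually (he.eventually_walkLE h hM hδ₂x₁.le hx₁l)).exists
  obtain ⟨z, hz1, hz2⟩ := hm₂'.exists_walkLE (he.club m₂) (hpos _ hδ₂c)
    (hδ₂c.trans_le (hM.succ_cof_le m₂)) fun ν hν => he.coherent m₂ ν δ₂ hν hδ₂c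
  obtain ⟨x₂, ⟨⟨hx₂e, hx₂E⟩, hx₂P⟩, hx₂, hx₂c⟩ := hm₂ _ (max_lt hz1 hvδ₂)
  have hx₂δ := (he.club m₂ δ₂).1 hx₂e
  obtain ⟨hzx₂, hvx₂⟩ := max_lt_iff.1 hx₂
  obtain ⟨y, hy1, hy2⟩ := (hz2 x₂ hx₂e hzx₂).exists_walkStop_eq (he.club m₂) (he.card m₂) hx₂c
  have hx₂x₁ := hx₂δ.trans hδ₂x₁
  obtain ⟨i₀, hi₀⟩ := h.eventually_atTop.1 (hE2 x₂ hx₂E _ (max_lt hy1 hvx₂) β hβ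
    (htβ.trans (Ici_subset_Ici.2 (hx₂x₁.trans hx₁δ).le)))
  obtain ⟨i, hi, hic⟩ := hcode (m₁, m₂, k) i₀
  obtain ⟨α, hα, hαt, hαd⟩ := hi₀ i hi
  refine ⟨α, β, ?_, hβ, fun ξ hξ ζ hζ => ?_⟩
  · by_contra! hle
    obtain ⟨ξ, hξ⟩ := hne α hα
    exact ((hαt hξ).2.trans (hx₂x₁.trans hx₁δ)).not_ge (hβt α hα hle hξ)
  · obtain ⟨h1, h2⟩ := hαt hξ
    obtain ⟨h3, h4⟩ := max_lt_iff.1 h1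
    have h5 : ξ < ζ := (h2.trans (hx₂x₁.trans hx₁δ)).trans_le (htβ hζ)
    rw [min_eq_left h5.le, max_eq_right h5.le]
    have h6 : y1 i ξ ζ = x₁ := by
      simp only [y1, hic]
      exact hv2 ζ hζ ξ ((hvv' ζ hζ).trans h4) (h2.trans hx₂x₁)
    have h7 : y2 i ξ ζ = x₂ := by
      simp only [y2, h6]
      rw [hic]
      exact hy2 ξ h3 h2
    have h8 : IsColor ξ ζ τ := by
      refine ⟨i, hαd ξ hξ ζ hζ, ?_⟩
      rw [h6, h7, hic]
      exact ⟨hτx₁, hk', hx₂P⟩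
    have h9 : ∃ τ, IsColor ξ ζ τ := ⟨τ, h8⟩
    beta_reduce
    rw [dif_pos h9]
    exact huniq ξ ζ _ _ (ht1 β hβ hζ) h9.choose_spec h8

end Coloring

section Reflection

theorem exists_sequence_le {Θ : Cardinal.{0}} (hr : Θ.IsRegular) {s : Ordinal.{0} → Ordinal.{0}}
    (hs : ∀ j < Θ.ord, s j < Θ.ord) : ∃ u : Ordinal.{0} → Ordinal.{0},
      (∀ υ < Θ.ord, u υ < Θ.ord) ∧ ∀ υ' υ, υ' < υ → υ < Θ.ord → s (u υ') ≤ u υ := by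
  let u : Ordinal.{0} → Ordinal.{0} :=
    WellFoundedLT.fix fun υ ih => sInf {t | ∀ υ' (h : υ' < υ), s (ih υ' h) ≤ t}
  have hu : ∀ υ, u υ = sInf {t | ∀ υ' < υ, s (u υ') ≤ t} := fun υ => WellFoundedLT.fix_eq _ _
  have key : ∀ υ < Θ.ord, (∀ υ' < υ, u υ' < Θ.ord) →
      ∃ t < Θ.ord, ∀ υ' < υ, s (u υ') ≤ t := by
    intro υ hυ ih
    obtain ⟨t, h1, h2⟩ := exists_bound_Iio (a := υ) (δ := Θ.ord) (f := fun υ' => s (u υ'))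
      (by rw [hr.cof_ord]; exact Cardinal.lt_ord.1 hυ) fun j hj => hs _ (ih j hj)
    exact ⟨t, h1, fun j hj => (h2 j hj).le⟩
  have hlt : ∀ υ < Θ.ord, u υ < Θ.ord := by
    intro υ
    induction υ using WellFoundedLT.induction with
    | _ υ ih =>
      intro hυ
      obtain ⟨t, h1, h2⟩ := key υ hυ fun υ' h => ih υ' h (h.trans hυ)
      rw [hu]
      exact (csInf_le' (show t ∈ {t | ∀ υ' < υ, s (u υ') ≤ t} from h2)).trans_lt h1
  refine ⟨u, hlt, fun υ' υ h hυ => ?_⟩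
  obtain ⟨t, -, h2⟩ := key υ hυ fun υ' h => hlt υ' (h.trans hυ)
  have h3 : sInf {t | ∀ υ' < υ, s (u υ') ≤ t} ∈ {t | ∀ υ' < υ, s (u υ') ≤ t} :=
    csInf_mem ⟨t, h2⟩
  rw [← hu] at h3
  exact h3 υ' h

variable {mu : Cardinal.{0}} {M : Idx mu → Cardinal.{0}}
  {e : Idx mu → Ordinal.{0} → Set Ordinal.{0}}

theorem exists_not_isPos_compl (h : IsSingular mu) {N χ : Cardinal.{0}}
    (hN : ¬ ∃ P : Ordinal.{0} → Set Ordinal.{0}, (∀ υ < N.ord, IsPos mu M e (P υ)) ∧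
      ∀ υ < N.ord, ∀ υ' < N.ord, υ ≠ υ' → Disjoint (P υ) (P υ'))
    (hχ : χ.IsRegular) (hκχ : Order.succ (Ordinal.cof mu.ord) < χ) (hχm : χ < mu) (hNχ : N ≤ χ)
    {Y : Ordinal.{0} → Set Ordinal.{0}} (hY : ∀ i j, i ≤ j → j < χ.ord → Y i ⊆ Y j)
    (hcov : ∀ x, ∃ j < χ.ord, x ∈ Y j) : ∃ j < χ.ord, ¬ IsPos mu M e (Y j)ᶜ := by
  by_contra! hcon
  have h1 : ∀ j < χ.ord, ∃ i < χ.ord, IsPos mu M e (Y i \ Y j) := by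
    intro j hj
    refine ((hcon j hj).mono fun x hx => ?_).exists_of_biUnion_mono h hχ hκχ hχm
      fun i i' hi hi' => sdiff_subset_sdiff_left (hY i i' hi hi')
    obtain ⟨i, hi, hxi⟩ := hcov x
    exact mem_iUnion₂.2 ⟨i, hi, hxi, hx⟩
  choose! s hs hsP using h1
  obtain ⟨u, hu, hus⟩ := exists_sequence_le hχ hs
  have hle : N.ord ≤ χ.ord := Cardinal.ord_le_ord.2 hNχ
  have hdis : ∀ υ' υ, υ' < υ → υ < N.ord →
      Disjoint (Y (s (u υ')) \ Y (u υ')) (Y (s (u υ)) \ Y (u υ)) := by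
    intro υ' υ h1 h2
    have h3 := h2.trans_le hle
    rw [Set.disjoint_left]
    exact fun x hx hx' => hx'.2 (hY _ _ (hus υ' υ h1 h3) (hu υ h3) hx.1)
  refine hN ⟨fun υ => Y (s (u υ)) \ Y (u υ), fun υ hυ => hsP _ (hu υ (hυ.trans_le hle)),
    fun υ hυ υ' hυ' hne => ?_⟩
  rcases hne.lt_or_gt with h1 | h1
  · exact hdis υ υ' h1 hυ'
  · exact (hdis υ' υ h1 hυ).symm

open Classical in
/-- The last ordinal at least `δ` on the walk from `x` to `a` along `C`. -/
def walkAbove (C : Ordinal.{0} → Set Ordinal.{0}) (a δ : Ordinal.{0}) :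
    Ordinal.{0} → Ordinal.{0} :=
  WellFoundedLT.fix fun x ih =>
    if h : sInf (C x ∩ Ici a) < x then
      if δ ≤ sInf (C x ∩ Ici a) then ih _ h else x
    else x

variable {C : Ordinal.{0} → Set Ordinal.{0}} {a δ x : Ordinal.{0}}

theorem walkAbove_of_le (h1 : sInf (C x ∩ Ici a) < x) (h2 : δ ≤ sInf (C x ∩ Ici a)) :
    walkAbove C a δ x = walkAbove C a δ (sInf (C x ∩ Ici a)) := by
  conv_lhs => rw [walkAbove, WellFoundedLT.fix_eq, dif_pos h1, if_pos h2]
  rfl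

theorem walkAbove_of_not (h : ¬ (sInf (C x ∩ Ici a) < x ∧ δ ≤ sInf (C x ∩ Ici a))) :
    walkAbove C a δ x = x := by
  rw [walkAbove, WellFoundedLT.fix_eq]
  split_ifs with h1 h2
  · exact absurd ⟨h1, h2⟩ h
  · rfl
  · rfl

theorem walkAbove_le : walkAbove C a δ x ≤ x := by
  induction x using WellFoundedLT.induction with
  | _ x ih =>
    by_cases h : sInf (C x ∩ Ici a) < x ∧ δ ≤ sInf (C x ∩ Ici a)
    · rw [walkAbove_of_le h.1 h.2]
      exact (ih _ h.1).trans h.1.le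
    · exact (walkAbove_of_not h).le

theorem le_walkAbove (hx : δ ≤ x) : δ ≤ walkAbove C a δ x := by
  induction x using WellFoundedLT.induction with
  | _ x ih =>
    by_cases h : sInf (C x ∩ Ici a) < x ∧ δ ≤ sInf (C x ∩ Ici a)
    · rw [walkAbove_of_le h.1 h.2]
      exact ih _ h.1 h.2
    · exact hx.trans_eq (walkAbove_of_not h).symm

theorem walkAbove_mono (C : Ordinal.{0} → Set Ordinal.{0}) (a x : Ordinal.{0}) :
    Monotone fun δ => walkAbove C a δ x := by
  intro δ δ' hδ
  induction x using WellFoundedLT.induction with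
  | _ x ih =>
    by_cases h : sInf (C x ∩ Ici a) < x ∧ δ' ≤ sInf (C x ∩ Ici a)
    · have := ih _ h.1
      simp only at this ⊢
      rwa [walkAbove_of_le h.1 h.2, walkAbove_of_le h.1 (hδ.trans h.2)]
    · simp only
      rw [walkAbove_of_not h]
      exact walkAbove_le

theorem finite_range_walkAbove (C : Ordinal.{0} → Set Ordinal.{0}) (a x : Ordinal.{0}) :
    (range fun δ => walkAbove C a δ x).Finite := by
  induction x using WellFoundedLT.induction with
  | _ x ih =>
    by_cases h : sInf (C x ∩ Ici a) < x
    · refine ((ih _ h).insert x).subset ?_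
      rintro _ ⟨δ, rfl⟩
      by_cases h2 : δ ≤ sInf (C x ∩ Ici a)
      · exact Or.inr ⟨δ, (walkAbove_of_le h h2).symm⟩
      · exact Or.inl (walkAbove_of_not fun h3 => h2 h3.2)
    · refine (finite_singleton x).subset ?_
      rintro _ ⟨δ, rfl⟩
      exact walkAbove_of_not fun h3 => h h3.1

/-- Walks from `x` to ordinals between `a` and `δ` leave the ordinals above `δ` through sets
unbounded in `δ`. -/
def IsGoodAt (C : Ordinal.{0} → Set Ordinal.{0}) (δ a x : Ordinal.{0}) : Prop :=
  δ ≤ x → ∀ a', a < a' → a' < δ → UnbddIn (C (walkAbove C a' δ x)) δ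

theorem IsGoodAt.mono {b : Ordinal.{0}} (hg : IsGoodAt C δ a x) (hab : a ≤ b) :
    IsGoodAt C δ b x := fun h a' h1 h2 => hg h a' (hab.trans_lt h1) h2

theorem exists_isGoodAt (hC : ∀ x, IsClubIn (C x) x) (hδ : 0 < δ) (x : Ordinal.{0}) :
    ∃ y < δ, IsGoodAt C δ y x := by
  induction x using WellFoundedLT.induction with
  | _ x ih =>
    by_cases hub : UnbddIn (C x) δ
    · refine ⟨0, hδ, fun hx a' h1 h2 => ?_⟩
      rw [walkAbove_of_not]
      · exact hub
      · obtain ⟨z, hz, h3, h4⟩ := hub a' h2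
        exact fun h5 => (h5.2.trans (csInf_le' ⟨hz, mem_Ici.2 h3⟩)).not_gt h4
    · rcases le_or_gt x δ with hxδ | hxδ
      · refine ⟨0, hδ, fun hx => ?_⟩
        obtain rfl := le_antisymm hx hxδ
        exact absurd (hC δ).2.2 hub
      · have h1 : ∃ y < δ, ∀ z ∈ C x, y ≤ z → δ ≤ z := by
          by_contra! hcon
          exact hub fun y hy => by
            obtain ⟨z, h1, h2, h3⟩ := hcon y hy
            exact ⟨z, h1, h2, h3⟩
        obtain ⟨y, hy, hyz⟩ := h1
        have h2 := sInf_inter_Ici_mem (hC x) hxδ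
        have h3 : sInf (C x ∩ Ici δ) < x := (hC x).1 h2.1
        have h4 : δ ≤ sInf (C x ∩ Ici δ) := h2.2
        obtain ⟨y', hy', hg⟩ := ih _ h3
        refine ⟨max y y', max_lt hy hy', fun _ a' h5 h6 => ?_⟩
        obtain ⟨h7, h8⟩ := max_lt_iff.1 h5
        have h9 : sInf (C x ∩ Ici a') = sInf (C x ∩ Ici δ) :=
          sInf_inter_Ici_eq h7 h6.le fun z hz hyz' => hyz z hz hyz'.le
        rw [walkAbove_of_le (by rwa [h9]) (by rwa [h9]), h9]
        exact hg h4 a' h8 h6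

/-- For `δ` of large cofinality, a single ordinal witnesses goodness at `δ` for all but
negligibly many starting points. -/
theorem exists_not_isPos_not_isGoodAt (h : IsSingular mu) {N : Cardinal.{0}}
    (hN : ¬ ∃ P : Ordinal.{0} → Set Ordinal.{0}, (∀ υ < N.ord, IsPos mu M e (P υ)) ∧
      ∀ υ < N.ord, ∀ υ' < N.ord, υ ≠ υ' → Disjoint (P υ) (P υ'))
    (hκN : Order.succ (Ordinal.cof mu.ord) ≤ N) (hC : ∀ x, IsClubIn (C x) x)
    (hδ : δ < (Order.succ mu).ord) (hNδ : N < δ.cof) :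
    ∃ a < δ, ¬ IsPos mu M e {x | ¬ IsGoodAt C δ a x} := by
  have hκ0 : Cardinal.aleph0 ≤ N := h.isRegular_cof.aleph0_le.trans ((Order.le_succ _).trans hκN)
  have hlim : Order.IsSuccLimit δ :=
    Ordinal.one_lt_cof_iff.1 (Cardinal.one_lt_aleph0.trans (hκ0.trans_lt hNδ))
  have hreg : δ.cof.IsRegular := Cardinal.isRegular_cof hlim
  obtain ⟨s, hs1, hs2, hs3⟩ := exists_cofinal_set δ
  have hδ0 : 0 < δ := pos_iff_ne_zero.2 fun h0 => by simp [h0] at hNδ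
  have hg : ∃ g : Ordinal.{0} → Ordinal.{0}, (∀ i, g i < δ) ∧ ∀ y ∈ s, ∃ i < δ.cof.ord, g i = y := by
    have : Cardinal.mk s ≤ Cardinal.mk (Iio δ.cof.ord) := by
      rw [hs3, Cardinal.mk_Iio_ordinal, Cardinal.card_ord]
    obtain ⟨φ⟩ := this
    classical
    refine ⟨fun i => if hi : ∃ y : s, (φ y : Ordinal) = i then hi.choose.1 else 0,
      fun i => ?_, fun y hy => ⟨φ ⟨y, hy⟩, (φ ⟨y, hy⟩).2, ?_⟩⟩
    · dsimp only
      split_ifs with hi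
      · exact hs1 _ hi.choose.2
      · exact hδ0
    · have hi : ∃ z : s, (φ z : Ordinal) = φ ⟨y, hy⟩ := ⟨_, rfl⟩
      dsimp only
      rw [dif_pos hi]
      exact congrArg Subtype.val (φ.injective (Subtype.ext hi.choose_spec))
  obtain ⟨g, hg1, hg2⟩ := hg
  obtain ⟨j, hj, hjP⟩ := exists_not_isPos_compl (M := M) (e := e) h hN hreg (hκN.trans_lt hNδ)
    (h.cof_lt hδ) hNδ.le (Y := fun j => {x | ∃ i < j, IsGoodAt C δ (g i) x})
    (fun i j hij _ x hx => hx.imp fun i' hi' => ⟨hi'.1.trans_le hij, hi'.2⟩) (fun x => by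
      obtain ⟨y, hy, hyg⟩ := exists_isGoodAt hC hδ0 x
      obtain ⟨z, hz, hyz⟩ := hs2 y hy
      obtain ⟨i, hi, rfl⟩ := hg2 z hz
      exact ⟨Order.succ i, hreg.isSuccLimit_ord.succ_lt hi, i, Order.lt_succ i, hyg.mono hyz⟩)
  obtain ⟨a, ha, hga⟩ := exists_bound_Iio (a := j) (f := g) (Cardinal.lt_ord.1 hj) fun i _ => hg1 i
  refine ⟨a, ha, fun hP => hjP (hP.mono fun x hx => ?_)⟩
  rintro ⟨i, hi, hi'⟩
  exact hx (hi'.mono (hga i hi).le)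

theorem simultaneous_reflection (h : IsSingular mu) {N : Cardinal.{0}}
    (hpos : IsPos mu M e univ)
    (hN : ¬ ∃ P : Ordinal.{0} → Set Ordinal.{0}, (∀ υ < N.ord, IsPos mu M e (P υ)) ∧
      ∀ υ < N.ord, ∀ υ' < N.ord, υ ≠ υ' → Disjoint (P υ) (P υ'))
    (hκN : Order.succ (Ordinal.cof mu.ord) ≤ N) (hNm : N < mu)
    {σ : Cardinal.{0}} (hσ : σ < Ordinal.cof mu.ord) {S : Ordinal.{0} → Set Ordinal.{0}}
    (hS : ∀ i < σ.ord, IsStatIn (S i) (Order.succ mu).ord)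
    (hSN : ∀ i < σ.ord, ∀ δ ∈ S i, N < δ.cof) :
    ∃ δ < (Order.succ mu).ord, ∀ i < σ.ord, IsStatIn (S i ∩ Iio δ) δ := by
  by_contra! hcon
  have hr := h.isRegular_succ
  have hu := h.aleph0_lt_succ
  have h1 : ∀ γ, ∃ C, IsClubIn C γ ∧ (γ < (Order.succ mu).ord →
      ∃ i < σ.ord, ∀ δ ∈ S i, δ < γ → δ ∉ C) := by
    intro γ
    by_cases hγ : γ < (Order.succ mu).ord
    · obtain ⟨i, hi, hns⟩ := hcon γ hγ
      by_contra! hno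
      refine hns ⟨inter_subset_right, fun C hC => ?_⟩
      obtain ⟨δ, h2, h3, h4⟩ := (hno C hC).2 i hi
      exact ⟨δ, ⟨h2, h3⟩, h4⟩
    · exact ⟨Iio γ, isClubIn_Iio, fun hh => absurd hh hγ⟩
  choose C hC hCS using h1
  have h2 : ∀ i < σ.ord, ∀ δ ∈ S i, ∃ a < δ, ¬ IsPos mu M e {x | ¬ IsGoodAt C δ a x} :=
    fun i hi δ hδ => exists_not_isPos_not_isGoodAt h hN hκN hC ((hS i hi).1 hδ) (hSN i hi δ hδ)
  choose! A hA hAP using h2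
  have h3 : ∀ i < σ.ord, ∃ a < (Order.succ mu).ord,
      IsStatIn {δ ∈ S i | A i δ = a} (Order.succ mu).ord :=
    fun i hi => (hS i hi).exists_fiber hr hu (hA i hi)
  choose! b hb hbS using h3
  have hσm : σ < mu := hσ.trans h.2
  obtain ⟨a, ha, hba⟩ := exists_bound_Iio (a := σ.ord) (δ := (Order.succ mu).ord) (f := b)
    (by rw [hr.cof_ord, Cardinal.card_ord]; exact hσm.trans (Order.lt_succ mu)) hb
  have h4 : ∀ i < σ.ord, ∀ v < (Order.succ mu).ord, ∃ δ, δ ∈ S i ∧ A i δ = b i ∧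
      max a v < δ ∧ δ < (Order.succ mu).ord := by
    intro i hi v hv
    obtain ⟨δ, h5, h6, h7⟩ := (hbS i hi).exists_gt hr (max_lt ha hv)
    exact ⟨δ, h5.1, h5.2, h6, h7⟩
  choose! d hdS hdA hdgt hdlt using h4
  have h5 : ∀ v < (Order.succ mu).ord, ∃ w < (Order.succ mu).ord, ∀ i < σ.ord, d i v < w :=
    fun v hv => exists_bound_Iio (a := σ.ord) (f := fun i => d i v)
      (by rw [hr.cof_ord, Cardinal.card_ord]; exact hσm.trans (Order.lt_succ mu))
      fun i hi => hdlt i hi v hv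
  choose! w hw hdw using h5
  obtain ⟨u, hul, huw⟩ := exists_sequence_le hr hw
  have hχ : (Order.succ N).IsRegular := Cardinal.isRegular_succ
    (h.isRegular_cof.aleph0_le.trans ((Order.le_succ _).trans hκN))
  have hχm := h.succ_lt hNm
  have hχl : (Order.succ N).ord < (Order.succ mu).ord :=
    Cardinal.ord_lt_ord.2 (hχm.trans (Order.lt_succ mu))
  let B : Ordinal.{0} → Set Ordinal.{0} := fun m =>
    {x | ∃ i < σ.ord, ¬ IsGoodAt C (d i (u m)) (b i) x}
  have hB : ∀ m < (Order.succ N).ord, ¬ IsPos mu M e (B m) := by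
    intro m hm hP
    have hum := hul m (hm.trans hχl)
    obtain ⟨i, hi, hPi⟩ := (hP.mono (Z := ⋃ i ∈ Iio σ.ord,
      {x | ¬ IsGoodAt C (d i (u m)) (b i) x}) (by
        rintro x ⟨i, hi, hx⟩
        exact mem_iUnion₂.2 ⟨i, hi, hx⟩)).exists_of_biUnion h (by
        rw [CardLT, Cardinal.mk_Iio_ordinal, Cardinal.card_ord]
        exact Cardinal.lift_lt.2 hσ)
    refine hAP i hi _ (hdS i hi _ hum) ?_
    rwa [hdA i hi _ hum]
  have hU : ¬ IsPos mu M e (⋃ j ∈ Iio (Order.succ N).ord,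
      {x | ∀ m, j ≤ m → m < (Order.succ N).ord → x ∈ B m}) := by
    intro hP
    obtain ⟨j, hj, hPj⟩ := hP.exists_of_biUnion_mono h hχ (hκN.trans_lt (Order.lt_succ N)) hχm
      fun i j hij _ x hx m hm hm' => hx m (hij.trans hm) hm'
    exact hB j hj (hPj.mono fun x hx => hx j le_rfl hj)
  obtain ⟨x, hx, hux, hxl⟩ := (hpos.diff h hU).exists_gt h (hul _ hχl)
  have humono : ∀ m' m, m' < m → m < (Order.succ mu).ord → ∀ i < σ.ord, d i (u m') < u m := by
    intro m' m hm hml i hi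
    exact (hdw _ (hul m' (hm.trans hml)) i hi).trans_le (huw m' m hm hml)
  let T : Set Ordinal.{0} := {m | m < (Order.succ N).ord ∧ x ∉ B m}
  have hT : ∀ j < (Order.succ N).ord, ∃ m ∈ T, j ≤ m := by
    intro j hj
    by_contra! hno
    refine hx.2 (mem_iUnion₂.2 ⟨j, hj, fun m hm hm' => ?_⟩)
    by_contra hxB
    exact (hno m ⟨hm', hxB⟩).not_ge hm
  have hTinf : T.Infinite := by
    intro hfin
    obtain ⟨m0, hm0, -⟩ := hT 0 hχ.isSuccLimit_ord.bot_lt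
    obtain ⟨m, hm, hmax⟩ := exists_max_image T id hfin ⟨m0, hm0⟩
    obtain ⟨m', hm', hle⟩ := hT _ (hχ.isSuccLimit_ord.succ_lt hm.1)
    exact (hmax m' hm').not_gt ((Order.lt_succ m).trans_le hle)
  obtain ⟨m, hm, m', hm', hne, heq⟩ := hTinf.exists_ne_map_eq_of_mapsTo
    (f := fun m => walkAbove C a (u m) x) (fun m _ => mem_range_self (u m))
    (finite_range_walkAbove C a x)
  wlog hlt : m < m' generalizing m m'
  · exact this m' hm' m hm hne.symm heq.symm (hne.lt_or_gt.resolve_left hlt)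
  have hml := hm.1.trans hχl
  have hml' := hm'.1.trans hχl
  obtain ⟨i, hi, hiC⟩ := hCS (walkAbove C a (u m) x) (walkAbove_le.trans_lt hxl)
  have hd1 : a < d i (u m) := (le_max_left _ _).trans_lt (hdgt i hi _ (hul m hml))
  have hd2 : u m < d i (u m) := (le_max_right _ _).trans_lt (hdgt i hi _ (hul m hml))
  have hd3 := humono m m' hlt hml' i hi
  have hd4 : u m' < u (Order.succ N).ord := by
    obtain ⟨i, hi⟩ : ∃ i, i < σ.ord := ⟨i, hi⟩
    exact ((le_max_right _ _).trans_lt (hdgt i hi _ (hul m' hml'))).trans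
      (humono _ _ hm'.1 hχl i hi)
  have heq' : walkAbove C a (d i (u m)) x = walkAbove C a (u m) x :=
    le_antisymm ((walkAbove_mono C a x hd3.le).trans_eq heq.symm) (walkAbove_mono C a x hd2.le)
  have hgood : IsGoodAt C (d i (u m)) (b i) x := by
    by_contra hng
    exact hm.2 ⟨i, hi, hng⟩
  have hunb := hgood (hd3.trans (hd4.trans hux)).le a (hba i hi) hd1
  rw [heq'] at hunb
  have hlt' : d i (u m) < walkAbove C a (u m) x := by
    refine hd3.trans_le ((le_walkAbove (hd4.trans hux).le).trans_eq heq.symm)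
  refine hiC _ (hdS i hi _ (hul m hml)) hlt' ((hC _).2.1 _ hlt' (bot_le.trans_lt hd1) ?_)
  intro y hy
  have hlim : Order.IsSuccLimit (d i (u m)) :=
    Ordinal.one_lt_cof_iff.1 (Cardinal.one_lt_aleph0.trans
      ((h.isRegular_cof.aleph0_le.trans ((Order.le_succ _).trans hκN)).trans_lt
        (hSN i hi _ (hdS i hi _ (hul m hml)))))
  obtain ⟨z, hz, h6, h7⟩ := hunb _ (hlim.succ_lt hy)
  exact ⟨z, hz, (Order.lt_succ y).trans_le h6, h7⟩

end Reflection

/-- If `pr₁(μ⁺,μ⁺,μ⁺,cf μ)` fails for a singular `μ`, then there is `θ < μ` such that any fewer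
than `cf(μ)` stationary subsets of `{δ < μ⁺ : cf δ ≥ θ}` reflect simultaneously at some `δ < μ⁺`. -/
theorem stmt2 (mu : Cardinal) (hsing : IsSingular mu)
    (hfail : ¬ Pr1 mu (Order.succ mu)) :
    ∃ θ : Cardinal, θ < mu ∧
      ∀ σ : Cardinal, σ < Ordinal.cof mu.ord →
        ∀ Sseq : Ordinal → Set Ordinal,
          (∀ a, a < σ.ord →
            Sseq a ⊆ {δ | δ < sucOrd mu ∧ θ ≤ Ordinal.cof δ} ∧
            IsStatIn (Sseq a) (sucOrd mu)) →
          ∃ δ, δ < sucOrd mu ∧ ∀ a, a < σ.ord → IsStatIn (Sseq a ∩ Set.Iio δ) δ := by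
  obtain ⟨M, hM⟩ := hsing.exists_isLayering
  obtain ⟨e, he⟩ := hsing.exists_isLadderSystem hM
  obtain ⟨g, f, hf⟩ := hsing.exists_isTrueScale
  have h1 : ∃ k, ¬ ∃ P : Ordinal.{0} → Set Ordinal.{0},
      (∀ υ < (M k).ord, IsPos mu M e (P υ)) ∧
      ∀ υ < (M k).ord, ∀ υ' < (M k).ord, υ ≠ υ' → Disjoint (P υ) (P υ') := by
    by_contra hcon
    rw [not_exists] at hcon
    choose P hP hdis using fun k => not_not.1 (hcon k)
    exact hfail (pr1With_of_isPos hsing hf hM he hP hdis)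
  obtain ⟨k, hk⟩ := h1
  refine ⟨Order.succ (M k), hsing.succ_lt (hM.lt k), fun σ hσ S hS => ?_⟩
  exact simultaneous_reflection hsing (he.isPos_univ hsing) hk (hM.succ_cof_le k) (hM.lt k) hσ
    (fun i hi => (hS i hi).2)
    fun i hi δ hδ => (Order.lt_succ (M k)).trans_le ((hS i hi).1 hδ).2

end
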